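/- arXiv:2005.13330 — 4 statements merged into one kernel-verified Lean document; each statement's English description precedes it below -/
import Mathlib

section
/- Berberan-Santos' integral for the double argument: let a be a real number with 0 < a ≤ 1, b > 0 a real number, and s > 0 a real number. Then E_{a,b}(−s) = (2s/π) · ∫_0^∞ E_{2a,b}(−w²) / (s² + w²) dw. -/
open MeasureTheory

/-- The (real) Mittag-Leffler function `E_{a,b}(x) = ∑_{k=0}^∞ x^k / Γ(b + a k)` for real
parameters and real argument. -/
noncomputable def mittagLefflerReal (a b x : ℝ) : ℝ :=
  ∑' k : ℕ, x ^ k / Real.Gamma (b + a * k)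


/-! ### Laplace transform of powers -/

lemma bs_gam_int {q r : ℝ} (hq : -1 < q) (hr : 0 < r) :
    IntegrableOn (fun t : ℝ => t ^ q * Real.exp (-(r * t))) (Set.Ioi 0) := by
  have := integrableOn_rpow_mul_exp_neg_mul_rpow (p := 1) hq one_pos hr
  simpa [Real.rpow_one] using this

lemma bs_cint {q : ℝ} {z : ℂ} (hq : -1 < q) (hz : 0 < z.re) :
    IntegrableOn (fun t : ℝ => ((t ^ q : ℝ) : ℂ) * Complex.exp (-(z * t))) (Set.Ioi 0) := by
  refine (bs_gam_int hq hz).mono' ?_ ?_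
  · apply Measurable.aestronglyMeasurable
    fun_prop
  · filter_upwards [ae_restrict_mem measurableSet_Ioi] with t ht
    rw [norm_mul, Complex.norm_real, Complex.norm_exp]
    rw [Real.norm_of_nonneg (Real.rpow_nonneg (le_of_lt ht) _)]
    simp

lemma bs_laplace_diff {q : ℝ} {z : ℂ} (hq : -1 < q) (hz : 0 < z.re) :
    DifferentiableAt ℂ
      (fun z : ℂ => ∫ t in Set.Ioi (0:ℝ), ((t ^ q : ℝ) : ℂ) * Complex.exp (-(z * t))) z := by
  have hb : Metric.ball z (z.re / 2) ∈ nhds z := Metric.ball_mem_nhds _ (by linarith)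
  have key := hasDerivAt_integral_of_dominated_loc_of_deriv_le (𝕜 := ℂ)
    (μ := volume.restrict (Set.Ioi (0:ℝ)))
    (F := fun (z : ℂ) (t : ℝ) => ((t ^ q : ℝ) : ℂ) * Complex.exp (-(z * t)))
    (F' := fun (z : ℂ) (t : ℝ) => ((t ^ q : ℝ) : ℂ) * (Complex.exp (-(z * t)) * (-(t:ℂ))))
    (x₀ := z) (bound := fun t => t ^ (q + 1) * Real.exp (-(z.re / 2 * t))) hb
    ?_ (bs_cint hq hz) ?_ ?_ (bs_gam_int (by linarith) (by linarith)) ?_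
  · exact key.2.differentiableAt
  · refine Filter.Eventually.of_forall fun x => ?_
    apply Measurable.aestronglyMeasurable
    fun_prop
  · apply Measurable.aestronglyMeasurable
    fun_prop
  · filter_upwards [ae_restrict_mem measurableSet_Ioi] with t ht x hx
    have ht : 0 < t := ht
    rw [norm_mul, norm_mul, Complex.norm_real, Complex.norm_exp, norm_neg, Complex.norm_real,
      Real.norm_of_nonneg (Real.rpow_nonneg ht.le _), Real.norm_of_nonneg ht.le,
      Real.rpow_add_one ht.ne']
    have h1 : z.re / 2 ≤ x.re := by
      have h2 : |(x - z).re| ≤ ‖x - z‖ := Complex.abs_re_le_norm _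
      rw [Metric.mem_ball, dist_eq_norm] at hx
      rw [Complex.sub_re] at h2
      have := (abs_le.1 h2).1
      linarith
    have h3 : Real.exp ((-(x * (t:ℂ))).re) ≤ Real.exp (-(z.re / 2 * t)) := by
      apply Real.exp_le_exp.2
      simp
      nlinarith
    have h4 : 0 ≤ t ^ q := Real.rpow_nonneg ht.le _
    calc _ = t ^ q * t * Real.exp ((-(x * (t:ℂ))).re) := by ring
      _ ≤ _ := by gcongr
  · refine Filter.Eventually.of_forall fun t x _ => ?_
    apply HasDerivAt.const_mul
    apply HasDerivAt.cexp
    simpa using ((hasDerivAt_id x).mul_const (t:ℂ)).fun_neg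

lemma bs_laplace {p : ℝ} {z : ℂ} (hp : 0 < p) (hz : 0 < z.re) :
    ∫ t in Set.Ioi (0:ℝ), ((t ^ (p - 1) : ℝ) : ℂ) * Complex.exp (-(z * t))
      = z ^ (-(p:ℂ)) * Real.Gamma p := by
  have hU : IsOpen {z : ℂ | 0 < z.re} := isOpen_lt continuous_const Complex.continuous_re
  have hf : AnalyticOnNhd ℂ
      (fun z : ℂ => ∫ t in Set.Ioi (0:ℝ), ((t ^ (p - 1) : ℝ) : ℂ) * Complex.exp (-(z * t)))
      {z : ℂ | 0 < z.re} := by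
    apply DifferentiableOn.analyticOnNhd _ hU
    intro w hw
    exact (bs_laplace_diff (by linarith) hw).differentiableWithinAt
  have hg : AnalyticOnNhd ℂ (fun z : ℂ => z ^ (-(p:ℂ)) * Real.Gamma p) {z : ℂ | 0 < z.re} := by
    apply DifferentiableOn.analyticOnNhd _ hU
    intro w hw
    apply DifferentiableAt.differentiableWithinAt
    apply DifferentiableAt.mul_const
    apply DifferentiableAt.cpow_const differentiableAt_id
    exact Or.inl hw
  have hconn : IsPreconnected {z : ℂ | 0 < z.re} :=
    (convex_halfSpace_re_gt 0).isPreconnected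
  refine hf.eqOn_of_preconnected_of_frequently_eq hg hconn (z₀ := 1) (by simp) ?_ hz
  have hreal : ∀ r : ℝ, 0 < r →
      ∫ t in Set.Ioi (0:ℝ), ((t ^ (p - 1) : ℝ) : ℂ) * Complex.exp (-((r:ℂ) * t))
        = (r:ℂ) ^ (-(p:ℂ)) * Real.Gamma p := by
    intro r hr
    have h := Complex.integral_cpow_mul_exp_neg_mul_Ioi (a := (p:ℂ)) (r := r) (by simpa using hp) hr
    rw [Complex.Gamma_ofReal] at h
    rw [Complex.cpow_neg, ← one_div, ← one_div_one_div ((r:ℂ) ^ (p:ℂ))]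
    rw [one_div_one_div]
    rw [one_div (r:ℂ), Complex.inv_cpow] at h
    · rw [one_div, ← h]
      refine setIntegral_congr_fun measurableSet_Ioi fun t ht => ?_
      have ht : 0 < t := ht
      rw [Complex.ofReal_cpow ht.le]
      push_cast
      rfl
    · rw [Complex.arg_ofReal_of_nonneg hr.le]
      exact Real.pi_pos.ne
  have htend : Filter.Tendsto (fun n : ℕ => ((1 + 1 / ((n:ℝ) + 1) : ℝ) : ℂ)) Filter.atTop
      (nhdsWithin 1 {1}ᶜ) := by
    apply tendsto_nhdsWithin_iff.2
    constructor
    · have : Filter.Tendsto (fun n : ℕ => (1 + 1 / ((n:ℝ) + 1) : ℝ)) Filter.atTop (nhds 1) := by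
        simpa using (tendsto_one_div_add_atTop_nhds_zero_nat (𝕜 := ℝ)).const_add 1
      have h2 := (Complex.continuous_ofReal.tendsto 1).comp this
      simpa [Function.comp_def] using h2
    · refine Filter.Eventually.of_forall fun n => ?_
      have : (0:ℝ) < 1 / ((n:ℝ) + 1) := by positivity
      intro h
      have h' : ((1 + 1 / ((n:ℝ) + 1) : ℝ) : ℂ) = 1 := h
      have : (1 + 1 / ((n:ℝ) + 1) : ℝ) = 1 := by exact_mod_cast h'
      linarith
  apply htend.frequently
  apply Filter.Frequently.of_forall
  intro n
  exact hreal _ (by positivity)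

/-! ### The vertical line -/

lemma bs_int_line {c p : ℝ} (hc : 1 ≤ c) (hp : 1 < p) :
    Integrable (fun y : ℝ => ‖(c:ℂ) + y * Complex.I‖ ^ (-p)) := by
  have h := integrable_rpow_neg_one_add_norm_sq (E := ℝ) (μ := volume) (r := p) (by simpa using hp)
  refine h.mono' ?_ ?_
  · apply Measurable.aestronglyMeasurable
    fun_prop
  · refine Filter.Eventually.of_forall fun y => ?_
    rw [Real.norm_of_nonneg (by positivity)]
    have h1 : ‖(c:ℂ) + y * Complex.I‖ = (c ^ 2 + y ^ 2) ^ (1 / 2 : ℝ) := by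
      rw [Complex.norm_add_mul_I, Real.sqrt_eq_rpow]
    rw [h1, ← Real.rpow_mul (by positivity)]
    rw [show (1 / 2 : ℝ) * -p = -p / 2 by ring]
    apply Real.rpow_le_rpow_of_nonpos (by positivity)
    · have : ‖y‖ ^ 2 = y ^ 2 := by simp
      nlinarith
    · linarith

lemma bs_zre {c : ℝ} (y : ℝ) : ((c:ℂ) + y * Complex.I).re = c := by simp

lemma bs_zcont (c : ℝ) : Continuous fun y : ℝ => (c:ℂ) + y * Complex.I := by fun_prop

lemma bs_cpow_cont {c : ℝ} (hc : 1 ≤ c) (p : ℂ) :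
    Continuous fun y : ℝ => ((c:ℂ) + y * Complex.I) ^ p := by
  apply (bs_zcont c).cpow continuous_const
  intro y
  left
  rw [bs_zre]; linarith

lemma bs_invGamma {c p : ℝ} (hc : 1 ≤ c) (hp : 1 < p) :
    ∫ y : ℝ, Complex.exp ((c:ℂ) + y * Complex.I) * ((c:ℂ) + y * Complex.I) ^ (-(p:ℂ))
      = 2 * Real.pi / Real.Gamma p := by
  set g : ℝ → ℂ := Set.indicator (Set.Ioi 0)
    (fun t : ℝ => ((t ^ (p - 1) : ℝ) : ℂ) * Complex.exp (-((c:ℂ) * t))) with hg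
  have hgi : Integrable g :=
    (integrable_indicator_iff measurableSet_Ioi).2 (bs_cint (by linarith) (by simp; linarith))
  have hF : ∀ ξ : ℝ, FourierTransform.fourier g ξ
      = ((c:ℂ) + (2 * Real.pi * ξ : ℝ) * Complex.I) ^ (-(p:ℂ)) * Real.Gamma p := by
    intro ξ
    rw [Real.fourier_real_eq_integral_exp_smul, ← bs_laplace (by linarith)
      (by rw [bs_zre]; linarith), ← integral_indicator measurableSet_Ioi]
    congr 1
    ext t
    by_cases ht : t ∈ Set.Ioi (0:ℝ)
    · simp only [hg, Set.indicator_of_mem ht, smul_eq_mul]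
      rw [mul_left_comm, ← Complex.exp_add]
      congr 2
      push_cast
      ring
    · simp [hg, Set.indicator_of_notMem ht]
  have hFi : Integrable (FourierTransform.fourier g) := by
    rw [show FourierTransform.fourier g = _ from funext hF]
    apply Integrable.mul_const
    have h0 : Integrable fun y : ℝ => ((c:ℂ) + y * Complex.I) ^ (-(p:ℂ)) := by
      refine (bs_int_line hc hp).mono' (bs_cpow_cont hc _).aestronglyMeasurable ?_
      refine Filter.Eventually.of_forall fun y => ?_
      rw [← Complex.ofReal_neg, Complex.norm_cpow_real]
    exact h0.comp_mul_left' (R := 2 * Real.pi) (by positivity)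
  have hcont : ContinuousAt g 1 := by
    have : (fun t : ℝ => ((t ^ (p - 1) : ℝ) : ℂ) * Complex.exp (-((c:ℂ) * t))) =ᶠ[nhds 1] g := by
      filter_upwards [Ioi_mem_nhds (show (0:ℝ) < 1 by norm_num)] with t ht
      rw [hg, Set.indicator_of_mem ht]
    refine ContinuousAt.congr ?_ this
    apply ContinuousAt.mul
    · apply Complex.continuous_ofReal.continuousAt.comp
      exact Real.continuousAt_rpow_const _ _ (Or.inl one_ne_zero)
    · fun_prop
  have hinv := hgi.fourierInv_fourier_eq hFi hcont
  rw [Real.fourierInv_eq', show FourierTransform.fourier g = _ from funext hF] at hinv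
  have hg1 : g 1 = Complex.exp (-(c:ℂ)) := by simp [hg]
  rw [hg1] at hinv
  have hG : (Real.Gamma p : ℂ) ≠ 0 := by
    exact_mod_cast (Real.Gamma_pos_of_pos (by linarith)).ne'
  have hsub := Measure.integral_comp_mul_left (fun y : ℝ => Complex.exp ((c:ℂ) + y * Complex.I) *
    ((c:ℂ) + y * Complex.I) ^ (-(p:ℂ))) (2 * Real.pi)
  have h2 : ∫ ξ : ℝ, Complex.exp ((c:ℂ) + (2 * Real.pi * ξ : ℝ) * Complex.I) *
      ((c:ℂ) + (2 * Real.pi * ξ : ℝ) * Complex.I) ^ (-(p:ℂ)) = 1 / Real.Gamma p := by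
    have : ∀ ξ : ℝ, Complex.exp ((c:ℂ) + (2 * Real.pi * ξ : ℝ) * Complex.I) *
      ((c:ℂ) + (2 * Real.pi * ξ : ℝ) * Complex.I) ^ (-(p:ℂ)) = (Complex.exp c / Real.Gamma p) *
       (Complex.exp (((2 * Real.pi * inner ℝ ξ (1:ℝ) : ℝ) : ℂ) * Complex.I) •
        (((c:ℂ) + (2 * Real.pi * ξ : ℝ) * Complex.I) ^ (-(p:ℂ)) * Real.Gamma p)) := by
      intro ξ
      rw [Complex.exp_add, smul_eq_mul]
      simp
      field_simp
    simp_rw [this]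
    rw [integral_const_mul, hinv, div_mul_eq_mul_div, ← Complex.exp_add]
    simp
  rw [h2] at hsub
  have hpi : (Real.pi : ℂ) ≠ 0 := by exact_mod_cast Real.pi_ne_zero
  rw [abs_of_pos (by positivity), Complex.real_smul] at hsub
  push_cast at hsub
  field_simp at hsub
  field_simp
  rw [hsub, mul_comm]

/-! ### The kernel -/

lemma bs_Vre {a c : ℝ} (ha0 : 0 < a) (ha1 : a ≤ 1) (hc : 1 ≤ c) (y : ℝ) :
    c ^ a ≤ ((((c:ℂ) + y * Complex.I)) ^ (a:ℂ)).re := by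
  set ζ : ℂ := (c:ℂ) + y * Complex.I with hζ
  have hre : ζ.re = c := bs_zre y
  have hφ : |ζ.arg| < Real.pi / 2 := Complex.abs_arg_lt_pi_div_two_iff.2 (Or.inl (by linarith))
  rw [Complex.cpow_ofReal_re]
  have h1 : ‖ζ‖ * Real.cos ζ.arg = c := by rw [Complex.norm_mul_cos_arg, hre]
  have hcos : 0 ≤ Real.cos ζ.arg :=
    Real.cos_nonneg_of_mem_Icc ⟨by linarith [(abs_lt.1 hφ).1], by linarith [(abs_lt.1 hφ).2]⟩
  have h2 : (Real.cos ζ.arg) ^ a ≤ Real.cos (ζ.arg * a) := by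
    have hconc := strictConcaveOn_cos_Icc.concaveOn.2
      (x := ζ.arg) ⟨by linarith [(abs_lt.1 hφ).1], by linarith [(abs_lt.1 hφ).2]⟩
      (y := 0) ⟨by linarith [Real.pi_pos], by linarith [Real.pi_pos]⟩
      ha0.le (sub_nonneg.2 ha1) (by ring)
    have ham := Real.geom_mean_le_arith_mean2_weighted ha0.le (sub_nonneg.2 ha1) hcos
      (zero_le_one) (by ring)
    simp only [smul_eq_mul, mul_zero, add_zero, Real.cos_zero] at hconc
    rw [Real.one_rpow, mul_one] at ham
    rw [mul_comm ζ.arg a]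
    linarith
  calc c ^ a = ‖ζ‖ ^ a * (Real.cos ζ.arg) ^ a := by
        rw [← h1, Real.mul_rpow (norm_nonneg _) hcos]
    _ ≤ _ := by gcongr

/-- The integrated-by-parts kernel. -/
noncomputable def bsK (a b : ℝ) (ζ z : ℂ) : ℂ :=
  ζ ^ ((-(b + 1) : ℝ) : ℂ) *
    ((b - a) * (ζ ^ (a:ℂ) / (ζ ^ (a:ℂ) - z)) + a * (ζ ^ (a:ℂ) / (ζ ^ (a:ℂ) - z)) ^ 2)

/-- The contour integral. -/
noncomputable def bsG (a b c : ℝ) (z : ℂ) : ℂ :=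
  ∫ y : ℝ, Complex.exp ((c:ℂ) + y * Complex.I) * bsK a b ((c:ℂ) + y * Complex.I) z

lemma bs_ne {a c : ℝ} (ha0 : 0 < a) (ha1 : a ≤ 1) (hc : 1 ≤ c) (y : ℝ) {z : ℂ}
    (hz : z.re < c ^ a) : ((c:ℂ) + y * Complex.I) ^ (a:ℂ) - z ≠ 0 := by
  intro h
  have := congrArg Complex.re h
  rw [Complex.sub_re, Complex.zero_re] at this
  linarith [bs_Vre ha0 ha1 hc y]

lemma bs_normexp {c : ℝ} (y : ℝ) : ‖Complex.exp ((c:ℂ) + y * Complex.I)‖ = Real.exp c := by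
  rw [Complex.norm_exp, bs_zre]

lemma bs_series {a b c : ℝ} (ha0 : 0 < a) (hb : 0 < b) (hc : 1 ≤ c) {z : ℂ}
    (hz : ‖z‖ < c ^ a) :
    HasSum (fun k : ℕ => z ^ k / (Real.Gamma (b + a * k) : ℂ)) (1 / (2 * Real.pi) * bsG a b c z) := by
  have hca : 0 < c ^ a := Real.rpow_pos_of_pos (by linarith) _
  set r : ℝ := ‖z‖ / c ^ a with hr
  have hr0 : 0 ≤ r := by positivity
  have hr1 : r < 1 := (div_lt_one hca).2 hz
  set F : ℕ → ℝ → ℂ := fun k y => (z ^ k * ((b + a * k : ℝ) : ℂ)) *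
    (Complex.exp ((c:ℂ) + y * Complex.I) *
      ((c:ℂ) + y * Complex.I) ^ (-((b + a * k + 1 : ℝ) : ℂ))) with hF
  have hζ0 : ∀ y : ℝ, (c:ℂ) + y * Complex.I ≠ 0 := by
    intro y h
    have := congrArg Complex.re h
    rw [bs_zre] at this
    simp at this; linarith
  have hζc : ∀ y : ℝ, c ≤ ‖(c:ℂ) + y * Complex.I‖ := by
    intro y
    have := Complex.re_le_norm ((c:ℂ) + y * Complex.I)
    rwa [bs_zre] at this
  have hnorm : ∀ k y, ‖F k y‖ ≤ (r ^ k * (b + a * k) * Real.exp c) *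
      ‖(c:ℂ) + y * Complex.I‖ ^ (-(b + 1)) := by
    intro k y
    have hpos : 0 < ‖(c:ℂ) + y * Complex.I‖ := norm_pos_iff.2 (hζ0 y)
    simp only [hF]
    rw [norm_mul, norm_mul, norm_mul, bs_normexp, ← Complex.ofReal_neg, Complex.norm_cpow_real,
      norm_pow, Complex.norm_real, Real.norm_of_nonneg (by positivity),
      show -(b + a * k + 1) = -(b + 1) + -(a * k) by ring, Real.rpow_add hpos]
    have h1 : ‖(c:ℂ) + y * Complex.I‖ ^ (-(a * k)) ≤ ((c ^ a) ^ k)⁻¹ := by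
      rw [← Real.rpow_natCast, ← Real.rpow_mul (by linarith), ← Real.rpow_neg (by linarith)]
      apply Real.rpow_le_rpow_of_nonpos (by linarith) (hζc y)
      have : 0 ≤ a * k := by positivity
      linarith
    calc _ ≤ ‖z‖ ^ k * (b + a * k) * (Real.exp c * (‖(c:ℂ) + y * Complex.I‖ ^ (-(b + 1)) *
          ((c ^ a) ^ k)⁻¹)) := by gcongr
      _ = _ := by rw [hr, div_pow]; field_simp
  have hint0 := bs_int_line hc (p := b + 1) (by linarith)
  have hFi : ∀ k, Integrable (F k) := by
    intro k
    refine (hint0.const_mul (r ^ k * (b + a * k) * Real.exp c)).mono' ?_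
      (Filter.Eventually.of_forall (hnorm k))
    apply Continuous.aestronglyMeasurable
    exact continuous_const.mul ((Complex.continuous_exp.comp (bs_zcont c)).mul (bs_cpow_cont hc _))
  have hsumr : Summable fun k : ℕ => r ^ k * (b + a * k) * Real.exp c := by
    apply Summable.mul_right
    have h1 : Summable fun k : ℕ => r ^ k := summable_geometric_of_lt_one hr0 hr1
    have h2 := summable_pow_mul_geometric_of_norm_lt_one (R := ℝ) 1 (r := r)
      (by rwa [Real.norm_of_nonneg hr0])
    refine ((h1.mul_left b).add (h2.mul_left a)).congr fun k => ?_
    simp; ring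
  have hsum : Summable fun k => ∫ y, ‖F k y‖ := by
    refine Summable.of_nonneg_of_le (fun k => integral_nonneg fun y => norm_nonneg _) (fun k => ?_)
      (hsumr.mul_right (∫ y : ℝ, ‖(c:ℂ) + y * Complex.I‖ ^ (-(b + 1))))
    rw [← integral_const_mul]
    exact integral_mono (hFi k).norm (hint0.const_mul _) (hnorm k)
  have key := hasSum_integral_of_summable_integral_norm hFi hsum
  have hterm : ∀ k, ∫ y, F k y = 2 * Real.pi * (z ^ k / (Real.Gamma (b + a * k) : ℂ)) := by
    intro k
    have hpos : 0 < b + a * k := by positivity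
    simp only [hF]
    rw [integral_const_mul, bs_invGamma hc (by linarith), Real.Gamma_add_one hpos.ne']
    have h1 : (Real.Gamma (b + a * k) : ℂ) ≠ 0 := by
      exact_mod_cast (Real.Gamma_pos_of_pos hpos).ne'
    have h2 : ((b + a * k : ℝ) : ℂ) ≠ 0 := by exact_mod_cast hpos.ne'
    rw [Complex.ofReal_mul]
    field_simp
  have hpt : ∀ y : ℝ, ∑' k, F k y =
      Complex.exp ((c:ℂ) + y * Complex.I) * bsK a b ((c:ℂ) + y * Complex.I) z := by
    intro y
    apply HasSum.tsum_eq
    set ζ := (c:ℂ) + y * Complex.I with hζ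
    set v := ζ ^ (a:ℂ) with hv
    have hvn : c ^ a ≤ ‖v‖ := by
      rw [hv, Complex.norm_cpow_real]
      exact Real.rpow_le_rpow (by linarith) (hζc y) ha0.le
    have hv0 : v ≠ 0 := by
      rw [← norm_pos_iff]; linarith
    have hvz : v - z ≠ 0 := by
      intro h
      have : v = z := sub_eq_zero.1 h
      rw [this] at hvn; linarith
    have hx : ‖z / v‖ < 1 := by
      rw [norm_div, div_lt_one (by linarith)]
      linarith
    have h1 := hasSum_geometric_of_norm_lt_one hx
    have h2 := hasSum_coe_mul_geometric_of_norm_lt_one hx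
    have h3 := ((h1.mul_left (b:ℂ)).add (h2.mul_left (a:ℂ))).mul_left
      (Complex.exp ζ * ζ ^ ((-(b + 1) : ℝ) : ℂ))
    have e1 : ∀ k, F k y = Complex.exp ζ * ζ ^ ((-(b + 1) : ℝ) : ℂ) *
        (b * (z / v) ^ k + a * (k * (z / v) ^ k)) := by
      intro k
      simp only [hF]
      have : ζ ^ (-((b + a * k + 1 : ℝ) : ℂ)) = ζ ^ ((-(b + 1) : ℝ) : ℂ) * (v ^ k)⁻¹ := by
        rw [hv, ← Complex.cpow_mul_nat, ← Complex.cpow_neg, ← Complex.cpow_add _ _ (hζ0 y)]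
        congr 1
        push_cast
        ring
      rw [← hζ, this, div_pow]
      push_cast
      field_simp
    have e2 : Complex.exp ζ * bsK a b ζ z = Complex.exp ζ * ζ ^ ((-(b + 1) : ℝ) : ℂ) *
        (b * (1 - z / v)⁻¹ + a * (z / v / (1 - z / v) ^ 2)) := by
      rw [bsK, ← hv]
      have h1v : 1 - z / v = (v - z) / v := by field_simp
      rw [h1v]
      field_simp
      ring
    rw [e2]
    rw [show (fun k => F k y) = _ from funext e1]
    exact h3
  simp_rw [hterm, hpt] at key
  have hpi : (Real.pi : ℂ) ≠ 0 := by exact_mod_cast Real.pi_ne_zero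
  have := key.mul_left (1 / (2 * (Real.pi : ℂ)))
  have e3 : (fun k : ℕ => z ^ k / (Real.Gamma (b + a * k) : ℂ)) = fun k : ℕ =>
      1 / (2 * (Real.pi : ℂ)) * (2 * Real.pi * (z ^ k / (Real.Gamma (b + a * k) : ℂ))) := by
    funext k
    field_simp
  rw [e3]
  exact this

lemma bsK_cont {a b c : ℝ} (ha0 : 0 < a) (ha1 : a ≤ 1) (hc : 1 ≤ c) {z : ℂ}
    (hz : z.re < c ^ a) :
    Continuous fun y : ℝ => Complex.exp ((c:ℂ) + y * Complex.I) *
      bsK a b ((c:ℂ) + y * Complex.I) z := by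
  have hq : Continuous fun y : ℝ => ((c:ℂ) + y * Complex.I) ^ (a:ℂ) /
      (((c:ℂ) + y * Complex.I) ^ (a:ℂ) - z) :=
    (bs_cpow_cont hc _).div ((bs_cpow_cont hc _).sub continuous_const)
      (fun y => bs_ne ha0 ha1 hc y hz)
  unfold bsK
  exact (Complex.continuous_exp.comp (bs_zcont c)).mul ((bs_cpow_cont hc _).mul
    ((continuous_const.mul hq).add (continuous_const.mul (hq.pow 2))))

lemma bsG_diff {a b c : ℝ} (ha0 : 0 < a) (ha1 : a ≤ 1) (hb : 0 < b) (hc : 1 ≤ c) {z : ℂ}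
    (hz : z.re < c ^ a) : DifferentiableAt ℂ (bsG a b c) z := by
  set ε : ℝ := (c ^ a - z.re) / 2 with hε
  have hε0 : 0 < ε := by rw [hε]; linarith
  have hball : Metric.ball z ε ∈ nhds z := Metric.ball_mem_nhds _ hε0
  set B : ℝ := 1 + (‖z‖ + ε) / ε with hB
  have hB0 : 0 ≤ B := by positivity
  have hin : ∀ x ∈ Metric.ball z ε, x.re < c ^ a ∧ ∀ y : ℝ,
      ε ≤ ‖((c:ℂ) + y * Complex.I) ^ (a:ℂ) - x‖ ∧
      ‖((c:ℂ) + y * Complex.I) ^ (a:ℂ) / (((c:ℂ) + y * Complex.I) ^ (a:ℂ) - x)‖ ≤ B := by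
    intro x hx
    rw [Metric.mem_ball, dist_eq_norm] at hx
    have h2 : (x - z).re ≤ ‖x - z‖ := Complex.re_le_norm _
    rw [Complex.sub_re] at h2
    have hxr : x.re ≤ c ^ a - ε := by rw [hε] at hx ⊢; linarith
    refine ⟨by linarith, fun y => ?_⟩
    have h3 : ε ≤ ‖((c:ℂ) + y * Complex.I) ^ (a:ℂ) - x‖ := by
      have h4 := Complex.re_le_norm (((c:ℂ) + y * Complex.I) ^ (a:ℂ) - x)
      rw [Complex.sub_re] at h4
      linarith [bs_Vre ha0 ha1 hc y]
    refine ⟨h3, ?_⟩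
    set v := ((c:ℂ) + y * Complex.I) ^ (a:ℂ)
    have hxn : ‖x‖ ≤ ‖z‖ + ε := by
      have := norm_add_le (x - z) z
      rw [sub_add_cancel] at this
      linarith
    have hv : ‖v‖ ≤ ‖v - x‖ + (‖z‖ + ε) := by
      have := norm_add_le (v - x) x
      rw [sub_add_cancel] at this
      linarith
    rw [norm_div, div_le_iff₀ (by linarith)]
    rw [hB, add_mul, one_mul]
    have : (‖z‖ + ε) ≤ (‖z‖ + ε) / ε * ‖v - x‖ := by
      rw [div_mul_eq_mul_div, le_div_iff₀ hε0]
      gcongr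
    linarith
  have hint0 := bs_int_line hc (p := b + 1) (by linarith)
  have hzb := Metric.mem_ball_self (x := z) hε0
  have key := hasDerivAt_integral_of_dominated_loc_of_deriv_le (𝕜 := ℂ)
    (μ := (volume : Measure ℝ))
    (F := fun (z : ℂ) (y : ℝ) => Complex.exp ((c:ℂ) + y * Complex.I) *
      bsK a b ((c:ℂ) + y * Complex.I) z)
    (F' := fun (z : ℂ) (y : ℝ) => Complex.exp ((c:ℂ) + y * Complex.I) *
      (((c:ℂ) + y * Complex.I) ^ ((-(b + 1) : ℝ) : ℂ) *
        ((((b - a) + 2 * a * (((c:ℂ) + y * Complex.I) ^ (a:ℂ) /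
          (((c:ℂ) + y * Complex.I) ^ (a:ℂ) - z)))) * (((c:ℂ) + y * Complex.I) ^ (a:ℂ) /
          (((c:ℂ) + y * Complex.I) ^ (a:ℂ) - z) / (((c:ℂ) + y * Complex.I) ^ (a:ℂ) - z)))))
    (x₀ := z) (bound := fun y : ℝ => Real.exp c * ((|b - a| + 2 * a * B) * (B / ε)) *
      ‖(c:ℂ) + y * Complex.I‖ ^ (-(b + 1))) hball
    ?_ ?_ ?_ ?_ (hint0.const_mul _) ?_
  · exact key.2.differentiableAt
  · filter_upwards [hball] with x hx
    exact (bsK_cont ha0 ha1 hc (hin x hx).1).aestronglyMeasurable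
  · refine (hint0.const_mul (Real.exp c * (|b - a| * B + a * B ^ 2))).mono'
      (bsK_cont ha0 ha1 hc hz).aestronglyMeasurable (Filter.Eventually.of_forall fun y => ?_)
    rw [bsK, norm_mul, norm_mul, bs_normexp, Complex.norm_cpow_real]
    have h := (hin z hzb).2 y
    set v := ((c:ℂ) + y * Complex.I) ^ (a:ℂ)
    have h5 : ‖((b:ℂ) - a) * (v / (v - z)) + a * (v / (v - z)) ^ 2‖ ≤ |b - a| * B + a * B ^ 2 := by
      refine (norm_add_le _ _).trans ?_
      rw [norm_mul, norm_mul, norm_pow, ← Complex.ofReal_sub, Complex.norm_real, Complex.norm_real,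
        Real.norm_eq_abs, Real.norm_of_nonneg ha0.le]
      have := h.2
      gcongr
    calc _ ≤ Real.exp c * (‖(c:ℂ) + y * Complex.I‖ ^ (-(b + 1)) * (|b - a| * B + a * B ^ 2)) := by
          gcongr
      _ = _ := by ring
  · apply Continuous.aestronglyMeasurable
    have hd := ((bs_cpow_cont hc (a:ℂ)).sub (continuous_const (y := z)))
    have hq : Continuous fun y : ℝ => ((c:ℂ) + y * Complex.I) ^ (a:ℂ) /
        (((c:ℂ) + y * Complex.I) ^ (a:ℂ) - z) :=
      (bs_cpow_cont hc _).div hd (fun y => bs_ne ha0 ha1 hc y hz)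
    exact (Complex.continuous_exp.comp (bs_zcont c)).mul ((bs_cpow_cont hc _).mul
      ((continuous_const.add (continuous_const.mul hq)).mul
        (hq.div hd (fun y => bs_ne ha0 ha1 hc y hz))))
  · refine Filter.Eventually.of_forall fun y x hx => ?_
    rw [norm_mul, norm_mul, bs_normexp, Complex.norm_cpow_real]
    have h := (hin x hx).2 y
    set v := ((c:ℂ) + y * Complex.I) ^ (a:ℂ)
    have h5 : ‖((b:ℂ) - a) + 2 * a * (v / (v - x))‖ ≤ |b - a| + 2 * a * B := by
      refine (norm_add_le _ _).trans ?_
      rw [norm_mul, norm_mul, ← Complex.ofReal_sub, Complex.norm_real, Complex.norm_real,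
        Real.norm_eq_abs, Real.norm_of_nonneg ha0.le, Complex.norm_two]
      have := h.2
      gcongr
    have h6 : ‖v / (v - x) / (v - x)‖ ≤ B / ε := by
      rw [norm_div]
      exact div_le_div₀ hB0 h.2 hε0 h.1
    rw [norm_mul (((b:ℂ) - a) + 2 * a * (v / (v - x)))]
    calc _ ≤ Real.exp c * (‖(c:ℂ) + y * Complex.I‖ ^ (-(b + 1)) *
          ((|b - a| + 2 * a * B) * (B / ε))) := by gcongr
      _ = _ := by ring
  · refine Filter.Eventually.of_forall fun y x hx => ?_
    have hne := bs_ne ha0 ha1 hc y (hin x hx).1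
    unfold bsK
    apply HasDerivAt.const_mul
    apply HasDerivAt.const_mul
    set v := ((c:ℂ) + y * Complex.I) ^ (a:ℂ)
    have hq : HasDerivAt (fun x : ℂ => v / (v - x)) (v / (v - x) / (v - x)) x := by
      have := (hasDerivAt_const x v).fun_div ((hasDerivAt_id x).const_sub v) hne
      refine this.congr_deriv ?_
      simp only [id]
      field_simp
      ring
    refine ((hq.const_mul ((b:ℂ) - a)).fun_add ((hq.fun_pow 2).const_mul (a:ℂ))).congr_deriv ?_
    push_cast
    ring

/-- Complex Mittag-Leffler. -/
noncomputable def bsE (a b : ℝ) (z : ℂ) : ℂ :=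
  ∑' k : ℕ, z ^ k / (Real.Gamma (b + a * k) : ℂ)

lemma bs_exists_c {a : ℝ} (ha0 : 0 < a) (M : ℝ) : ∃ c : ℝ, 1 ≤ c ∧ M < c ^ a := by
  have h := (tendsto_rpow_atTop ha0).eventually_gt_atTop M
  obtain ⟨c, h1, h2⟩ := (h.and (Filter.eventually_ge_atTop 1)).exists
  exact ⟨c, h2, h1⟩

lemma bsE_summable {a b : ℝ} (ha0 : 0 < a) (hb : 0 < b) (z : ℂ) :
    Summable fun k : ℕ => z ^ k / (Real.Gamma (b + a * k) : ℂ) := by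
  obtain ⟨c, hc, hz⟩ := bs_exists_c ha0 ‖z‖
  exact (bs_series ha0 hb hc hz).summable

lemma bsE_eq_ball {a b c : ℝ} (ha0 : 0 < a) (hb : 0 < b) (hc : 1 ≤ c) {z : ℂ}
    (hz : ‖z‖ < c ^ a) : bsE a b z = 1 / (2 * Real.pi) * bsG a b c z :=
  (bs_series ha0 hb hc hz).tsum_eq

lemma bsE_diff {a b : ℝ} (ha0 : 0 < a) (ha1 : a ≤ 1) (hb : 0 < b) :
    Differentiable ℂ (bsE a b) := by
  intro z
  obtain ⟨c, hc, hz⟩ := bs_exists_c ha0 ‖z‖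
  have h := ((bsG_diff ha0 ha1 hb hc (lt_of_le_of_lt (Complex.re_le_norm z) hz)).const_mul
    (1 / (2 * (Real.pi : ℂ))))
  refine h.congr_of_eventuallyEq ?_
  filter_upwards [(isOpen_lt continuous_norm continuous_const).mem_nhds hz] with w hw
  exact bsE_eq_ball ha0 hb hc hw

lemma bsE_eq {a b c : ℝ} (ha0 : 0 < a) (ha1 : a ≤ 1) (hb : 0 < b) (hc : 1 ≤ c) {z : ℂ}
    (hz : z.re < c ^ a) : bsE a b z = 1 / (2 * Real.pi) * bsG a b c z := by
  have hca : 0 < c ^ a := Real.rpow_pos_of_pos (by linarith) _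
  have hU : IsOpen {z : ℂ | z.re < c ^ a} := isOpen_lt Complex.continuous_re continuous_const
  have hg : AnalyticOnNhd ℂ (fun z => 1 / (2 * (Real.pi : ℂ)) * bsG a b c z)
      {z : ℂ | z.re < c ^ a} := by
    apply DifferentiableOn.analyticOnNhd _ hU
    intro w hw
    exact ((bsG_diff ha0 ha1 hb hc hw).const_mul _).differentiableWithinAt
  have hf : AnalyticOnNhd ℂ (bsE a b) {z : ℂ | z.re < c ^ a} :=
    (bsE_diff ha0 ha1 hb).differentiableOn.analyticOnNhd hU
  refine hf.eqOn_of_preconnected_of_eventuallyEq hg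
    (convex_halfSpace_re_lt _).isPreconnected (z₀ := 0) (by simpa using hca) ?_ hz
  have h0 : ‖(0:ℂ)‖ < c ^ a := by simpa using hca
  filter_upwards [(isOpen_lt continuous_norm continuous_const).mem_nhds h0] with w hw
  exact bsE_eq_ball ha0 hb hc hw

/-! ### Integrals over the imaginary axis -/

lemma bs_cauchy {s : ℝ} (hs : 0 < s) (η : ℝ) :
    Integrable (fun w : ℝ => (s ^ 2 + (w - η) ^ 2)⁻¹) ∧
      ∫ w : ℝ, (s ^ 2 + (w - η) ^ 2)⁻¹ = Real.pi / s := by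
  have e : ∀ w : ℝ, (s ^ 2 + w ^ 2)⁻¹ = (s ^ 2)⁻¹ * (1 + (s⁻¹ * w) ^ 2)⁻¹ := by
    intro w
    rw [← mul_inv]
    congr 1
    field_simp
  have h1 : Integrable fun w : ℝ => (s ^ 2 + w ^ 2)⁻¹ := by
    simp_rw [e]
    exact (integrable_inv_one_add_sq.comp_mul_left' (inv_ne_zero hs.ne')).const_mul _
  have h2 : ∫ w : ℝ, (s ^ 2 + w ^ 2)⁻¹ = Real.pi / s := by
    simp_rw [e]
    rw [integral_const_mul, Measure.integral_comp_mul_left (fun w : ℝ => (1 + w ^ 2)⁻¹),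
      integral_univ_inv_one_add_sq, inv_inv, abs_of_pos hs, smul_eq_mul]
    field_simp
  refine ⟨h1.comp_sub_right η, ?_⟩
  rw [← h2]
  exact integral_sub_right_eq_self (fun w : ℝ => (s ^ 2 + w ^ 2)⁻¹) η

lemma bs_normsq (v : ℂ) (w : ℝ) : ‖v - w * Complex.I‖ ^ 2 = v.re ^ 2 + (w - v.im) ^ 2 := by
  rw [← Complex.normSq_eq_norm_sq, Complex.normSq_apply]
  simp
  ring

lemma bs_ne2 {v : ℂ} (hv : 0 < v.re) (w : ℝ) : v - w * Complex.I ≠ 0 := by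
  intro h
  have := congrArg Complex.re h
  simp at this
  linarith

lemma bs_cont2 {v : ℂ} (hv : 0 < v.re) : Continuous fun w : ℝ => (v - w * Complex.I)⁻¹ := by
  apply Continuous.inv₀ (by fun_prop) (bs_ne2 hv)

lemma bs_sqint {v : ℂ} (hv : 0 < v.re) :
    Integrable fun w : ℝ => ‖(v - w * Complex.I)⁻¹‖ ^ 2 := by
  refine (bs_cauchy hv v.im).1.congr (Filter.Eventually.of_forall fun w => ?_)
  simp only
  rw [norm_inv, inv_pow, bs_normsq]

lemma bs_mulint {u v : ℂ} (hu : 0 < u.re) (hv : 0 < v.re) :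
    Integrable fun w : ℝ => (u - w * Complex.I)⁻¹ * (v - w * Complex.I)⁻¹ := by
  refine ((bs_sqint hu).add (bs_sqint hv)).mono'
    ((bs_cont2 hu).mul (bs_cont2 hv)).aestronglyMeasurable (Filter.Eventually.of_forall fun w => ?_)
  rw [norm_mul]
  simp only [Pi.add_apply]
  nlinarith [sq_nonneg (‖(u - w * Complex.I)⁻¹‖ - ‖(v - w * Complex.I)⁻¹‖),
    sq_nonneg (‖(u - w * Complex.I)⁻¹‖), sq_nonneg (‖(v - w * Complex.I)⁻¹‖)]

lemma bs_bdd {v : ℂ} (hv : 0 < v.re) (w : ℝ) : ‖(v - w * Complex.I)⁻¹‖ ≤ v.re⁻¹ := by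
  rw [norm_inv]
  apply inv_anti₀ hv
  have := Complex.re_le_norm (v - w * Complex.I)
  simpa using this

lemma bs_tend (v : ℂ) :
    Filter.Tendsto (fun w : ℝ => (v - w * Complex.I)⁻¹) Filter.atTop (nhds 0) ∧
    Filter.Tendsto (fun w : ℝ => (v - w * Complex.I)⁻¹) Filter.atBot (nhds 0) := by
  have hb : ∀ w : ℝ, |w - v.im| ≤ ‖v - w * Complex.I‖ := by
    intro w
    have := Complex.abs_im_le_norm (v - w * Complex.I)
    rw [abs_sub_comm]
    simpa using this
  constructor
  · apply tendsto_zero_iff_norm_tendsto_zero.2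
    simp_rw [norm_inv]
    apply Filter.Tendsto.inv_tendsto_atTop
    refine Filter.tendsto_atTop_mono hb ?_
    exact Filter.tendsto_abs_atTop_atTop.comp (Filter.tendsto_atTop_add_const_right _ _ Filter.tendsto_id)
  · apply tendsto_zero_iff_norm_tendsto_zero.2
    simp_rw [norm_inv]
    apply Filter.Tendsto.inv_tendsto_atTop
    refine Filter.tendsto_atTop_mono hb ?_
    exact Filter.tendsto_abs_atBot_atTop.comp (Filter.tendsto_atBot_add_const_right _ _ Filter.tendsto_id)

lemma bs_hasDeriv_lin (v : ℂ) (w : ℝ) :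
    HasDerivAt (fun w : ℝ => v - w * Complex.I) (-Complex.I) w := by
  have := ((Complex.ofRealCLM.hasDerivAt (x := w)).mul_const Complex.I).const_sub v
  simpa using this

lemma bs_zero1 {v : ℂ} {s : ℝ} (hs : 0 < s) (hv : s < v.re) :
    ∫ w : ℝ, (v - w * Complex.I)⁻¹ * ((s:ℂ) - w * Complex.I)⁻¹ = 0 := by
  have hv0 : 0 < v.re := by linarith
  have hs0 : 0 < (s:ℂ).re := by simpa using hs
  have hvs : v - s ≠ 0 := by
    intro h
    have := congrArg Complex.re h
    simp at this
    linarith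
  have hI := bs_mulint hv0 hs0
  have hslit : ∀ w : ℝ, (v - w * Complex.I) * ((s:ℂ) - w * Complex.I)⁻¹ ∈ Complex.slitPlane := by
    intro w
    rw [Complex.mem_slitPlane_iff]
    have hn : 0 < s ^ 2 + w ^ 2 := by positivity
    have h1 : ((s:ℂ) - w * Complex.I)⁻¹ = ((s:ℂ) + w * Complex.I) * ((s ^ 2 + w ^ 2)⁻¹ : ℝ) := by
      apply inv_eq_of_mul_eq_one_right
      have hn' : ((s:ℂ) ^ 2 + w ^ 2) ≠ 0 := by exact_mod_cast hn.ne'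
      push_cast
      field_simp
      ring_nf
      rw [Complex.I_sq]; ring
    rw [h1, ← mul_assoc, Complex.re_mul_ofReal, Complex.im_mul_ofReal]
    by_contra! hcon
    obtain ⟨hre, him⟩ := hcon
    have him' : ((v - w * Complex.I) * ((s:ℂ) + w * Complex.I)).im = 0 := by
      rcases mul_eq_zero.1 him with h | h
      · exact h
      · exact absurd h (inv_pos.2 hn).ne'
    have hre' : ((v - w * Complex.I) * ((s:ℂ) + w * Complex.I)).re ≤ 0 := by
      by_contra! h
      have := mul_pos h (inv_pos.2 hn)
      linarith
    simp at him' hre'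
    have h3 : s * (v.re * s - (v.im - w) * w) ≤ 0 := by nlinarith
    have h4 : s * (v.re * s - (v.im - w) * w) = v.re * (s ^ 2 + w ^ 2) := by
      linear_combination (-w) * him'
    rw [h4] at h3
    nlinarith
  have hd : ∀ w : ℝ, HasDerivAt
      (fun w : ℝ => Complex.log ((v - w * Complex.I) * ((s:ℂ) - w * Complex.I)⁻¹))
      (Complex.I * (v - s) * ((v - w * Complex.I)⁻¹ * ((s:ℂ) - w * Complex.I)⁻¹)) w := by
    intro w
    have hq := (bs_hasDeriv_lin v w).fun_mul ((bs_hasDeriv_lin s w).fun_inv (bs_ne2 hs0 w))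
    refine (hq.clog_real (hslit w)).congr_deriv ?_
    have h1 := bs_ne2 hv0 w
    have h2 := bs_ne2 hs0 w
    field_simp
    ring
  have hlim : ∀ l : Filter ℝ,
      Filter.Tendsto (fun w : ℝ => ((s:ℂ) - w * Complex.I)⁻¹) l (nhds 0) → Filter.Tendsto
      (fun w : ℝ => Complex.log ((v - w * Complex.I) * ((s:ℂ) - w * Complex.I)⁻¹)) l (nhds 0) := by
    intro l hl
    have h1 : Filter.Tendsto (fun w : ℝ => (v - w * Complex.I) * ((s:ℂ) - w * Complex.I)⁻¹) l
        (nhds 1) := by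
      have := (hl.const_mul (v - s)).const_add 1
      rw [mul_zero, add_zero] at this
      refine this.congr fun w => ?_
      have h2 := bs_ne2 hs0 w
      field_simp
      ring
    have h3 := (continuousAt_clog Complex.one_mem_slitPlane).tendsto.comp h1
    rw [Complex.log_one] at h3
    exact h3
  have key := integral_of_hasDerivAt_of_tendsto hd (hI.const_mul _)
    (hlim _ (bs_tend s).2) (hlim _ (bs_tend s).1)
  rw [integral_const_mul, sub_zero] at key
  rcases mul_eq_zero.1 key with h | h
  · exact absurd h (mul_ne_zero Complex.I_ne_zero hvs)
  · exact h

lemma bs_zero2 {v : ℂ} (hv0 : 0 < v.re) :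
    ∫ w : ℝ, (v - w * Complex.I)⁻¹ * (v - w * Complex.I)⁻¹ = 0 := by
  have hd : ∀ w : ℝ, HasDerivAt
      (fun w : ℝ => (v - w * Complex.I)⁻¹)
      (Complex.I * ((v - w * Complex.I)⁻¹ * (v - w * Complex.I)⁻¹)) w := by
    intro w
    refine ((bs_hasDeriv_lin v w).fun_inv (bs_ne2 hv0 w)).congr_deriv ?_
    have h1 := bs_ne2 hv0 w
    field_simp
  have key := integral_of_hasDerivAt_of_tendsto hd ((bs_mulint hv0 hv0).const_mul _)
    (bs_tend v).2 (bs_tend v).1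
  rw [integral_const_mul, sub_zero] at key
  rcases mul_eq_zero.1 key with h | h
  · exact absurd h Complex.I_ne_zero
  · exact h

lemma bs_fac {s : ℝ} (w : ℝ) :
    ((s:ℂ) ^ 2 + w ^ 2) = ((s:ℂ) - w * Complex.I) * ((s:ℂ) + w * Complex.I) := by
  ring_nf
  rw [Complex.I_sq]; ring

lemma bs_c0 {s : ℝ} (hs : 0 < s) : Integrable (fun w : ℝ => ((s:ℂ) ^ 2 + (w:ℂ) ^ 2)⁻¹) ∧
    ∫ w : ℝ, ((s:ℂ) ^ 2 + (w:ℂ) ^ 2)⁻¹ = Real.pi / s := by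
  have h := bs_cauchy hs 0
  simp only [sub_zero] at h
  have e : ∀ w : ℝ, ((s:ℂ) ^ 2 + (w:ℂ) ^ 2)⁻¹ = (((s ^ 2 + w ^ 2)⁻¹ : ℝ) : ℂ) := by
    intro w; push_cast; rfl
  simp_rw [e]
  refine ⟨h.1.ofReal, ?_⟩
  rw [integral_complex_ofReal, h.2]
  push_cast; rfl

lemma bs_P1 {v : ℂ} {s : ℝ} (hs : 0 < s) (hv : s < v.re) :
    Integrable (fun w : ℝ => (v - w * Complex.I)⁻¹ * ((s:ℂ) ^ 2 + (w:ℂ) ^ 2)⁻¹) ∧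
    ∫ w : ℝ, (v - w * Complex.I)⁻¹ * ((s:ℂ) ^ 2 + (w:ℂ) ^ 2)⁻¹ =
      (Real.pi / s) * (v + s)⁻¹ := by
  have hv0 : 0 < v.re := by linarith
  have hs0 : 0 < (s:ℂ).re := by simpa using hs
  have hvs : v + s ≠ 0 := by
    intro h
    have := congrArg Complex.re h
    simp at this
    linarith
  have e : ∀ w : ℝ, (v - w * Complex.I)⁻¹ * ((s:ℂ) ^ 2 + (w:ℂ) ^ 2)⁻¹ =
      (v + s)⁻¹ * ((v - w * Complex.I)⁻¹ * ((s:ℂ) - w * Complex.I)⁻¹ +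
        ((s:ℂ) ^ 2 + (w:ℂ) ^ 2)⁻¹) := by
    intro w
    have h1 := bs_ne2 hv0 w
    have h2 := bs_ne2 hs0 w
    have h3 : (s:ℂ) + w * Complex.I ≠ 0 := by
      have := bs_ne2 hs0 (-w)
      simpa using this
    rw [bs_fac]
    field_simp
    ring
  simp_rw [e]
  refine ⟨((bs_mulint hv0 hs0).add (bs_c0 hs).1).const_mul _, ?_⟩
  rw [integral_const_mul, integral_add (bs_mulint hv0 hs0) (bs_c0 hs).1, bs_zero1 hs hv,
    (bs_c0 hs).2]
  ring

lemma bs_P2 {v : ℂ} {s : ℝ} (hs : 0 < s) (hv : s < v.re) :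
    Integrable (fun w : ℝ => (v - w * Complex.I)⁻¹ ^ 2 * ((s:ℂ) ^ 2 + (w:ℂ) ^ 2)⁻¹) ∧
    ∫ w : ℝ, (v - w * Complex.I)⁻¹ ^ 2 * ((s:ℂ) ^ 2 + (w:ℂ) ^ 2)⁻¹ =
      (Real.pi / s) * (v + s)⁻¹ ^ 2 := by
  have hv0 : 0 < v.re := by linarith
  have hs0 : 0 < (s:ℂ).re := by simpa using hs
  have hvs : v + s ≠ 0 := by
    intro h
    have := congrArg Complex.re h
    simp at this
    linarith
  have hvs' : v - s ≠ 0 := by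
    intro h
    have := congrArg Complex.re h
    simp at this
    linarith
  have e : ∀ w : ℝ, (v - w * Complex.I)⁻¹ ^ 2 * ((s:ℂ) ^ 2 + (w:ℂ) ^ 2)⁻¹ =
      (v + s)⁻¹ * ((v - s)⁻¹ * ((v - w * Complex.I)⁻¹ * ((s:ℂ) - w * Complex.I)⁻¹ -
        (v - w * Complex.I)⁻¹ * (v - w * Complex.I)⁻¹) +
        (v - w * Complex.I)⁻¹ * ((s:ℂ) ^ 2 + (w:ℂ) ^ 2)⁻¹) := by
    intro w
    have h1 := bs_ne2 hv0 w
    have h2 := bs_ne2 hs0 w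
    have h3 : (s:ℂ) + w * Complex.I ≠ 0 := by
      have := bs_ne2 hs0 (-w)
      simpa using this
    rw [bs_fac]
    field_simp
    ring
  simp_rw [e]
  have hi := (((bs_mulint hv0 hs0).sub (bs_mulint hv0 hv0)).const_mul (v - s)⁻¹)
  simp only [Pi.sub_apply] at hi
  refine ⟨(hi.add (bs_P1 hs hv).1).const_mul _, ?_⟩
  rw [integral_const_mul, integral_add hi (bs_P1 hs hv).1, integral_const_mul,
    integral_sub (bs_mulint hv0 hs0) (bs_mulint hv0 hv0), bs_zero1 hs hv, bs_zero2 hv0,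
    (bs_P1 hs hv).2]
  ring

/-! ### Fubini -/

lemma bs_H_int {a b c s : ℝ} (hb : 0 < b) (hc : 1 ≤ c) (hs : 0 < s) :
    Integrable (fun p : ℝ × ℝ => ‖(c:ℂ) + p.2 * Complex.I‖ ^ (-(b + 1)) *
      (3 * (s ^ 2 + p.1 ^ 2)⁻¹ + 2 * ((c ^ a) ^ 2 +
        (p.1 - (((c:ℂ) + p.2 * Complex.I) ^ (a:ℂ)).im) ^ 2)⁻¹)) (volume.prod volume) := by
  have hca : 0 < c ^ a := Real.rpow_pos_of_pos (by linarith) _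
  have hmeas : Measurable fun y : ℝ => (((c:ℂ) + y * Complex.I) ^ (a:ℂ)).im :=
    (Complex.continuous_im.comp (bs_cpow_cont hc _)).measurable
  have h1 := bs_cauchy hs 0
  simp only [sub_zero] at h1
  have h2 := fun η => bs_cauchy hca η
  refine (integrable_prod_iff' ?_).2 ⟨?_, ?_⟩
  · apply Measurable.aestronglyMeasurable
    have : Measurable fun p : ℝ × ℝ => (((c:ℂ) + p.2 * Complex.I) ^ (a:ℂ)).im :=
      hmeas.comp measurable_snd
    fun_prop
  · refine Filter.Eventually.of_forall fun y => ?_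
    exact ((h1.1.const_mul 3).add ((h2 (((c:ℂ) + y * Complex.I) ^ (a:ℂ)).im).1.const_mul
      2)).const_mul (‖(c:ℂ) + y * Complex.I‖ ^ (-(b + 1)))
  · have e : ∀ y : ℝ, ∫ w : ℝ, ‖‖(c:ℂ) + y * Complex.I‖ ^ (-(b + 1)) *
      (3 * (s ^ 2 + w ^ 2)⁻¹ + 2 * ((c ^ a) ^ 2 +
        (w - (((c:ℂ) + y * Complex.I) ^ (a:ℂ)).im) ^ 2)⁻¹)‖ =
        ‖(c:ℂ) + y * Complex.I‖ ^ (-(b + 1)) * (3 * (Real.pi / s) + 2 * (Real.pi / c ^ a)) := by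
      intro y
      have : ∀ w : ℝ, ‖‖(c:ℂ) + y * Complex.I‖ ^ (-(b + 1)) *
        (3 * (s ^ 2 + w ^ 2)⁻¹ + 2 * ((c ^ a) ^ 2 +
        (w - (((c:ℂ) + y * Complex.I) ^ (a:ℂ)).im) ^ 2)⁻¹)‖ =
        ‖(c:ℂ) + y * Complex.I‖ ^ (-(b + 1)) *
        (3 * (s ^ 2 + w ^ 2)⁻¹ + 2 * ((c ^ a) ^ 2 +
        (w - (((c:ℂ) + y * Complex.I) ^ (a:ℂ)).im) ^ 2)⁻¹) := by
        intro w
        rw [Real.norm_of_nonneg (by positivity)]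
      simp_rw [this]
      rw [integral_const_mul, integral_add (h1.1.const_mul 3) ((h2 _).1.const_mul 2),
        integral_const_mul, integral_const_mul, h1.2, (h2 _).2]
    simp_rw [e]
    exact (bs_int_line hc (by linarith)).mul_const _

lemma bs_F_int {a b c s : ℝ} (ha0 : 0 < a) (ha1 : a ≤ 1) (hb : 0 < b) (hc : 1 ≤ c) (hs : 0 < s) :
    Integrable (Function.uncurry fun w y : ℝ => Complex.exp ((c:ℂ) + y * Complex.I) *
      bsK a b ((c:ℂ) + y * Complex.I) (w * Complex.I) * ((s:ℂ) ^ 2 + (w:ℂ) ^ 2)⁻¹)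
      (volume.prod volume) := by
  have hca : 0 < c ^ a := Real.rpow_pos_of_pos (by linarith) _
  refine ((bs_H_int (a := a) hb hc hs).const_mul (Real.exp c * (|b - a| + a))).mono' ?_ ?_
  · apply Continuous.aestronglyMeasurable
    have hv : Continuous fun p : ℝ × ℝ => ((c:ℂ) + p.2 * Complex.I) ^ (a:ℂ) :=
      (bs_cpow_cont hc _).comp continuous_snd
    have hq : Continuous fun p : ℝ × ℝ => ((c:ℂ) + p.2 * Complex.I) ^ (a:ℂ) /
      (((c:ℂ) + p.2 * Complex.I) ^ (a:ℂ) - p.1 * Complex.I) := by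
      apply hv.div (hv.sub (by fun_prop))
      intro p
      exact bs_ne ha0 ha1 hc p.2 (by simpa using hca)
    have hz : Continuous fun p : ℝ × ℝ => ((s:ℂ) ^ 2 + (p.1:ℂ) ^ 2)⁻¹ := by
      apply Continuous.inv₀ (by fun_prop)
      intro p
      have : 0 < s ^ 2 + p.1 ^ 2 := by positivity
      exact_mod_cast this.ne'
    unfold bsK
    exact (((Complex.continuous_exp.comp (bs_zcont c)).comp continuous_snd).mul
      (((bs_cpow_cont hc _).comp continuous_snd).mul
      ((continuous_const.mul hq).add (continuous_const.mul (hq.pow 2))))).mul hz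
  · refine Filter.Eventually.of_forall ?_
    rintro ⟨w, y⟩
    simp only [Function.uncurry_apply_pair]
    rw [bsK, norm_mul, norm_mul, norm_mul, bs_normexp, Complex.norm_cpow_real]
    have hvre := bs_Vre ha0 ha1 hc y
    set v := ((c:ℂ) + y * Complex.I) ^ (a:ℂ)
    have hvre0 : 0 < v.re := by linarith
    have hS : 0 < s ^ 2 + w ^ 2 := by positivity
    have hSn : ‖((s:ℂ) ^ 2 + (w:ℂ) ^ 2)⁻¹‖ = (s ^ 2 + w ^ 2)⁻¹ := by
      rw [norm_inv]
      congr 1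
      rw [← Complex.ofReal_pow, ← Complex.ofReal_pow, ← Complex.ofReal_add, Complex.norm_real,
        Real.norm_of_nonneg hS.le]
    rw [hSn]
    set q := v / (v - w * Complex.I) with hq
    have hd : 0 < ‖v - w * Complex.I‖ := norm_pos_iff.2 (bs_ne2 hvre0 w)
    have h5 : ‖((b:ℂ) - a) * q + a * q ^ 2‖ ≤ (|b - a| + a) * (1 + ‖q‖ ^ 2) := by
      refine (norm_add_le _ _).trans ?_
      rw [norm_mul, norm_mul, norm_pow, ← Complex.ofReal_sub, Complex.norm_real, Complex.norm_real,
        Real.norm_eq_abs, Real.norm_of_nonneg ha0.le]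
      have h6 : ‖q‖ ≤ 1 + ‖q‖ ^ 2 := by nlinarith [sq_nonneg (‖q‖ - 1), sq_nonneg (‖q‖)]
      have h7 := mul_le_mul_of_nonneg_left h6 (abs_nonneg (b - a))
      nlinarith
    have h6 : (1 + ‖q‖ ^ 2) * (s ^ 2 + w ^ 2)⁻¹ ≤ 3 * (s ^ 2 + w ^ 2)⁻¹ +
        2 * ((c ^ a) ^ 2 + (w - v.im) ^ 2)⁻¹ := by
      have h7 : ‖v‖ ≤ ‖v - w * Complex.I‖ + |w| := by
        have := norm_add_le (v - w * Complex.I) (w * Complex.I)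
        simpa using this
      have h8 : ‖v‖ ^ 2 ≤ 2 * ‖v - w * Complex.I‖ ^ 2 + 2 * w ^ 2 := by
        have h9 : ‖v‖ ^ 2 ≤ (‖v - w * Complex.I‖ + |w|) ^ 2 := by gcongr
        nlinarith [sq_nonneg (‖v - w * Complex.I‖ - |w|), sq_abs w]
      have h10 : ‖q‖ ^ 2 ≤ 2 + 2 * (w ^ 2 * (‖v - w * Complex.I‖ ^ 2)⁻¹) := by
        rw [hq, norm_div, div_pow, div_le_iff₀ (by positivity)]
        have : (‖v - w * Complex.I‖ ^ 2)⁻¹ * ‖v - w * Complex.I‖ ^ 2 = 1 :=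
          inv_mul_cancel₀ (by positivity)
        calc _ ≤ _ := h8
          _ = 2 * ‖v - w * Complex.I‖ ^ 2 + 2 * w ^ 2 *
            ((‖v - w * Complex.I‖ ^ 2)⁻¹ * ‖v - w * Complex.I‖ ^ 2) := by rw [this, mul_one]
          _ = _ := by ring
      have h11 : (‖v - w * Complex.I‖ ^ 2)⁻¹ ≤ ((c ^ a) ^ 2 + (w - v.im) ^ 2)⁻¹ := by
        apply inv_anti₀ (by positivity)
        rw [bs_normsq]
        gcongr
      have h12 : w ^ 2 * (s ^ 2 + w ^ 2)⁻¹ ≤ 1 := by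
        rw [← div_eq_mul_inv, div_le_one hS]
        nlinarith
      have h13 : 0 ≤ (‖v - w * Complex.I‖ ^ 2)⁻¹ := by positivity
      calc _ ≤ (1 + (2 + 2 * (w ^ 2 * (‖v - w * Complex.I‖ ^ 2)⁻¹))) * (s ^ 2 + w ^ 2)⁻¹ := by
            gcongr
        _ = 3 * (s ^ 2 + w ^ 2)⁻¹ +
            2 * ((w ^ 2 * (s ^ 2 + w ^ 2)⁻¹) * (‖v - w * Complex.I‖ ^ 2)⁻¹) := by ring
        _ ≤ 3 * (s ^ 2 + w ^ 2)⁻¹ + 2 * (1 * (‖v - w * Complex.I‖ ^ 2)⁻¹) := by gcongr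
        _ ≤ _ := by rw [one_mul]; gcongr
    calc _ ≤ Real.exp c * (‖(c:ℂ) + y * Complex.I‖ ^ (-(b + 1)) *
          ((|b - a| + a) * (1 + ‖q‖ ^ 2))) * (s ^ 2 + w ^ 2)⁻¹ := by gcongr
      _ = Real.exp c * (|b - a| + a) * (‖(c:ℂ) + y * Complex.I‖ ^ (-(b + 1)) *
          ((1 + ‖q‖ ^ 2) * (s ^ 2 + w ^ 2)⁻¹)) := by ring
      _ ≤ _ := by gcongr

lemma bs_inner {a b c s : ℝ} (ha0 : 0 < a) (ha1 : a ≤ 1) (hc : 1 ≤ c) (hs : 0 < s)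
    (hcs : s < c ^ a) (y : ℝ) :
    ∫ w : ℝ, Complex.exp ((c:ℂ) + y * Complex.I) *
      bsK a b ((c:ℂ) + y * Complex.I) (w * Complex.I) * ((s:ℂ) ^ 2 + (w:ℂ) ^ 2)⁻¹ =
    (Real.pi / s) * (Complex.exp ((c:ℂ) + y * Complex.I) *
      bsK a b ((c:ℂ) + y * Complex.I) (-s)) := by
  have hvre := bs_Vre ha0 ha1 hc y
  unfold bsK
  set v := ((c:ℂ) + y * Complex.I) ^ (a:ℂ)
  have hv : s < v.re := by linarith
  set A := Complex.exp ((c:ℂ) + y * Complex.I)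
  set Z := ((c:ℂ) + y * Complex.I) ^ ((-(b + 1) : ℝ) : ℂ)
  have e : ∀ w : ℝ, A * (Z * ((b - a) * (v / (v - w * Complex.I)) +
      a * (v / (v - w * Complex.I)) ^ 2)) * ((s:ℂ) ^ 2 + (w:ℂ) ^ 2)⁻¹ =
      (A * Z * (b - a) * v) * ((v - w * Complex.I)⁻¹ * ((s:ℂ) ^ 2 + (w:ℂ) ^ 2)⁻¹) +
      (A * Z * a * v ^ 2) * ((v - w * Complex.I)⁻¹ ^ 2 * ((s:ℂ) ^ 2 + (w:ℂ) ^ 2)⁻¹) := by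
    intro w
    rw [div_eq_mul_inv]
    ring
  simp_rw [e]
  rw [integral_add ((bs_P1 hs hv).1.const_mul _) ((bs_P2 hs hv).1.const_mul _),
    integral_const_mul, integral_const_mul, (bs_P1 hs hv).2, (bs_P2 hs hv).2, sub_neg_eq_add,
    div_eq_mul_inv v]
  ring

lemma bs_complex {a b s : ℝ} (ha0 : 0 < a) (ha1 : a ≤ 1) (hb : 0 < b) (hs : 0 < s) :
    Integrable (fun w : ℝ => bsE a b (w * Complex.I) * ((s:ℂ) ^ 2 + (w:ℂ) ^ 2)⁻¹) ∧
    ∫ w : ℝ, bsE a b (w * Complex.I) * ((s:ℂ) ^ 2 + (w:ℂ) ^ 2)⁻¹ =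
      (Real.pi / s) * bsE a b (-s) := by
  obtain ⟨c, hc, hcs⟩ := bs_exists_c ha0 s
  have hF := bs_F_int ha0 ha1 hb hc hs
  have e : ∀ w : ℝ, bsE a b (w * Complex.I) * ((s:ℂ) ^ 2 + (w:ℂ) ^ 2)⁻¹ =
      1 / (2 * Real.pi) * ∫ y : ℝ, Complex.exp ((c:ℂ) + y * Complex.I) *
      bsK a b ((c:ℂ) + y * Complex.I) (w * Complex.I) * ((s:ℂ) ^ 2 + (w:ℂ) ^ 2)⁻¹ := by
    intro w
    rw [bsE_eq ha0 ha1 hb hc (by simp; linarith), bsG, integral_mul_const, mul_assoc]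
  simp_rw [e]
  refine ⟨hF.integral_prod_left.const_mul _, ?_⟩
  rw [integral_const_mul, integral_integral_swap hF]
  simp_rw [bs_inner ha0 ha1 hc hs hcs]
  rw [integral_const_mul, bsE_eq ha0 ha1 hb hc (z := -(s:ℂ)) (by simp; linarith), bsG]
  ring

lemma bsE_ofReal (a b x : ℝ) : (mittagLefflerReal a b x : ℂ) = bsE a b x := by
  rw [mittagLefflerReal, bsE, Complex.ofReal_tsum]
  push_cast
  rfl

lemma bs_hasSum_congr {f g : ℕ → ℂ} {x : ℂ} (h : ∀ k, f k = g k) (hg : HasSum g x) :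
    HasSum f x := by
  rwa [show f = g from funext h]

lemma bsE_even {a b : ℝ} (ha0 : 0 < a) (hb : 0 < b) (w : ℝ) :
    bsE a b (w * Complex.I) + bsE a b (-(w * Complex.I)) =
      2 * (mittagLefflerReal (2 * a) b (-(w ^ 2)) : ℂ) := by
  rw [bsE_ofReal]
  have h1 := (bsE_summable ha0 hb (w * Complex.I)).hasSum.add
    (bsE_summable ha0 hb (-(w * Complex.I))).hasSum
  refine h1.unique ?_
  have h2 := (bsE_summable (a := 2 * a) (by linarith) hb ((-(w ^ 2) : ℝ) : ℂ)).hasSum.mul_left 2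
  rw [← add_zero (2 * bsE (2 * a) b _)]
  refine HasSum.even_add_odd ?_ ?_
  · rw [bsE]
    refine bs_hasSum_congr (fun k => ?_) h2
    rw [pow_mul, pow_mul, neg_sq, mul_pow, Complex.I_sq]
    have : b + a * ((2 * k : ℕ) : ℝ) = b + 2 * a * k := by push_cast; ring
    rw [this]
    push_cast
    ring
  · refine bs_hasSum_congr (fun k => ?_) hasSum_zero
    rw [Odd.neg_pow ⟨k, rfl⟩]
    ring

/-- Berberan-Santos' integral for the double argument: for real `0 < a ≤ 1`, `b > 0` and
`s > 0`, `E_{a,b}(−s) = (2s/π) ∫_0^∞ E_{2a,b}(−w²)/(s² + w²) dw`. -/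
theorem mittagLeffler_berberanSantos (a b s : ℝ) (ha0 : 0 < a) (ha1 : a ≤ 1) (hb : 0 < b)
    (hs : 0 < s) :
    mittagLefflerReal a b (-s)
      = (2 * s / Real.pi) *
          ∫ w in Set.Ioi (0:ℝ), mittagLefflerReal (2 * a) b (-(w ^ 2)) / (s ^ 2 + w ^ 2) := by
  have hc := bs_complex ha0 ha1 hb hs
  set g : ℝ → ℝ := fun w => mittagLefflerReal (2 * a) b (-(w ^ 2)) / (s ^ 2 + w ^ 2) with hg
  have hneg := hc.1.comp_neg
  have hnegI := integral_neg_eq_self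
    (fun w : ℝ => bsE a b (w * Complex.I) * ((s:ℂ) ^ 2 + (w:ℂ) ^ 2)⁻¹) volume
  have hsum := integral_add hc.1 hneg
  rw [hnegI] at hsum
  have e : ∀ w : ℝ, bsE a b (w * Complex.I) * ((s:ℂ) ^ 2 + (w:ℂ) ^ 2)⁻¹ +
      bsE a b (((-w : ℝ) : ℂ) * Complex.I) * ((s:ℂ) ^ 2 + ((-w : ℝ) : ℂ) ^ 2)⁻¹ =
      ((2 * g w : ℝ) : ℂ) := by
    intro w
    have h := bsE_even ha0 hb w
    rw [Complex.ofReal_neg, neg_sq, neg_mul, ← add_mul, h, hg]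
    push_cast
    ring
  simp_rw [e] at hsum
  rw [integral_complex_ofReal, integral_const_mul, hc.2, ← Complex.ofReal_neg,
    ← bsE_ofReal] at hsum
  have hr : 2 * ∫ w, g w = Real.pi / s * mittagLefflerReal a b (-s) +
      Real.pi / s * mittagLefflerReal a b (-s) := by exact_mod_cast hsum
  have habs : ∫ w, g w = 2 * ∫ w in Set.Ioi (0:ℝ), g w := by
    rw [← integral_comp_abs]
    congr 1
    ext w
    simp only [hg, sq_abs]
  rw [habs] at hr
  have hpi := Real.pi_pos
  field_simp at hr ⊢
  linarith
end

section
/- Real integral representation on the negative axis: let a, b be real numbers with 0 < a < 1 and b < a + 1, and let x > 0 be real. Then E_{a,b}(−x) = −(x^{(1−b)/a}·sin(π(a−b))/π) · ∫_0^∞ u^{a−b} · e^{−x^{1/a}·u} / (1 + 2u^a·cos(πa) + u^{2a}) du + (x^{(1−b)/a}·sin(πb)/π) · ∫_0^∞ u^{2a−b} · e^{−x^{1/a}·u} / (1 + 2u^a·cos(πa) + u^{2a}) du. In particular, for b = 1, E_a(−x) = (sin(πa)/π) · ∫_0^∞ u^{a−1} · e^{−x^{1/a}·u} / (1 + 2u^a·cos(πa)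 + u^{2a}) du. -/
open MeasureTheory

open Filter Topology Set Complex

/-- shift lemma : collapse of the Hankel contour in logarithmic coordinates -/
lemma ml_shift (G : ℂ → ℂ) (D : ℝ → ℂ) (L : ℂ)
    (hG : ∀ w : ℂ, |w.im| ≤ Real.pi → DifferentiableAt ℂ G w)
    (hD : ∀ t : ℝ, G (t + (Real.pi : ℝ) * I) - G (t + (-Real.pi : ℝ) * I) = D t)
    (hDi : Integrable D)
    (hL : Tendsto (fun ρ : ℝ => ∫ y in (-Real.pi)..Real.pi, G (ρ + y * I)) atBot (𝓝 L)) (ρ : ℝ) :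
    I * (∫ y in (-Real.pi)..Real.pi, G (ρ + y * I)) + ∫ t in Ioi ρ, D t
      = I * L + ∫ t, D t := by
  have hpi := Real.pi_pos
  have key : ∀ r : ℝ, ∫ t in r..ρ, D t = I * (∫ y in (-Real.pi)..Real.pi, G (ρ + y * I))
      - I * (∫ y in (-Real.pi)..Real.pi, G (r + y * I)) := by
    intro r
    have h := Complex.integral_boundary_rect_eq_zero_of_differentiableOn G
      (r + (-Real.pi : ℝ) * I) (ρ + (Real.pi : ℝ) * I) (by
        intro w hw
        refine (hG w ?_).differentiableWithinAt
        have := hw.2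
        simp [uIcc_of_le (by linarith : -Real.pi ≤ Real.pi)] at this
        exact abs_le.2 this)
    have e1 : ((r : ℂ) + (-Real.pi : ℝ) * I).re = r := by simp
    have e2 : ((r : ℂ) + (-Real.pi : ℝ) * I).im = -Real.pi := by simp
    have e3 : ((ρ : ℂ) + (Real.pi : ℝ) * I).re = ρ := by simp
    have e4 : ((ρ : ℂ) + (Real.pi : ℝ) * I).im = Real.pi := by simp
    rw [e1, e2, e3, e4] at h
    have hc : ∀ s : ℝ, |s| ≤ Real.pi → Continuous (fun x : ℝ => G (x + s * I)) := by
      intro s hs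
      rw [continuous_iff_continuousAt]
      intro x
      have := (hG (x + s * I) (by simpa using hs)).continuousAt
      exact ContinuousAt.comp (f := fun x : ℝ => (x : ℂ) + s * I) this (by fun_prop)
    have hs : ∫ t in r..ρ, D t = (∫ t in r..ρ, G (t + (Real.pi : ℝ) * I))
        - ∫ t in r..ρ, G (t + (-Real.pi : ℝ) * I) := by
      rw [← intervalIntegral.integral_sub]
      · simp_rw [hD]
      · exact (hc _ (by rw [abs_of_pos hpi])).intervalIntegrable _ _
      · exact (hc _ (by rw [abs_neg, abs_of_pos hpi])).intervalIntegrable _ _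
    rw [hs]
    simp only [smul_eq_mul] at h
    linear_combination -h
  have t1 : Tendsto (fun r : ℝ => ∫ t in r..ρ, D t) atBot (𝓝 (∫ t in Iic ρ, D t)) :=
    intervalIntegral_tendsto_integral_Iic ρ hDi.integrableOn tendsto_id
  have t2 := (hL.const_mul I).const_sub (I * (∫ y in (-Real.pi)..Real.pi, G (ρ + y * I)))
  have e := tendsto_nhds_unique t1 (t2.congr fun r => (key r).symm)
  rw [← intervalIntegral.integral_Iic_add_Ioi (hDi.integrableOn (s := Iic ρ)) hDi.integrableOn, e]
  ring

lemma ml_exp_image : Real.exp '' univ = Ioi 0 := by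
  rw [image_univ, Real.range_exp]

lemma ml_subst (f : ℝ → ℝ) : ∫ u in Ioi (0:ℝ), f u = ∫ t : ℝ, Real.exp t * f (Real.exp t) := by
  rw [← ml_exp_image, integral_image_eq_integral_abs_deriv_smul MeasurableSet.univ
    (fun x _ => (Real.hasDerivAt_exp x).hasDerivWithinAt) Real.exp_injective.injOn]
  simp

lemma ml_subst_int (f : ℝ → ℝ) : IntegrableOn f (Ioi (0:ℝ)) ↔
    Integrable (fun t : ℝ => Real.exp t * f (Real.exp t)) := by
  rw [← ml_exp_image, integrableOn_image_iff_integrableOn_abs_deriv_smul MeasurableSet.univ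
    (fun x _ => (Real.hasDerivAt_exp x).hasDerivWithinAt) Real.exp_injective.injOn]
  simp

lemma ml_pt (l c t : ℝ) : Real.exp t * (Real.exp t ^ (c - 1) * Real.exp (-(l * Real.exp t)))
    = Real.exp (-(l * Real.exp t) + c * t) := by
  rw [← Real.exp_mul, ← Real.exp_add, ← Real.exp_add]
  congr 1; ring

lemma ml_int_pos {l c : ℝ} (hl : 0 < l) (hc : 0 < c) :
    Integrable (fun t : ℝ => Real.exp (-(l * Real.exp t) + c * t)) := by
  have h := integrableOn_rpow_mul_exp_neg_mul_rpow (s := c - 1) (p := 1) (b := l)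
    (by linarith) one_pos hl
  simp only [Real.rpow_one, neg_mul] at h
  rw [ml_subst_int] at h
  simpa only [ml_pt] using h

lemma ml_val_pos {l c : ℝ} (hl : 0 < l) (hc : 0 < c) :
    ∫ t : ℝ, Real.exp (-(l * Real.exp t) + c * t) = (1 / l) ^ c * Real.Gamma c := by
  rw [← Real.integral_rpow_mul_exp_neg_mul_Ioi hc hl, ml_subst]
  simp only [ml_pt]

lemma ml_int_Ioi {l : ℝ} (c ρ : ℝ) (hl : 0 < l) :
    IntegrableOn (fun t : ℝ => Real.exp (-(l * Real.exp t) + c * t)) (Ioi ρ) := by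
  have h := ((ml_int_pos (c := |c| + 1) hl (by positivity)).integrableOn (s := Ioi ρ)).const_mul
    (Real.exp ((|c| + 1 - c) * (- ρ)))
  refine Integrable.mono' h (by fun_prop) ?_
  refine (ae_restrict_iff' measurableSet_Ioi).2 (ae_of_all _ fun t ht => ?_)
  rw [Real.norm_eq_abs, Real.abs_exp, ← Real.exp_add]
  apply Real.exp_le_exp.2
  have h1 : 0 ≤ |c| + 1 - c := by linarith [le_abs_self c]
  have : ρ < t := ht
  nlinarith

lemma ml_tendsto_zero {l : ℝ} (c : ℝ) (hl : 0 < l) :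
    Tendsto (fun t : ℝ => Real.exp (-(l * Real.exp t) + c * t)) atTop (𝓝 0) := by
  have h := (Real.tendsto_pow_mul_exp_neg_atTop_nhds_zero 0)
  apply Real.tendsto_exp_atBot.comp
  have h1 : Tendsto (fun t : ℝ => Real.exp t / t) atTop atTop := by
    simpa using Real.tendsto_exp_div_pow_atTop 1
  have h2 : Tendsto (fun t : ℝ => (-l * (Real.exp t / t) + c) * t) atTop atBot := by
    apply Tendsto.atBot_mul_atTop₀ _ tendsto_id
    exact tendsto_atBot_add_const_right _ _ (h1.const_mul_atTop_of_neg (by linarith))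
  refine h2.congr' ?_
  filter_upwards [eventually_gt_atTop 0] with t ht
  field_simp

noncomputable def mlG (l z : ℝ) (w : ℂ) : ℂ := cexp (l * cexp w + (1 - z) * w)

noncomputable def mlD (l z t : ℝ) : ℝ :=
  2 * Real.sin (Real.pi * z) * Real.exp (-(l * Real.exp t) + (1 - z) * t)

lemma mlG_deriv (l z : ℝ) (w : ℂ) :
    HasDerivAt (mlG l (z + 1)) (l * mlG l z w - z * mlG l (z + 1) w) w := by
  have h1 : HasDerivAt (fun w : ℂ => (l * cexp w + (1 - ((z + 1 : ℝ) : ℂ)) * w))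
      (l * cexp w + (1 - ((z + 1 : ℝ) : ℂ)) * 1) w :=
    ((Complex.hasDerivAt_exp w).const_mul _).add ((hasDerivAt_id w).const_mul _)
  have h2 := h1.cexp
  refine h2.congr_deriv ?_
  have : mlG l z w = cexp (l * cexp w + (1 - ((z + 1 : ℝ) : ℂ)) * w) * cexp w := by
    rw [mlG, ← Complex.exp_add]; congr 1; push_cast; ring
  rw [this, mlG]; push_cast; ring

lemma mlG_diff (l z : ℝ) : Differentiable ℂ (mlG l z) := by
  unfold mlG; fun_prop

lemma ml_exp_pi (t : ℝ) : cexp (t + (Real.pi : ℝ) * I) = -(Real.exp t : ℝ) := by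
  rw [Complex.exp_add, Complex.exp_pi_mul_I]; push_cast; ring

lemma ml_exp_neg_pi (t : ℝ) : cexp (t + (-Real.pi : ℝ) * I) = -(Real.exp t : ℝ) := by
  rw [Complex.exp_add, ofReal_neg, neg_mul, Complex.exp_neg, Complex.exp_pi_mul_I]
  push_cast; norm_num

lemma mlG_diffD (l z t : ℝ) :
    mlG l z (t + (Real.pi : ℝ) * I) - mlG l z (t + (-Real.pi : ℝ) * I) = I * (mlD l z t : ℝ) := by
  unfold mlG mlD
  rw [ml_exp_pi, ml_exp_neg_pi]
  have e1 : (l : ℂ) * -(Real.exp t : ℝ) + (1 - z) * (t + (Real.pi : ℝ) * I)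
    = ((-(l * Real.exp t) + (1 - z) * t : ℝ) : ℂ) + ((Real.pi * z : ℝ) : ℂ) * -I + Real.pi * I := by
    push_cast; ring
  have e2 : (l : ℂ) * -(Real.exp t : ℝ) + (1 - z) * (t + (-Real.pi : ℝ) * I)
    = ((-(l * Real.exp t) + (1 - z) * t : ℝ) : ℂ) + ((Real.pi * z : ℝ) : ℂ) * I + -(Real.pi * I) := by
    push_cast; ring
  rw [e1, e2]
  simp only [Complex.exp_add, Complex.exp_neg, Complex.exp_pi_mul_I]
  rw [show ((Real.pi * z : ℝ) : ℂ) * -I = (-(Real.pi * z : ℝ) : ℂ) * I by ring]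
  rw [Complex.exp_mul_I, Complex.exp_mul_I, Complex.cos_neg, Complex.sin_neg]
  push_cast
  norm_num
  ring

lemma ml_norm_G (l z r y : ℝ) (hl : 0 < l) :
    ‖mlG l z (r + y * I)‖ ≤ Real.exp (l * Real.exp r + (1 - z) * r) := by
  unfold mlG
  rw [Complex.norm_exp]
  apply Real.exp_le_exp.2
  have : (cexp (r + y * I)).re ≤ Real.exp r := by
    rw [Complex.exp_re]; simp
    exact mul_le_of_le_one_right (Real.exp_pos _).le (Real.cos_le_one _)
  have h3 := mul_le_mul_of_nonneg_left this hl.le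
  simp only [add_re, mul_re, ofReal_re, ofReal_im, sub_re, one_re, sub_im, one_im, I_re, I_im,
    add_im, mul_im]
  simp
  linarith

/-- the Hankel integral at height `ρ` -/
noncomputable def mlH (l z ρ : ℝ) : ℂ :=
  I * (∫ y in (-Real.pi)..Real.pi, mlG l z (ρ + y * I)) + ∫ t in Ioi ρ, I * (mlD l z t : ℝ)

lemma mlD_int_Ioi {l : ℝ} (z ρ : ℝ) (hl : 0 < l) :
    IntegrableOn (fun t => I * (mlD l z t : ℝ)) (Ioi ρ) :=
  (((ml_int_Ioi (1 - z) ρ hl).const_mul (2 * Real.sin (Real.pi * z))).ofReal).const_mul I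

lemma mlG_cont (l z ρ : ℝ) : Continuous (fun y : ℝ => mlG l z (ρ + y * I)) := by
  unfold mlG; fun_prop

lemma mlH_rec {l : ℝ} (z ρ : ℝ) (hl : 0 < l) : l * mlH l z ρ = z * mlH l (z + 1) ρ := by
  have h1 : I * (∫ y in (-Real.pi)..Real.pi, (l * mlG l z (ρ + y * I)
      - z * mlG l (z + 1) (ρ + y * I))) = I * (mlD l (z + 1) ρ : ℝ) := by
    rw [← mlG_diffD, ← intervalIntegral.integral_const_mul]
    rw [intervalIntegral.integral_eq_sub_of_hasDerivAt
      (f := fun y : ℝ => mlG l (z + 1) (ρ + y * I))]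
    · intro y _
      have := (mlG_deriv l z (ρ + y * I)).scomp y
        (h := fun y : ℝ => (ρ : ℂ) + y * I) (h' := I) (by
          simpa using ((hasDerivAt_id y).ofReal_comp.mul_const I).const_add (ρ : ℂ))
      simpa [Function.comp_def] using this
    · apply Continuous.intervalIntegrable
      have := mlG_cont l z ρ
      have := mlG_cont l (z + 1) ρ
      fun_prop
  have h2 : ∫ t in Ioi ρ, (l * (I * (mlD l z t : ℝ)) - z * (I * (mlD l (z + 1) t : ℝ)))
      = 0 - I * (mlD l (z + 1) ρ : ℝ) := by
    apply integral_Ioi_of_hasDerivAt_of_tendsto' (f := fun t => I * (mlD l (z + 1) t : ℝ))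
    · intro t _
      have hd : HasDerivAt (mlD l (z + 1)) (l * mlD l z t - z * mlD l (z + 1) t) t := by
        have h1 : HasDerivAt (fun t : ℝ => -(l * Real.exp t) + (1 - (z + 1)) * t)
            (-(l * Real.exp t) + (1 - (z + 1)) * 1) t :=
          ((Real.hasDerivAt_exp t).const_mul l).neg.add ((hasDerivAt_id t).const_mul _)
        have h2 := (h1.exp).const_mul (2 * Real.sin (Real.pi * (z + 1)))
        refine h2.congr_deriv ?_
        have e : Real.exp (-(l * Real.exp t) + (1 - z) * t)
          = Real.exp (-(l * Real.exp t) + (1 - (z + 1)) * t) * Real.exp t := by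
          rw [← Real.exp_add]; congr 1; ring
        have s : Real.sin (Real.pi * (z + 1)) = - Real.sin (Real.pi * z) := by
          rw [mul_add, mul_one, Real.sin_add_pi]
        rw [mlD, mlD, e, s]; ring
      have := hd.ofReal_comp.const_mul I
      refine this.congr_deriv ?_
      push_cast; ring
    · exact ((mlD_int_Ioi z ρ hl).const_mul _).sub ((mlD_int_Ioi (z + 1) ρ hl).const_mul _)
    · have := ((ml_tendsto_zero (1 - (z + 1)) hl).const_mul (2 * Real.sin (Real.pi * (z + 1))))
      have := ((Complex.continuous_ofReal.tendsto _).comp this).const_mul I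
      simpa [mlD, Function.comp_def] using this
  rw [intervalIntegral.integral_sub, intervalIntegral.integral_const_mul,
    intervalIntegral.integral_const_mul] at h1
  rotate_left
  · exact ((mlG_cont l z ρ).const_mul _ |>.intervalIntegrable _ _)
  · exact ((mlG_cont l (z + 1) ρ).const_mul _ |>.intervalIntegrable _ _)
  rw [integral_sub ((mlD_int_Ioi z ρ hl).const_mul _) ((mlD_int_Ioi (z + 1) ρ hl).const_mul _),
    integral_const_mul, integral_const_mul (z : ℂ)] at h2
  unfold mlH
  simp only [integral_const_mul] at h2 ⊢
  linear_combination h1 + h2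

lemma ml_exp_tendsto_bot {l c : ℝ} (hc : 0 < c) :
    Tendsto (fun r : ℝ => Real.exp (l * Real.exp r + c * r)) atBot (𝓝 0) := by
  apply Real.tendsto_exp_atBot.comp
  have := (Real.tendsto_exp_atBot.const_mul l)
  exact this.add_atBot (tendsto_id.const_mul_atBot hc)

lemma mlH_lt {l z : ℝ} (ρ : ℝ) (hl : 0 < l) (hz : z < 1) :
    mlH l z ρ = 2 * Real.pi * I * ((l ^ (z - 1) / Real.Gamma z : ℝ) : ℂ) := by
  have hL : Tendsto (fun ρ : ℝ => ∫ y in (-Real.pi)..Real.pi, mlG l z (ρ + y * I)) atBot (𝓝 0) := by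
    apply squeeze_zero_norm (a := fun r : ℝ => Real.exp (l * Real.exp r + (1 - z) * r)
      * |Real.pi - (-Real.pi)|)
    · intro r
      exact intervalIntegral.norm_integral_le_of_norm_le_const fun y _ => ml_norm_G l z r y hl
    · simpa using (ml_exp_tendsto_bot (l := l) (c := 1 - z) (by linarith)).mul_const
        |Real.pi - (-Real.pi)|
  have h := ml_shift (mlG l z) (fun t => I * (mlD l z t : ℝ)) 0
    (fun w _ => (mlG_diff l z).differentiableAt) (mlG_diffD l z)
    ((((ml_int_pos (c := 1 - z) hl (by linarith)).const_mul _).ofReal).const_mul I) hL ρ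
  rw [mlH, h, integral_const_mul, integral_complex_ofReal]
  unfold mlD
  rw [integral_const_mul, ml_val_pos hl (by linarith)]
  have hg : 2 * Real.sin (Real.pi * z) * ((1 / l) ^ (1 - z) * Real.Gamma (1 - z))
      = 2 * Real.pi * (l ^ (z - 1) / Real.Gamma z) := by
    have r := Real.Gamma_mul_Gamma_one_sub z
    have g1 : Real.Gamma (1 - z) ≠ 0 := (Real.Gamma_pos_of_pos (by linarith)).ne'
    have e : (1 / l) ^ (1 - z) = l ^ (z - 1) := by
      rw [one_div, Real.inv_rpow hl.le, ← Real.rpow_neg hl.le]; congr 1; ring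
    rw [e]
    by_cases hs : Real.sin (Real.pi * z) = 0
    · rw [hs, div_zero] at r
      have : Real.Gamma z = 0 := by simpa [g1] using r
      rw [this, hs]; simp
    · have g2 : Real.Gamma z ≠ 0 := by
        intro h0
        rw [h0, zero_mul] at r
        exact (div_ne_zero Real.pi_ne_zero hs) r.symm
      rw [eq_div_iff hs] at r
      field_simp
      linear_combination r
  rw [hg]; push_cast; ring

lemma mlH_one {l : ℝ} (ρ : ℝ) : mlH l 1 ρ = 2 * Real.pi * I := by
  have hG : ∀ w, mlG l 1 w = cexp (l * cexp w) := by intro w; simp [mlG]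
  have hD : ∀ t, mlD l 1 t = 0 := by intro t; simp [mlD]
  have hL : Tendsto (fun ρ : ℝ => ∫ y in (-Real.pi)..Real.pi, mlG l 1 (ρ + y * I)) atBot
      (𝓝 (∫ y in (-Real.pi)..Real.pi, (1:ℂ))) := by
    apply intervalIntegral.tendsto_integral_filter_of_dominated_convergence
      (fun _ => Real.exp |l|)
    · exact Eventually.of_forall fun r => (mlG_cont l 1 r).aestronglyMeasurable
    · filter_upwards [eventually_le_atBot 0] with r hr
      refine ae_of_all _ fun y _ => ?_
      rw [hG]
      refine (Complex.norm_exp_le_exp_norm _).trans (Real.exp_le_exp.2 ?_)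
      rw [norm_mul, Complex.norm_real, Real.norm_eq_abs, Complex.norm_exp]
      simp
      exact mul_le_of_le_one_right (abs_nonneg _) (Real.exp_le_one_iff.2 hr)
    · simp
    · refine ae_of_all _ fun y _ => ?_
      simp_rw [hG]
      have : Tendsto (fun r : ℝ => cexp (r + y * I)) atBot (𝓝 0) := by
        rw [tendsto_zero_iff_norm_tendsto_zero]
        simpa [Complex.norm_exp] using Real.tendsto_exp_atBot
      have h2 := (Complex.continuous_exp.tendsto _).comp (this.const_mul (l : ℂ))
      simpa [Function.comp_def] using h2
  have h := ml_shift (mlG l 1) (fun t => I * (mlD l 1 t : ℝ)) _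
    (fun w _ => (mlG_diff l 1).differentiableAt) (mlG_diffD l 1)
    (by simp [hD]) hL ρ
  rw [mlH, h]
  simp [hD]; ring

lemma mlH_eq {l : ℝ} (ρ : ℝ) (hl : 0 < l) (z : ℝ) :
    mlH l z ρ = 2 * Real.pi * I * ((l ^ (z - 1) / Real.Gamma z : ℝ) : ℂ) := by
  have key : ∀ n : ℕ, ∀ z : ℝ, z ≤ n + 1 →
      mlH l z ρ = 2 * Real.pi * I * ((l ^ (z - 1) / Real.Gamma z : ℝ) : ℂ) := by
    have h1 : mlH l 1 ρ = 2 * Real.pi * I * ((l ^ ((1:ℝ) - 1) / Real.Gamma 1 : ℝ) : ℂ) := by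
      rw [mlH_one]; simp
    intro n
    induction n with
    | zero =>
      intro z hz
      rcases lt_or_eq_of_le hz with h | h
      · exact mlH_lt ρ hl (by simpa using h)
      · have : z = 1 := by simpa using h
        rw [this, h1]
    | succ n ih =>
      intro z hz
      by_cases hz1 : z < 1
      · exact mlH_lt ρ hl hz1
      by_cases hz2 : z = 1
      · rw [hz2, h1]
      have hz3 : 0 < z - 1 := by
        rcases lt_trichotomy z 1 with h | h | h
        · exact absurd h hz1
        · exact absurd h hz2
        · linarith
      have e := mlH_rec (z - 1) ρ hl
      rw [sub_add_cancel, ih (z - 1) (by push_cast at hz; linarith)] at e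
      have hg : Real.Gamma z = (z - 1) * Real.Gamma (z - 1) := by
        rw [← Real.Gamma_add_one hz3.ne', sub_add_cancel]
      have hp : l ^ (z - 1) = l * l ^ (z - 1 - 1) := by
        rw [Real.rpow_sub_one hl.ne' (z - 1)]; field_simp
      have g2 := (Real.Gamma_pos_of_pos hz3).ne'
      have hz4 : ((z - 1 : ℝ) : ℂ) ≠ 0 := by exact_mod_cast hz3.ne'
      apply mul_left_cancel₀ hz4
      rw [← e]
      have : (z - 1) * (l ^ (z - 1) / Real.Gamma z) = l * (l ^ (z - 1 - 1) / Real.Gamma (z - 1)) := by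
        rw [hg, hp]; field_simp
      have this2 := congrArg (fun r : ℝ => (r : ℂ)) this
      simp only [ofReal_mul] at this2
      linear_combination -(2 * Real.pi * I) * this2
  obtain ⟨n, hn⟩ := exists_nat_ge z
  exact key n z (by linarith)

noncomputable def mlF (l a b : ℝ) (w : ℂ) : ℂ :=
  cexp (l * cexp w + (1 - b + a) * w) / (1 + cexp (a * w))

noncomputable def mlQ (a t : ℝ) : ℝ :=
  1 + 2 * Real.exp (a * t) * Real.cos (Real.pi * a) + Real.exp (a * t) ^ 2

noncomputable def mlDF (l a b t : ℝ) : ℝ :=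
  -2 * Real.sin (Real.pi * (a - b)) * (Real.exp (-(l * Real.exp t) + (1 - b + a) * t) / mlQ a t)
   + 2 * Real.sin (Real.pi * b) * (Real.exp (-(l * Real.exp t) + (1 - b + 2 * a) * t) / mlQ a t)

lemma ml_den_ne {a : ℝ} (ha0 : 0 < a) (ha1 : a < 1) (w : ℂ) (hw : |w.im| ≤ Real.pi) :
    1 + cexp (a * w) ≠ 0 := by
  intro h
  have h1 : cexp (a * w) = -1 := by linear_combination h
  have hre := congrArg Complex.re h1
  have him := congrArg Complex.im h1
  rw [Complex.exp_re] at hre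
  rw [Complex.exp_im] at him
  have hI : ((a : ℂ) * w).im = a * w.im := by simp
  rw [hI] at hre him
  have hw' := abs_le.1 hw
  have hpi := Real.pi_pos
  have b1 : -Real.pi < a * w.im := by nlinarith
  have b2 : a * w.im < Real.pi := by nlinarith
  simp at him
  rw [Real.sin_eq_zero_iff_of_lt_of_lt b1 b2] at him
  rw [him] at hre
  simp at hre
  linarith [Real.exp_pos (a * w.re)]

lemma mlF_diff {l a b : ℝ} (ha0 : 0 < a) (ha1 : a < 1) (w : ℂ) (hw : |w.im| ≤ Real.pi) :
    DifferentiableAt ℂ (mlF l a b) w := by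
  unfold mlF
  exact DifferentiableAt.div (by fun_prop) (by fun_prop) (ml_den_ne ha0 ha1 w hw)

lemma mlQ_lb (a t : ℝ) : Real.sin (Real.pi * a) ^ 2 ≤ mlQ a t := by
  unfold mlQ
  nlinarith [Real.sin_sq_add_cos_sq (Real.pi * a),
    sq_nonneg (Real.exp (a * t) + Real.cos (Real.pi * a))]

lemma ml_sin_pos {a : ℝ} (ha0 : 0 < a) (ha1 : a < 1) : 0 < Real.sin (Real.pi * a) := by
  have hpi := Real.pi_pos
  exact Real.sin_pos_of_pos_of_lt_pi (by positivity) (by nlinarith)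

lemma mlQ_pos {a : ℝ} (ha0 : 0 < a) (ha1 : a < 1) (t : ℝ) : 0 < mlQ a t :=
  lt_of_lt_of_le (by have := ml_sin_pos ha0 ha1; positivity) (mlQ_lb a t)

lemma ml_fint {l a c : ℝ} (ha0 : 0 < a) (ha1 : a < 1) (hl : 0 < l) (hc : 0 < c) :
    Integrable (fun t : ℝ => Real.exp (-(l * Real.exp t) + c * t) / mlQ a t) := by
  have hs := ml_sin_pos ha0 ha1
  refine Integrable.mono' ((ml_int_pos hl hc).div_const (Real.sin (Real.pi * a) ^ 2)) ?_ ?_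
  · apply Continuous.aestronglyMeasurable
    apply Continuous.div (by fun_prop) (by unfold mlQ; fun_prop)
    exact fun t => (mlQ_pos ha0 ha1 t).ne'
  · refine ae_of_all _ fun t => ?_
    have hq := mlQ_pos ha0 ha1 t
    rw [Real.norm_eq_abs, abs_of_pos (by positivity)]
    exact div_le_div_of_nonneg_left (Real.exp_pos _).le (by positivity) (mlQ_lb a t)

lemma mlDF_int {l a b : ℝ} (ha0 : 0 < a) (ha1 : a < 1) (hb : b < a + 1) (hl : 0 < l) :
    Integrable (mlDF l a b) :=
  ((ml_fint ha0 ha1 hl (by linarith)).const_mul _).add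
    ((ml_fint ha0 ha1 hl (by linarith)).const_mul _)

lemma mlF_diffD {l a b : ℝ} (ha0 : 0 < a) (ha1 : a < 1) (t : ℝ) :
    mlF l a b (t + (Real.pi : ℝ) * I) - mlF l a b (t + (-Real.pi : ℝ) * I)
      = I * (mlDF l a b t : ℝ) := by
  have n1 := ml_den_ne ha0 ha1 (t + (Real.pi : ℝ) * I) (by simp [abs_of_pos Real.pi_pos])
  have n2 := ml_den_ne ha0 ha1 (t + (-Real.pi : ℝ) * I) (by simp [abs_of_pos Real.pi_pos])
  have q : (mlQ a t : ℂ) ≠ 0 := by exact_mod_cast (mlQ_pos ha0 ha1 t).ne'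
  have e1 : cexp (a * (t + (Real.pi : ℝ) * I)) = (Real.exp (a * t) : ℝ)
      * ((Real.cos (Real.pi * a) : ℝ) + (Real.sin (Real.pi * a) : ℝ) * I) := by
    rw [ofReal_cos, ofReal_sin, ← Complex.exp_mul_I, ofReal_exp, ← Complex.exp_add]
    congr 1; push_cast; ring
  have e2 : cexp (a * (t + (-Real.pi : ℝ) * I)) = (Real.exp (a * t) : ℝ)
      * ((Real.cos (Real.pi * a) : ℝ) - (Real.sin (Real.pi * a) : ℝ) * I) := by
    have := Complex.exp_mul_I (-(Real.pi * a : ℝ) : ℂ)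
    rw [Complex.cos_neg, Complex.sin_neg] at this
    rw [ofReal_cos, ofReal_sin, sub_eq_add_neg, ← neg_mul, ← this, ofReal_exp, ← Complex.exp_add]
    congr 1; push_cast; ring
  have e3 : cexp (l * cexp (t + (Real.pi : ℝ) * I) + (1 - b + a) * (t + (Real.pi : ℝ) * I))
      = - (Real.exp (-(l * Real.exp t) + (1 - b) * t) : ℝ) *
        ((Real.cos (Real.pi * b) : ℝ) - (Real.sin (Real.pi * b) : ℝ) * I) *
        cexp (a * (t + (Real.pi : ℝ) * I)) := by
    rw [ml_exp_pi]
    have := Complex.exp_mul_I (-(Real.pi * b : ℝ) : ℂ)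
    rw [Complex.cos_neg, Complex.sin_neg, neg_mul (Complex.sin _), ← sub_eq_add_neg] at this
    rw [ofReal_cos, ofReal_sin, ← this, neg_mul, neg_mul, ofReal_exp (-(l * Real.exp t) + _),
      ← Complex.exp_add, ← Complex.exp_add, ← mul_neg_one (cexp _), ← Complex.exp_pi_mul_I,
      ← Complex.exp_add]
    congr 1; push_cast; ring
  have e4 : cexp (l * cexp (t + (-Real.pi : ℝ) * I) + (1 - b + a) * (t + (-Real.pi : ℝ) * I))
      = - (Real.exp (-(l * Real.exp t) + (1 - b) * t) : ℝ) *
        ((Real.cos (Real.pi * b) : ℝ) + (Real.sin (Real.pi * b) : ℝ) * I) *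
        cexp (a * (t + (-Real.pi : ℝ) * I)) := by
    rw [ml_exp_neg_pi]
    have hm : cexp (-(Real.pi * I)) = -1 := by
      rw [Complex.exp_neg, Complex.exp_pi_mul_I]; norm_num
    rw [ofReal_cos, ofReal_sin, ← Complex.exp_mul_I, neg_mul, neg_mul,
      ofReal_exp (-(l * Real.exp t) + _),
      ← Complex.exp_add, ← Complex.exp_add, ← mul_neg_one (cexp _), ← hm,
      ← Complex.exp_add]
    congr 1; push_cast; ring
  have e5 : Real.exp (-(l * Real.exp t) + (1 - b + a) * t)
      = Real.exp (-(l * Real.exp t) + (1 - b) * t) * Real.exp (a * t) := by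
    rw [← Real.exp_add]; congr 1; ring
  have e6 : Real.exp (-(l * Real.exp t) + (1 - b + 2 * a) * t)
      = Real.exp (-(l * Real.exp t) + (1 - b) * t) * Real.exp (a * t) ^ 2 := by
    rw [← Real.exp_nat_mul, ← Real.exp_add]; congr 1; push_cast; ring
  unfold mlF mlDF
  rw [e3, e4, e5, e6]
  rw [e1] at n1
  rw [e2] at n2
  rw [e1, e2, mul_sub Real.pi, Real.sin_sub]
  have hq : (mlQ a t : ℂ) = 1 + 2 * (Real.exp (a * t) : ℝ) * (Real.cos (Real.pi * a) : ℝ)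
      + (Real.exp (a * t) : ℝ) ^ 2 := by
    unfold mlQ; push_cast; ring
  have hpy : ((Real.cos (Real.pi * a) : ℝ) : ℂ) ^ 2 + ((Real.sin (Real.pi * a) : ℝ) : ℂ) ^ 2 = 1 := by
    exact_mod_cast Real.cos_sq_add_sin_sq (Real.pi * a)
  push_cast [-ofReal_exp, -ofReal_sin, -ofReal_cos]
  generalize (mlQ a t : ℂ) = Q at *
  generalize ((Real.exp (-(l * Real.exp t) + (1 - b) * t) : ℝ) : ℂ) = N at *
  generalize ((Real.exp (a * t) : ℝ) : ℂ) = p at *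
  generalize ((Real.cos (Real.pi * a) : ℝ) : ℂ) = ca at *
  generalize ((Real.sin (Real.pi * a) : ℝ) : ℂ) = sa at *
  generalize ((Real.cos (Real.pi * b) : ℝ) : ℂ) = cb at *
  generalize ((Real.sin (Real.pi * b) : ℝ) : ℂ) = sb at *
  have hI : I ^ 2 = -1 := Complex.I_sq
  have hprod : (1 + p * (ca + sa * I)) * (1 + p * (ca - sa * I)) = Q := by
    rw [hq]; linear_combination p ^ 2 * hpy - p ^ 2 * sa ^ 2 * hI
  rw [div_sub_div _ _ n1 n2, hprod]
  have hR : I * (-2 * (sa * cb - ca * sb) * (N * p / Q) + 2 * sb * (N * p ^ 2 / Q))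
      = (I * (-2 * (sa * cb - ca * sb) * (N * p) + 2 * sb * (N * p ^ 2))) / Q := by ring
  rw [hR]
  congr 1
  linear_combination (2 * N * p ^ 2 * sb * I) * hpy - 2 * N * p ^ 2 * sb * I * sa ^ 2 * hI

lemma ml_hasSum {l a b : ℝ} (ha0 : 0 < a) (w : ℂ) (hw : 0 < w.re) :
    HasSum (fun k : ℕ => (-1) ^ k * mlG l (b + a * k) w) (mlF l a b w) := by
  have hn : ‖-cexp (-(a * w))‖ < 1 := by
    rw [norm_neg, Complex.norm_exp, Real.exp_lt_one_iff]
    simp; positivity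
  have h := (hasSum_geometric_of_norm_lt_one hn).mul_left (mlG l b w)
  have hk : (fun k : ℕ => (-1) ^ k * mlG l (b + a * k) w)
      = fun k : ℕ => mlG l b w * (-cexp (-(a * w))) ^ k := by
    funext k
    have : mlG l (b + a * k) w = mlG l b w * cexp (-(a * w)) ^ k := by
      unfold mlG
      rw [← Complex.exp_nat_mul, ← Complex.exp_add]; congr 1; push_cast; ring
    rw [this, neg_pow (cexp _)]; ring
  have hv : mlF l a b w = mlG l b w * (1 - -cexp (-(a * w)))⁻¹ := by
    unfold mlF mlG
    have e : (1 - b + a : ℂ) * w = (1 - b) * w + a * w := by ring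
    have h1 : 1 + (cexp (a * w))⁻¹ ≠ 0 := by
      rw [← Complex.exp_neg]
      intro h0
      have : -cexp (-(a * w)) = 1 := by linear_combination -h0
      rw [this] at hn
      simp at hn
    have h2 := Complex.exp_ne_zero (a * w)
    have h3 : 1 + cexp (a * w) ≠ 0 := by
      intro h0
      apply h1
      field_simp
      linear_combination h0
    rw [e, ← add_assoc, Complex.exp_add, sub_neg_eq_add, Complex.exp_neg]
    field_simp
    ring
  rw [hk, hv]
  exact h

lemma mlF_tendsto {l a b : ℝ} (ha0 : 0 < a) (hb : b < a + 1) (hl : 0 < l) :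
    Tendsto (fun ρ : ℝ => ∫ y in (-Real.pi)..Real.pi, mlF l a b (ρ + y * I)) atBot (𝓝 0) := by
  have hlim : Tendsto (fun r : ℝ => Real.exp (l * Real.exp r + (1 - b + a) * r) /
      (1 - Real.exp (a * r)) * |Real.pi - (-Real.pi)|) atBot (𝓝 0) := by
    have h1 := ml_exp_tendsto_bot (l := l) (c := 1 - b + a) (by linarith)
    have h2 : Tendsto (fun r : ℝ => 1 - Real.exp (a * r)) atBot (𝓝 (1 - 0)) :=
      (Real.tendsto_exp_atBot.comp (tendsto_id.const_mul_atBot ha0)).const_sub 1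
    simpa using (h1.div h2 (by norm_num)).mul_const |Real.pi - (-Real.pi)|
  refine squeeze_zero_norm' ?_ hlim
  filter_upwards [eventually_lt_atBot 0] with r hr
  refine intervalIntegral.norm_integral_le_of_norm_le_const fun y _ => ?_
  have hlt : Real.exp (a * r) < 1 := by
    rw [Real.exp_lt_one_iff]; nlinarith
  have hnum : ‖cexp (l * cexp (r + y * I) + (1 - b + a) * (r + y * I))‖
      ≤ Real.exp (l * Real.exp r + (1 - b + a) * r) := by
    have := ml_norm_G l (b - a) r y hl
    unfold mlG at this
    push_cast at this
    rw [show (1 - b + a : ℂ) = 1 - (b - a) by ring, show (1 - b + a : ℝ) = 1 - (b - a) by ring]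
    exact this
  have hden : 1 - Real.exp (a * r) ≤ ‖1 + cexp (a * (r + y * I))‖ := by
    have h1 := norm_sub_norm_le (1 : ℂ) (-cexp (a * (r + y * I)))
    rw [norm_neg, Complex.norm_exp, sub_neg_eq_add, norm_one] at h1
    simpa using h1
  unfold mlF
  rw [norm_div]
  exact div_le_div₀ (Real.exp_pos _).le hnum (by linarith) hden

lemma mlH_hasSum {l a b : ℝ} (ha0 : 0 < a) (ha1 : a < 1) (hb : b < a + 1) (hl : 0 < l) :
    HasSum (fun k : ℕ => (-1) ^ k * mlH l (b + a * k) 1) (∫ t, I * (mlDF l a b t : ℝ)) := by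
  have hq : Real.exp (-a) < 1 := by rw [Real.exp_lt_one_iff]; linarith
  have hsum : Summable (fun k : ℕ => Real.exp (-a) ^ k) :=
    summable_geometric_of_lt_one (Real.exp_pos _).le hq
  have h := ml_shift (mlF l a b) (fun t => I * (mlDF l a b t : ℝ)) 0
    (fun w hw => mlF_diff ha0 ha1 w hw) (mlF_diffD ha0 ha1)
    ((mlDF_int ha0 ha1 hb hl).ofReal.const_mul I) (mlF_tendsto ha0 hb hl) 1
  rw [mul_zero, zero_add] at h
  rw [← h]
  have v : HasSum (fun k : ℕ => ∫ y in (-Real.pi)..Real.pi,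
      (-1) ^ k * mlG l (b + a * k) ((1 : ℝ) + y * I))
      (∫ y in (-Real.pi)..Real.pi, mlF l a b ((1 : ℝ) + y * I)) := by
    apply intervalIntegral.hasSum_integral_of_dominated_convergence
      (fun k _ => Real.exp (l * Real.exp 1 + (1 - b)) * Real.exp (-a) ^ k)
    · intro k
      exact ((mlG_cont l (b + a * k) 1).const_mul _).aestronglyMeasurable
    · intro k
      refine ae_of_all _ fun y _ => ?_
      rw [norm_mul, norm_pow, norm_neg, norm_one, one_pow, one_mul]
      refine (ml_norm_G l (b + a * k) 1 y hl).trans (le_of_eq ?_)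
      rw [← Real.exp_nat_mul, ← Real.exp_add]; congr 1; ring
    · exact ae_of_all _ fun y _ => hsum.mul_left _
    · simp
    · exact ae_of_all _ fun y _ => ml_hasSum ha0 _ (by simp)
  have hz : HasSum (fun k : ℕ => ∫ t in Ioi (1:ℝ), (-1) ^ k * (I * (mlD l (b + a * k) t : ℝ)))
      (∫ t in Ioi (1:ℝ), I * (mlDF l a b t : ℝ)) := by
    apply hasSum_integral_of_dominated_convergence
      (fun (k : ℕ) t => 2 * Real.exp (-(l * Real.exp t) + (1 - b) * t) * Real.exp (-a) ^ k)
    · intro k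
      exact ((mlD_int_Ioi (b + a * k) 1 hl).const_mul _).aestronglyMeasurable
    · intro k
      refine (ae_restrict_iff' measurableSet_Ioi).2 (ae_of_all _ fun t ht => ?_)
      rw [norm_mul, norm_pow, norm_neg, norm_one, one_pow, one_mul, norm_mul, Complex.norm_I,
        one_mul, Complex.norm_real, Real.norm_eq_abs, mlD, abs_mul, Real.abs_exp, abs_mul, abs_two,
        mul_assoc, mul_assoc]
      refine mul_le_mul_of_nonneg_left ?_ zero_le_two
      refine (mul_le_of_le_one_left (Real.exp_pos _).le (Real.abs_sin_le_one _)).trans ?_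
      rw [← Real.exp_nat_mul, ← Real.exp_add]
      apply Real.exp_le_exp.2
      have : (1:ℝ) < t := ht
      have hk : 0 ≤ a * k := by positivity
      nlinarith
    · exact ae_of_all _ fun y => hsum.mul_left _
    · simp_rw [tsum_mul_left]
      exact ((ml_int_Ioi (1 - b) 1 hl).const_mul 2).mul_const _
    · refine (ae_restrict_iff' measurableSet_Ioi).2 (ae_of_all _ fun t ht => ?_)
      have ht' : (0:ℝ) < t := lt_trans one_pos ht
      have s1 := ml_hasSum (l := l) (b := b) ha0 (t + (Real.pi : ℝ) * I) (by simpa using ht')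
      have s2 := ml_hasSum (l := l) (b := b) ha0 (t + (-Real.pi : ℝ) * I) (by simpa using ht')
      have s3 := s1.sub s2
      rw [mlF_diffD ha0 ha1] at s3
      simpa only [← mul_sub, mlG_diffD] using s3
  have hh := (v.mul_left I).add hz
  have hk : (fun k : ℕ => (-1) ^ k * mlH l (b + a * k) 1) = fun k : ℕ =>
      (I * ∫ y in (-Real.pi)..Real.pi, (-1) ^ k * mlG l (b + a * k) ((1 : ℝ) + y * I)) +
        ∫ t in Ioi (1:ℝ), (-1) ^ k * (I * (mlD l (b + a * k) t : ℝ)) := by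
    funext k
    rw [mlH, intervalIntegral.integral_const_mul, integral_const_mul ((-1 : ℂ) ^ k)]
    ring
  rw [hk]
  exact hh

lemma ml_pt2 {l a : ℝ} (c t : ℝ) :
    Real.exp t * (Real.exp t ^ (c - 1) * Real.exp (-(l * Real.exp t)) /
      (1 + 2 * Real.exp t ^ a * Real.cos (Real.pi * a) + Real.exp t ^ (2 * a)))
    = Real.exp (-(l * Real.exp t) + c * t) / mlQ a t := by
  rw [← ml_pt, mul_div_assoc']
  congr 1
  unfold mlQ
  rw [← Real.exp_mul, ← Real.exp_mul, ← Real.exp_nat_mul, mul_comm t a]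
  congr 2; push_cast; ring

lemma ml_main (a b x : ℝ) (ha0 : 0 < a) (ha1 : a < 1)
    (hb : b < a + 1) (hx : 0 < x) :
    mittagLefflerReal a b (-x)
      = -(x ^ ((1 - b) / a) * Real.sin (Real.pi * (a - b)) / Real.pi) *
          (∫ u in Set.Ioi (0:ℝ),
            u ^ (a - b) * Real.exp (-(x ^ (1 / a) * u)) /
              (1 + 2 * u ^ a * Real.cos (Real.pi * a) + u ^ (2 * a)))
        + (x ^ ((1 - b) / a) * Real.sin (Real.pi * b) / Real.pi) *
          (∫ u in Set.Ioi (0:ℝ),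
            u ^ (2 * a - b) * Real.exp (-(x ^ (1 / a) * u)) /
              (1 + 2 * u ^ a * Real.cos (Real.pi * a) + u ^ (2 * a))) := by
  have hl : 0 < x ^ (1 / a) := Real.rpow_pos_of_pos hx _
  set l := x ^ (1 / a) with hldef
  have hs := mlH_hasSum ha0 ha1 hb hl
  have hterm : ∀ k : ℕ, (-1) ^ k * mlH l (b + a * k) 1
      = I * ((2 * Real.pi * l ^ (b - 1) * ((-x) ^ k / Real.Gamma (b + a * k)) : ℝ) : ℂ) := by
    intro k
    have : l ^ (b + a * k - 1) = l ^ (b - 1) * x ^ k := by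
      rw [show b + a * k - 1 = (b - 1) + a * k by ring, Real.rpow_add hl]
      congr 1
      rw [hldef, ← Real.rpow_mul hx.le, ← Real.rpow_natCast]
      congr 1; field_simp
    rw [mlH_eq 1 hl, this, neg_pow x]
    push_cast; ring
  simp_rw [hterm, integral_const_mul I, integral_complex_ofReal] at hs
  have hs2 := hs.mul_left (-I)
  simp only [← mul_assoc, neg_mul, Complex.I_mul_I, neg_neg, one_mul] at hs2
  have hs3 := (Complex.hasSum_ofReal.1 hs2).tsum_eq
  simp_rw [mul_assoc, tsum_mul_left] at hs3
  have hE : 2 * (Real.pi * (l ^ (b - 1) * mittagLefflerReal a b (-x))) = ∫ t, mlDF l a b t := hs3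
  unfold mlDF at hE
  rw [integral_add ((ml_fint ha0 ha1 hl (by linarith)).const_mul _)
    ((ml_fint ha0 ha1 hl (by linarith)).const_mul _), integral_const_mul, integral_const_mul] at hE
  rw [ml_subst, ml_subst]
  have c1 : a - b = (1 - b + a) - 1 := by ring
  have c2 : 2 * a - b = (1 - b + 2 * a) - 1 := by ring
  have i1 : ∀ t : ℝ, Real.exp t * (Real.exp t ^ (a - b) * Real.exp (-(l * Real.exp t)) /
      (1 + 2 * Real.exp t ^ a * Real.cos (Real.pi * a) + Real.exp t ^ (2 * a)))
      = Real.exp (-(l * Real.exp t) + (1 - b + a) * t) / mlQ a t := by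
    intro t; rw [c1, ml_pt2]
  have i2 : ∀ t : ℝ, Real.exp t * (Real.exp t ^ (2 * a - b) * Real.exp (-(l * Real.exp t)) /
      (1 + 2 * Real.exp t ^ a * Real.cos (Real.pi * a) + Real.exp t ^ (2 * a)))
      = Real.exp (-(l * Real.exp t) + (1 - b + 2 * a) * t) / mlQ a t := by
    intro t; rw [c2, ml_pt2]
  simp_rw [i1, i2]
  have hlb : x ^ ((1 - b) / a) * l ^ (b - 1) = 1 := by
    rw [hldef, ← Real.rpow_mul hx.le, ← Real.rpow_add hx]
    rw [show (1 - b) / a + 1 / a * (b - 1) = 0 by ring, Real.rpow_zero]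
  have hpi := Real.pi_ne_zero
  have hfin : mittagLefflerReal a b (-x) = x ^ ((1 - b) / a) / (2 * Real.pi) *
      (2 * (Real.pi * (l ^ (b - 1) * mittagLefflerReal a b (-x)))) := by
    field_simp
    linear_combination -(mittagLefflerReal a b (-x)) * hlb
  rw [hfin, hE]
  field_simp

/-- Real integral representation on the negative axis: for `0 < a < 1`, `b < a + 1` and
`x > 0`,
`E_{a,b}(−x) = −(x^{(1−b)/a} sin(π(a−b))/π) ∫_0^∞ u^{a−b} e^{−x^{1/a} u}/(1+2u^a cos(πa)+u^{2a}) du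
  + (x^{(1−b)/a} sin(πb)/π) ∫_0^∞ u^{2a−b} e^{−x^{1/a} u}/(1+2u^a cos(πa)+u^{2a}) du`;
in particular, for `b = 1`,
`E_a(−x) = (sin(πa)/π) ∫_0^∞ u^{a−1} e^{−x^{1/a} u}/(1+2u^a cos(πa)+u^{2a}) du`. -/
theorem mittagLeffler_neg_axis_integral (a b x : ℝ) (ha0 : 0 < a) (ha1 : a < 1)
    (hb : b < a + 1) (hx : 0 < x) :
    (mittagLefflerReal a b (-x)
      = -(x ^ ((1 - b) / a) * Real.sin (Real.pi * (a - b)) / Real.pi) *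
          (∫ u in Set.Ioi (0:ℝ),
            u ^ (a - b) * Real.exp (-(x ^ (1 / a) * u)) /
              (1 + 2 * u ^ a * Real.cos (Real.pi * a) + u ^ (2 * a)))
        + (x ^ ((1 - b) / a) * Real.sin (Real.pi * b) / Real.pi) *
          (∫ u in Set.Ioi (0:ℝ),
            u ^ (2 * a - b) * Real.exp (-(x ^ (1 / a) * u)) /
              (1 + 2 * u ^ a * Real.cos (Real.pi * a) + u ^ (2 * a)))) ∧
    mittagLefflerReal a 1 (-x)
      = (Real.sin (Real.pi * a) / Real.pi) *
          ∫ u in Set.Ioi (0:ℝ),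
            u ^ (a - 1) * Real.exp (-(x ^ (1 / a) * u)) /
              (1 + 2 * u ^ a * Real.cos (Real.pi * a) + u ^ (2 * a)) := by
  refine ⟨ml_main a b x ha0 ha1 hb hx, ?_⟩
  rw [ml_main a 1 x ha0 ha1 (by linarith) hx]
  have h1 : Real.sin (Real.pi * (a - 1)) = -Real.sin (Real.pi * a) := by
    rw [mul_sub, mul_one, Real.sin_sub_pi]
  rw [h1, mul_one, Real.sin_pi, sub_self, zero_div, Real.rpow_zero]
  ring
end

section
/- Evaluation of the cosecant-type vertical-line integral: let a, c be real numbers with 0 < a < 1 and 0 < c < 1, let b be real, and let u > 0 be real. Then (1/(2π)) · ∫_{−∞}^{∞} [ sin(π(a·(c+it) − b)) / sin(π(c+it)) ] · u^{a·(c+it)} dt = (1/π) · ( u^a·sin(π(a−b)) − u^{2a}·sin(πb) ) / ( 1 + 2u^a·cos(πa) + u^{2a} ), where u^{w} := exp(w·log u) for complex w and real u > 0. -/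
open MeasureTheory
namespace CosecAux
open Complex Filter Topology

lemma sin_lower (w : ℂ) (h : 1 ≤ |w.im|) :
    Real.exp (Real.pi * |w.im|) / 4 ≤ ‖Complex.sin (Real.pi * w)‖ := by
  have h1 : ‖Complex.sin (Real.pi * w)‖
      = ‖Complex.exp (-(Real.pi * w) * I) - Complex.exp (Real.pi * w * I)‖ / 2 := by
    rw [Complex.sin]; simp
  have h2 := abs_norm_sub_norm_le (Complex.exp (-(Real.pi * w) * I)) (Complex.exp (Real.pi * w * I))
  rw [Complex.norm_exp, Complex.norm_exp] at h2
  have e1 : (-(Real.pi * w) * I).re = Real.pi * w.im := by simp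
  have e2 : (Real.pi * w * I).re = -(Real.pi * w.im) := by simp
  rw [e1, e2] at h2
  have key : ∀ y : ℝ, 1 ≤ y → Real.exp y / 2 ≤ Real.exp y - Real.exp (-y) := by
    intro y hy
    have a1 : y + 1 ≤ Real.exp y := Real.add_one_le_exp y
    have a2 : Real.exp (-y) ≤ Real.exp 0 := Real.exp_le_exp.2 (by linarith)
    rw [Real.exp_zero] at a2
    linarith
  have hy : 1 ≤ Real.pi * |w.im| := by
    nlinarith [Real.pi_gt_three]
  have k := key _ hy
  rw [h1]
  have : Real.exp (Real.pi * |w.im|) - Real.exp (-(Real.pi * |w.im|)) ≤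
    |Real.exp (Real.pi * w.im) - Real.exp (-(Real.pi * w.im))| := by
    rcases abs_cases w.im with ⟨h, _⟩ | ⟨h, _⟩
    · rw [h]; exact le_abs_self _
    · rw [h, abs_sub_comm]; simp only [mul_neg, neg_neg]; exact le_abs_self _
  linarith

lemma sin_lower' (c t : ℝ) (hc0 : 0 < c) (hc1 : c < 1) :
    Real.sin (Real.pi * c) * (Real.exp (Real.pi * |t|) / 2)
      ≤ ‖Complex.sin (Real.pi * (c + t * I))‖ := by
  have hs : 0 < Real.sin (Real.pi * c) :=
    Real.sin_pos_of_pos_of_lt_pi (by positivity) (by nlinarith [Real.pi_pos])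
  have h1 : (Complex.sin (Real.pi * (c + t * I))).re
      = Real.sin (Real.pi * c) * Real.cosh (Real.pi * t) := by
    have : (Real.pi * (c + t * I) : ℂ) = (Real.pi * c : ℝ) + (Real.pi * t : ℝ) * I := by
      push_cast; ring
    rw [this, Complex.sin_add_mul_I, ← Complex.ofReal_sin, ← Complex.ofReal_cosh,
      ← Complex.ofReal_cos, ← Complex.ofReal_sinh, ← Complex.ofReal_mul, ← Complex.ofReal_mul]
    rw [Complex.add_re, Complex.ofReal_re, Complex.re_ofReal_mul, I_re, mul_zero, add_zero]
  refine le_trans ?_ (Complex.re_le_norm _)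
  rw [h1]
  gcongr
  rw [← Real.cosh_abs, abs_mul, abs_of_pos Real.pi_pos, Real.cosh_eq]
  have := Real.exp_pos (-(Real.pi * |t|))
  linarith

lemma sin_ne (w : ℂ) (h : ∀ n : ℤ, w ≠ n) : Complex.sin (Real.pi * w) ≠ 0 := by
  intro h0
  rw [Complex.sin_eq_zero_iff] at h0
  obtain ⟨k, hk⟩ := h0
  apply h k
  have : (Real.pi : ℂ) ≠ 0 := by exact_mod_cast Real.pi_ne_zero
  apply mul_left_cancel₀ this
  rw [hk]; ring

lemma norm_exp_bound (s w : ℂ) (h0 : 0 ≤ w.re) (h2 : w.re ≤ 2) :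
    ‖Complex.exp (s * w)‖ ≤ Real.exp (2 * |s.re|) * Real.exp (|s.im| * |w.im|) := by
  rw [Complex.norm_exp, ← Real.exp_add, Complex.mul_re, Real.exp_le_exp]
  have a1 : s.re * w.re ≤ 2 * |s.re| := by
    nlinarith [le_abs_self s.re, abs_nonneg s.re]
  have a2 : -(s.im * w.im) ≤ |s.im| * |w.im| := by
    rw [← abs_mul]; exact neg_le_abs _
  linarith

lemma integrable_f (s : ℂ) (hs : |s.im| < Real.pi) (c : ℝ) (hc0 : 0 < c) (hc1 : c < 1) :
    Integrable (fun t : ℝ => Complex.exp (s * (c + t * I)) / Complex.sin (Real.pi * (c + t * I))) := by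
  have hsin : 0 < Real.sin (Real.pi * c) :=
    Real.sin_pos_of_pos_of_lt_pi (by positivity) (by nlinarith [Real.pi_pos])
  set d := Real.pi - |s.im| with hd
  have hdpos : 0 < d := by linarith
  have hint : Integrable (fun t : ℝ => Real.exp (-d * |t|)) := by
    rw [← integrableOn_univ, ← Set.Iic_union_Ioi (a := (0:ℝ))]
    refine IntegrableOn.union ?_ ?_
    · refine (integrableOn_exp_mul_Iic hdpos 0).congr_fun ?_ measurableSet_Iic
      intro t ht
      simp only [Set.mem_Iic] at ht
      simp [abs_of_nonpos ht]
    · refine (integrableOn_exp_mul_Ioi (neg_lt_zero.2 hdpos) 0).congr_fun ?_ measurableSet_Ioi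
      intro t ht
      simp only [Set.mem_Ioi] at ht
      simp [abs_of_pos ht]
  refine (hint.const_mul (Real.exp (2 * |s.re|) * 2 / Real.sin (Real.pi * c))).mono' ?_ ?_
  · apply Continuous.aestronglyMeasurable
    refine Continuous.div (by fun_prop) (by fun_prop) ?_
    intro t h
    have := sin_lower' c t hc0 hc1
    rw [h, norm_zero] at this
    have : 0 < Real.sin (Real.pi * c) * (Real.exp (Real.pi * |t|) / 2) := by positivity
    linarith
  · refine Eventually.of_forall fun t => ?_
    rw [norm_div]
    have b1 := norm_exp_bound s (c + t * I) (by simpa using hc0.le) (by simp; linarith)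
    have b2 := sin_lower' c t hc0 hc1
    have him : ((c : ℂ) + t * I).im = t := by simp
    rw [him] at b1
    calc _ ≤ (Real.exp (2 * |s.re|) * Real.exp (|s.im| * |t|)) /
          (Real.sin (Real.pi * c) * (Real.exp (Real.pi * |t|) / 2)) := by
          gcongr
      _ = _ := by
          have : Real.exp (-d * |t|) = Real.exp (|s.im| * |t|) / Real.exp (Real.pi * |t|) := by
            rw [← Real.exp_sub]; congr 1; rw [hd]; ring
          rw [this]
          field_simp

noncomputable def N (s w : ℂ) : ℂ := Complex.exp (s * w) + Complex.exp s * Complex.cos (Real.pi * w)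
noncomputable def S (w : ℂ) : ℂ := Complex.sin (Real.pi * w)
noncomputable def G (s w : ℂ) : ℂ := dslope (N s) 1 w / dslope S 1 w

lemma S_one : S 1 = 0 := by simp [S]
lemma N_one (s : ℂ) : N s 1 = 0 := by simp [N]

lemma G_of_ne (s w : ℂ) (h : w ≠ 1) : G s w = N s w / S w := by
  rw [G, dslope_of_ne _ h, dslope_of_ne _ h, slope_def_field, slope_def_field, S_one, N_one,
    sub_zero, sub_zero, div_div_div_cancel_right₀ (sub_ne_zero.2 h)]

lemma diff_G (s : ℂ) (w : ℂ) (h0 : 0 < w.re) (h2 : w.re < 2) : DifferentiableAt ℂ (G s) w := by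
  have hN : Differentiable ℂ (N s) := by unfold N; fun_prop
  have hS : Differentiable ℂ S := by unfold S; fun_prop
  have hN' : Differentiable ℂ (dslope (N s) 1) := by
    rw [← differentiableOn_univ, Complex.differentiableOn_dslope univ_mem]
    exact hN.differentiableOn
  have hS' : Differentiable ℂ (dslope S 1) := by
    rw [← differentiableOn_univ, Complex.differentiableOn_dslope univ_mem]
    exact hS.differentiableOn
  refine (hN' w).div (hS' w) ?_
  by_cases hw : w = 1
  · rw [hw, dslope_same]
    have : HasDerivAt S (Complex.cos (Real.pi * 1) * (Real.pi * 1)) 1 := by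
      unfold S
      exact ((hasDerivAt_id (1:ℂ)).const_mul (Real.pi : ℂ)).csin
    rw [this.deriv]
    simp
  · rw [dslope_of_ne _ hw, slope_def_field, S_one, sub_zero]
    refine div_ne_zero (sin_ne w ?_) (sub_ne_zero.2 hw)
    intro n hn
    rw [hn] at h0 h2
    simp only [intCast_re] at h0 h2
    have a : (0:ℤ) < n := by exact_mod_cast h0
    have b : n < (2:ℤ) := by exact_mod_cast h2
    have : n = 1 := by omega
    exact hw (by rw [hn, this]; simp)

/-- bound on horizontal sides; `e = 1` at the top and `e = -1` at the bottom. -/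
lemma G_bound (s : ℂ) (x T e : ℝ) (he : e = 1 ∨ e = -1) (hT : 1 ≤ T) (h0 : 0 ≤ x) (h2 : x ≤ 2) :
    ‖G s (x + (e * T : ℝ) * I) + e * (I * Complex.exp s)‖ ≤
      4 * Real.exp (2 * |s.re|) * Real.exp (-((Real.pi - |s.im|) * T))
      + 4 * ‖Complex.exp s‖ * Real.exp (-(Real.pi * T)) := by
  have he2 : e * e = 1 := by rcases he with rfl | rfl <;> norm_num
  have habs : |e| = 1 := by rcases he with rfl | rfl <;> norm_num
  set w : ℂ := x + (e * T : ℝ) * I with hw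
  have wre : w.re = x := by simp [hw]
  have wim : w.im = e * T := by simp [hw]
  have wabs : |w.im| = T := by rw [wim, abs_mul, habs, one_mul, abs_of_pos (by linarith)]
  have hl := sin_lower w (by rw [wabs]; exact hT)
  rw [wabs] at hl
  have hS : S w ≠ 0 := by
    intro h
    unfold S at h
    rw [h, norm_zero] at hl
    have := Real.exp_pos (Real.pi * T)
    linarith
  have hne : w ≠ 1 := by
    rintro h; rw [h] at hS; exact hS S_one
  have hexp : Complex.cos (Real.pi * w) + e * I * Complex.sin (Real.pi * w)
      = Complex.exp (e * (Real.pi * w) * I) := by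
    rcases he with rfl | rfl
    · rw [Complex.exp_mul_I]; push_cast; simp; ring
    · rw [Complex.exp_mul_I]; push_cast; simp; ring
  have h3 : G s w + e * (I * Complex.exp s)
      = Complex.exp (s * w) / S w + Complex.exp s * Complex.exp (e * (Real.pi * w) * I) / S w := by
    rw [G_of_ne s w hne, ← hexp]
    field_simp
    simp only [N, S]
    ring
  have hn : ‖Complex.exp (e * (Real.pi * w) * I)‖ ≤ 1 := by
    rw [Complex.norm_exp]
    have : ((e : ℂ) * (Real.pi * w) * I).re = -(Real.pi * T) := by
      simp [wim]
      linear_combination (Real.pi * T) * he2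
    rw [this]
    apply Real.exp_le_one_iff.2
    have := Real.pi_pos
    nlinarith
  have b1 := norm_exp_bound s w (by rw [wre]; exact h0) (by rw [wre]; exact h2)
  rw [wabs] at b1
  rw [h3]
  refine (norm_add_le _ _).trans (add_le_add ?_ ?_)
  · rw [norm_div]
    calc _ ≤ (Real.exp (2 * |s.re|) * Real.exp (|s.im| * T)) / (Real.exp (Real.pi * T) / 4) := by
          gcongr; exact hl
      _ = _ := by
          have : Real.exp (-((Real.pi - |s.im|) * T))
              = Real.exp (|s.im| * T) / Real.exp (Real.pi * T) := by
            rw [← Real.exp_sub]; congr 1; ring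
          rw [this]; field_simp
  · rw [norm_div, norm_mul]
    calc _ ≤ (‖Complex.exp s‖ * 1) / (Real.exp (Real.pi * T) / 4) := by
          gcongr; exact hl
      _ = _ := by
          rw [Real.exp_neg]; field_simp

lemma horiz (s : ℂ) (hs : |s.im| < Real.pi) (c e : ℝ) (hc0 : 0 < c) (hc1 : c < 1)
    (he : e = 1 ∨ e = -1) :
    Tendsto (fun T : ℝ => ∫ x : ℝ in c..(c + 1), G s (x + (e * T : ℝ) * I)) atTop
      (𝓝 (-(e * (I * Complex.exp s)))) := by
  rw [tendsto_iff_norm_sub_tendsto_zero]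
  have hB : Tendsto (fun T : ℝ => 4 * Real.exp (2 * |s.re|) * Real.exp (-((Real.pi - |s.im|) * T))
      + 4 * ‖Complex.exp s‖ * Real.exp (-(Real.pi * T))) atTop (𝓝 0) := by
    have aux : ∀ k : ℝ, 0 < k → Tendsto (fun T : ℝ => Real.exp (-(k * T))) atTop (𝓝 0) := by
      intro k hk
      exact Real.tendsto_exp_neg_atTop_nhds_zero.comp (tendsto_id.const_mul_atTop hk)
    have := ((aux _ (sub_pos.2 hs)).const_mul (4 * Real.exp (2 * |s.re|))).add
      ((aux _ Real.pi_pos).const_mul (4 * ‖Complex.exp s‖))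
    simpa using this
  refine squeeze_zero' (Eventually.of_forall fun _ => norm_nonneg _) ?_ hB
  filter_upwards [eventually_ge_atTop (1:ℝ)] with T hT
  have hcont : ContinuousOn (fun x : ℝ => G s (x + (e * T : ℝ) * I)) (Set.uIcc c (c + 1)) := by
    intro x hx
    rw [Set.uIcc_of_le (by linarith)] at hx
    apply ContinuousAt.continuousWithinAt
    have h1 : ContinuousAt (G s) ((x : ℂ) + (e * T : ℝ) * I) :=
      (diff_G s _ (by simp; linarith [hx.1]) (by simp; linarith [hx.2])).continuousAt
    exact ContinuousAt.comp (f := fun x : ℝ => (x : ℂ) + (e * T : ℝ) * I) h1 (by fun_prop)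
  have h1 : (∫ x : ℝ in c..(c + 1), G s (x + (e * T : ℝ) * I)) - -(e * (I * Complex.exp s))
      = ∫ x : ℝ in c..(c + 1), (G s (x + (e * T : ℝ) * I) + e * (I * Complex.exp s)) := by
    rw [intervalIntegral.integral_add hcont.intervalIntegrable (by simp)]
    simp
  rw [h1]
  refine (intervalIntegral.norm_integral_le_of_norm_le_const
    (C := 4 * Real.exp (2 * |s.re|) * Real.exp (-((Real.pi - |s.im|) * T))
      + 4 * ‖Complex.exp s‖ * Real.exp (-(Real.pi * T))) ?_).trans ?_
  · intro x hx
    rw [Set.uIoc_of_le (by linarith)] at hx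
    exact G_bound s x T e he hT (by linarith [hx.1]) (by linarith [hx.2])
  · simp

lemma one_add_exp_ne (s : ℂ) (hs : |s.im| < Real.pi) : 1 + Complex.exp s ≠ 0 := by
  intro h
  have h1 : Complex.exp s = Complex.exp (Real.pi * I) := by
    rw [Complex.exp_pi_mul_I]; linear_combination h
  rw [Complex.exp_eq_exp_iff_exists_int] at h1
  obtain ⟨n, hn⟩ := h1
  have him : s.im = Real.pi + n * (2 * Real.pi) := by
    rw [hn]; simp
  rw [him, abs_lt] at hs
  have hp := Real.pi_pos
  have a : (-1:ℝ) < 1 + n * 2 := by nlinarith [hs.1]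
  have b : (1 + n * 2 : ℝ) < 1 := by nlinarith [hs.2]
  have a' : (-1:ℤ) < 1 + n * 2 := by exact_mod_cast a
  have b' : (1 + n * 2 : ℤ) < 1 := by exact_mod_cast b
  omega

lemma K_eval (s : ℂ) (hs : |s.im| < Real.pi) (c : ℝ) (hc0 : 0 < c) (hc1 : c < 1) :
    (∫ t : ℝ, Complex.exp (s * (c + t * I)) / Complex.sin (Real.pi * (c + t * I)))
      = 2 * Complex.exp s / (1 + Complex.exp s) := by
  have hlim := intervalIntegral_tendsto_integral (integrable_f s hs c hc0 hc1)
    tendsto_neg_atTop_atBot tendsto_id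
  have hcont : ∀ d : ℝ, 0 < d → d < 2 → Continuous (fun y : ℝ => G s (d + y * I)) := by
    intro d h0 h2
    rw [continuous_iff_continuousAt]
    intro y
    have h1 : ContinuousAt (G s) ((d : ℂ) + y * I) :=
      (diff_G s _ (by simpa using h0) (by simpa using h2)).continuousAt
    exact ContinuousAt.comp (f := fun y : ℝ => (d : ℂ) + y * I) h1 (by fun_prop)
  have hrect : ∀ T : ℝ,
      (∫ t in (-T)..(id T), Complex.exp (s * (c + t * I)) / Complex.sin (Real.pi * (c + t * I)))
      = (I * (1 + Complex.exp s))⁻¹ * ((∫ x : ℝ in c..(c + 1), G s (x + ((-1) * T : ℝ) * I))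
        - ∫ x : ℝ in c..(c + 1), G s (x + (1 * T : ℝ) * I)) := by
    intro T
    have h := Complex.integral_boundary_rect_eq_zero_of_differentiableOn (G s)
      (c + ((-1) * T : ℝ) * I) ((c + 1 : ℝ) + (1 * T : ℝ) * I) (by
        intro w hw
        rw [Complex.mem_reProdIm] at hw
        have hw1 := hw.1
        simp only [add_re, ofReal_re, mul_re, I_re, mul_zero, ofReal_im, I_im, mul_one, sub_self,
          add_zero] at hw1
        rw [Set.uIcc_of_le (by linarith)] at hw1
        exact (diff_G s w (by linarith [hw1.1]) (by linarith [hw1.2])).differentiableWithinAt)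
    have r1 : ((c : ℂ) + ((-1) * T : ℝ) * I).re = c := by simp
    have r2 : ((c : ℂ) + ((-1) * T : ℝ) * I).im = (-1) * T := by simp
    have r3 : (((c + 1 : ℝ) : ℂ) + (1 * T : ℝ) * I).re = c + 1 := by simp
    have r4 : (((c + 1 : ℝ) : ℂ) + (1 * T : ℝ) * I).im = 1 * T := by simp
    rw [r1, r2, r3, r4] at h
    have hv : (∫ y : ℝ in ((-1) * T)..(1 * T), G s ((c + 1 : ℝ) + y * I))
        - (∫ y : ℝ in ((-1) * T)..(1 * T), G s (c + y * I))
        = -(1 + Complex.exp s) * ∫ t in (-T)..(id T),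
          Complex.exp (s * (c + t * I)) / Complex.sin (Real.pi * (c + t * I)) := by
      rw [← intervalIntegral.integral_sub
        ((hcont (c + 1) (by linarith) (by linarith)).intervalIntegrable _ _)
        ((hcont c (by linarith) (by linarith)).intervalIntegrable _ _),
        ← intervalIntegral.integral_const_mul, neg_one_mul, one_mul]
      refine intervalIntegral.integral_congr fun t _ => ?_
      have hre : ((c : ℂ) + t * I).re = c := by simp
      have hnz : ∀ n : ℤ, (c : ℂ) + t * I ≠ n := by
        intro n hn
        rw [hn] at hre
        simp only [intCast_re] at hre
        rw [← hre] at hc0 hc1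
        have a : (0:ℤ) < n := by exact_mod_cast hc0
        have b : n < (1:ℤ) := by exact_mod_cast hc1
        omega
      have hs0 := sin_ne _ hnz
      have e1 : ((c + 1 : ℝ) : ℂ) + t * I = (c + t * I) + 1 := by push_cast; ring
      rw [e1]
      set w : ℂ := c + t * I
      rw [G_of_ne s w (by simpa using hnz 1), G_of_ne s (w + 1) (by
        intro h; apply hnz 0; push_cast; linear_combination h)]
      have c1 : Complex.cos (Real.pi * (w + 1)) = - Complex.cos (Real.pi * w) := by
        rw [mul_add, mul_one, Complex.cos_add_pi]
      have c2 : Complex.sin (Real.pi * (w + 1)) = - Complex.sin (Real.pi * w) := by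
        rw [mul_add, mul_one, Complex.sin_add_pi]
      simp only [N, S]
      rw [c1, c2, mul_add, mul_one, Complex.exp_add]
      field_simp
      ring
    have hne := one_add_exp_ne s hs
    rw [eq_inv_mul_iff_mul_eq₀ (mul_ne_zero I_ne_zero hne)]
    simp only [smul_eq_mul] at h
    linear_combination (-1) * h + I * hv
  have hR := ((horiz s hs c (-1) hc0 hc1 (Or.inr rfl)).sub
    (horiz s hs c 1 hc0 hc1 (Or.inl rfl))).const_mul ((I * (1 + Complex.exp s))⁻¹)
  have hne := one_add_exp_ne s hs
  rw [tendsto_nhds_unique hlim (hR.congr fun T => (hrect T).symm)]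
  have := I_ne_zero
  push_cast
  field_simp
  ring

end CosecAux

theorem cosecant_vertical_line_integral (a b c u : ℝ) (ha0 : 0 < a) (ha1 : a < 1)
    (hc0 : 0 < c) (hc1 : c < 1) (hu : 0 < u) :
    (1 / (2 * (Real.pi : ℂ))) *
        ∫ t : ℝ,
          Complex.sin ((Real.pi : ℂ) * ((a : ℂ) * ((c : ℂ) + (t : ℂ) * Complex.I) - (b : ℂ))) /
              Complex.sin ((Real.pi : ℂ) * ((c : ℂ) + (t : ℂ) * Complex.I)) *
            Complex.exp ((a : ℂ) * ((c : ℂ) + (t : ℂ) * Complex.I) * (Real.log u : ℂ))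
      = (((1 / Real.pi) *
            (u ^ a * Real.sin (Real.pi * (a - b)) - u ^ (2 * a) * Real.sin (Real.pi * b)) /
            (1 + 2 * u ^ a * Real.cos (Real.pi * a) + u ^ (2 * a)) : ℝ) : ℂ) := by
  have hpi := Real.pi_pos
  set L := Real.log u with hL
  set sp : ℂ := ((a * L : ℝ) : ℂ) + ((Real.pi * a : ℝ) : ℂ) * Complex.I with hsp
  set sm : ℂ := ((a * L : ℝ) : ℂ) + ((-(Real.pi * a) : ℝ) : ℂ) * Complex.I with hsm
  have hpa : |Real.pi * a| < Real.pi := by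
    rw [abs_of_pos (by positivity)]; nlinarith
  have hspi : |sp.im| < Real.pi := by
    have : sp.im = Real.pi * a := by simp [hsp]
    rw [this]; exact hpa
  have hsmi : |sm.im| < Real.pi := by
    have : sm.im = -(Real.pi * a) := by simp [hsm]
    rw [this, abs_neg]; exact hpa
  set E : ℂ := Complex.exp ((Real.pi * b : ℝ) * Complex.I) with hE
  have hE0 : E ≠ 0 := Complex.exp_ne_zero _
  have hEinv : Complex.exp (-((Real.pi * b : ℝ) * Complex.I)) = E⁻¹ := by rw [Complex.exp_neg]
  have hI : (∫ t : ℝ,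
          Complex.sin ((Real.pi : ℂ) * ((a : ℂ) * ((c : ℂ) + (t : ℂ) * Complex.I) - (b : ℂ))) /
              Complex.sin ((Real.pi : ℂ) * ((c : ℂ) + (t : ℂ) * Complex.I)) *
            Complex.exp ((a : ℂ) * ((c : ℂ) + (t : ℂ) * Complex.I) * (L : ℂ)))
      = (Complex.I / 2 * E) * (2 * Complex.exp sm / (1 + Complex.exp sm))
        - (Complex.I / 2 * E⁻¹) * (2 * Complex.exp sp / (1 + Complex.exp sp)) := by
    rw [← CosecAux.K_eval sp hspi c hc0 hc1, ← CosecAux.K_eval sm hsmi c hc0 hc1,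
      ← integral_const_mul, ← integral_const_mul, ← integral_sub
        ((CosecAux.integrable_f sm hsmi c hc0 hc1).const_mul _)
        ((CosecAux.integrable_f sp hspi c hc0 hc1).const_mul _)]
    refine integral_congr_ae (Filter.Eventually.of_forall fun t => ?_)
    simp only
    set w : ℂ := (c : ℂ) + (t : ℂ) * Complex.I
    have e1 : Complex.exp (sm * w) = Complex.exp (a * w * L)
        * Complex.exp (-(Real.pi * (a * w)) * Complex.I) := by
      rw [← Complex.exp_add]; congr 1; rw [hsm]; push_cast; ring
    have e2 : Complex.exp (sp * w) = Complex.exp (a * w * L)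
        * Complex.exp (Real.pi * (a * w) * Complex.I) := by
      rw [← Complex.exp_add]; congr 1; rw [hsp]; push_cast; ring
    have e3 : Complex.exp (-(Real.pi * (a * w - b)) * Complex.I)
        = Complex.exp (-(Real.pi * (a * w)) * Complex.I) * E := by
      rw [hE, ← Complex.exp_add]; congr 1; push_cast; ring
    have e4 : Complex.exp (Real.pi * (a * w - b) * Complex.I)
        = Complex.exp (Real.pi * (a * w) * Complex.I) * E⁻¹ := by
      rw [← hEinv, ← Complex.exp_add]; congr 1; push_cast; ring
    rw [Complex.sin, e1, e2, e3, e4]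
    ring
  rw [hI]
  set r : ℝ := u ^ a with hr
  have hrpos : 0 < r := Real.rpow_pos_of_pos hu a
  have hr2 : u ^ (2 * a) = r ^ 2 := by
    rw [hr, ← Real.rpow_natCast, ← Real.rpow_mul hu.le]; congr 1; push_cast; ring
  have hrexp : r = Real.exp (a * L) := by
    rw [hr, Real.rpow_def_of_pos hu, mul_comm]
  rw [hr2]
  set A : ℂ := Complex.exp ((Real.pi * a : ℝ) * Complex.I) with hA
  have hA0 : A ≠ 0 := Complex.exp_ne_zero _
  have hzp : Complex.exp sp = r * A := by
    rw [hsp, Complex.exp_add, hrexp, Complex.ofReal_exp]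
  have hzm : Complex.exp sm = r * A⁻¹ := by
    rw [hsm, Complex.exp_add, hrexp, Complex.ofReal_exp, hA, ← Complex.exp_neg]
    congr 2; push_cast; ring
  have n1 := CosecAux.one_add_exp_ne sp hspi
  have n2 := CosecAux.one_add_exp_ne sm hsmi
  rw [hzp] at n1 ⊢
  rw [hzm] at n2 ⊢
  have hcos : ((Real.cos (Real.pi * a) : ℝ) : ℂ) = (A + A⁻¹) / 2 := by
    rw [Complex.ofReal_cos, Complex.cos, hA, ← Complex.exp_neg, neg_mul]
  have hsinb : ((Real.sin (Real.pi * b) : ℝ) : ℂ) = (E⁻¹ - E) * Complex.I / 2 := by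
    rw [Complex.ofReal_sin, Complex.sin, hE, ← Complex.exp_neg, neg_mul]
  have hsinab : ((Real.sin (Real.pi * (a - b)) : ℝ) : ℂ)
      = (A⁻¹ * E - A * E⁻¹) * Complex.I / 2 := by
    rw [Complex.ofReal_sin, Complex.sin, hE, hA, ← Complex.exp_neg, ← Complex.exp_neg,
      ← Complex.exp_add, ← Complex.exp_add]
    congr 4 <;> push_cast <;> ring
  have hden : (1 + 2 * (r : ℂ) * ((A + A⁻¹) / 2) + (r : ℂ) ^ 2)
      = (1 + r * A) * (1 + r * A⁻¹) := by
    field_simp; ring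
  rw [Complex.ofReal_div, Complex.ofReal_mul, Complex.ofReal_sub, Complex.ofReal_mul,
    Complex.ofReal_mul, Complex.ofReal_add, Complex.ofReal_add, Complex.ofReal_mul,
    Complex.ofReal_mul, hcos, hsinb, hsinab, Complex.ofReal_pow, Complex.ofReal_div,
    Complex.ofReal_one, Complex.ofReal_ofNat, hden]
  have hpc : (Real.pi : ℂ) ≠ 0 := by exact_mod_cast hpi.ne'
  rw [mul_div_assoc', mul_div_assoc', div_sub_div _ _ n2 n1, mul_div_assoc',
    div_eq_div_iff (mul_ne_zero n2 n1) (mul_ne_zero n1 n2)]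
  field_simp
  ring
end

section
/- Bounds for E_a(−x): let a be a real number with 0 < a < 1 and x > 0 a real number. Then E_a(−x) ≥ (1/2)·e^{−x^{1/a}}. If moreover 0 < a < 1/2, then also E_a(−x) ≤ sin(πa)·Γ(a)/(π·x) − (e^{−x^{1/a}}/(4aπ)) · sin(2πa)/(1 + cos(πa)). -/
namespace MLaux

open MeasureTheory Set Filter Topology intervalIntegral

theorem ml_gamma_int (c : ℝ) (hc : 0 < c) :
    Integrable (fun y : ℝ => Real.exp (-Real.exp y) * Real.exp (c * y)) ∧
    ∫ y : ℝ, Real.exp (-Real.exp y) * Real.exp (c * y) = Real.Gamma c := by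
  have him : Real.exp '' univ = Ioi 0 := by rw [image_univ, Real.range_exp]
  have hd : ∀ y ∈ (univ : Set ℝ), HasDerivWithinAt Real.exp (Real.exp y) univ y :=
    fun y _ => (Real.hasDerivAt_exp y).hasDerivWithinAt
  have hinj : InjOn Real.exp univ := Real.exp_injective.injOn
  have key : ∀ y : ℝ, |Real.exp y| • (Real.exp (-Real.exp y) * (Real.exp y) ^ (c - 1))
      = Real.exp (-Real.exp y) * Real.exp (c * y) := by
    intro y
    rw [abs_of_pos (Real.exp_pos y), ← Real.exp_mul, smul_eq_mul, mul_left_comm, ← Real.exp_add]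
    ring_nf
  constructor
  · have h := Real.GammaIntegral_convergent hc
    rw [← him, integrableOn_image_iff_integrableOn_abs_deriv_smul MeasurableSet.univ hd hinj,
      integrableOn_univ] at h
    exact h.congr (ae_of_all _ key)
  · rw [Real.Gamma_eq_integral hc, ← him,
      integral_image_eq_integral_abs_deriv_smul MeasurableSet.univ hd hinj, setIntegral_univ]
    exact (integral_congr_ae (ae_of_all _ key)).symm

theorem ml_tail_int (c R : ℝ) :
    IntegrableOn (fun y : ℝ => Real.exp (-Real.exp y) * Real.exp (c * y)) (Ioi R) := by
  have h := ((ml_gamma_int (|c| + 1) (by positivity)).1.const_mul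
    (Real.exp ((c - (|c| + 1)) * R))).integrableOn (s := Ioi R)
  refine Integrable.mono' h (by fun_prop) ?_
  refine (ae_restrict_iff' measurableSet_Ioi).2 (ae_of_all _ fun y hy => ?_)
  have hy' : R < y := hy
  rw [Real.norm_of_nonneg (by positivity), mul_left_comm]
  refine mul_le_mul_of_nonneg_left ?_ (Real.exp_pos _).le
  rw [← Real.exp_add]
  refine Real.exp_le_exp.2 ?_
  have : c ≤ |c| := le_abs_self c
  nlinarith

theorem ml_expexp_pos (y : ℝ) :
    Complex.exp (Complex.exp (y + Real.pi * Complex.I)) = ((Real.exp (-Real.exp y) : ℝ) : ℂ) := by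
  rw [Complex.exp_add, Complex.exp_pi_mul_I]
  push_cast; ring_nf

theorem ml_expexp_neg (y : ℝ) :
    Complex.exp (Complex.exp (y + (-Real.pi : ℝ) * Complex.I))
      = ((Real.exp (-Real.exp y) : ℝ) : ℂ) := by
  have : Complex.exp ((-Real.pi : ℝ) * Complex.I) = -1 := by
    push_cast
    rw [neg_mul, Complex.exp_neg, Complex.exp_pi_mul_I]; norm_num
  rw [Complex.exp_add, this]
  push_cast; ring_nf

/-- The jump of `exp (exp w) * G w` across the strip. -/
noncomputable def mlJump (G : ℂ → ℂ) (y : ℝ) : ℂ :=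
  ((Real.exp (-Real.exp y) : ℝ) : ℂ) *
    (G (y + Real.pi * Complex.I) - G (y + (-Real.pi : ℝ) * Complex.I))

/-- The integral over the right edge. -/
noncomputable def mlArc (R : ℝ) (G : ℂ → ℂ) : ℂ :=
  ∫ t in (-Real.pi)..Real.pi, Complex.exp (Complex.exp (R + t * Complex.I)) * G (R + t * Complex.I)

/-- The Hankel contour functional. -/
noncomputable def mlH (R : ℝ) (G : ℂ → ℂ) : ℂ :=
  Complex.I * mlArc R G + ∫ y in Ioi R, mlJump G y

theorem ml_cauchy (R c C : ℝ) (hc : 0 < c) (G : ℂ → ℂ)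
    (hd : ∀ w : ℂ, |w.im| ≤ Real.pi → DifferentiableAt ℂ G w)
    (hb : ∀ w : ℂ, |w.im| ≤ Real.pi → ‖G w‖ ≤ C * Real.exp (c * w.re)) :
    Integrable (mlJump G) ∧ mlH R G = ∫ y : ℝ, mlJump G y := by
  have hpi := Real.pi_pos
  have himp : ∀ y : ℝ, |((y : ℂ) + Real.pi * Complex.I).im| ≤ Real.pi := by
    intro y; simp [abs_of_pos hpi]
  have himn : ∀ y : ℝ, |((y : ℂ) + (-Real.pi : ℝ) * Complex.I).im| ≤ Real.pi := by
    intro y; simp [abs_of_pos hpi]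
  have hcp : Continuous fun y : ℝ => G (y + Real.pi * Complex.I) := by
    refine continuous_iff_continuousAt.2 fun y => ?_
    exact ContinuousAt.comp (f := fun y : ℝ => (y : ℂ) + Real.pi * Complex.I)
      (hd _ (himp y)).continuousAt (by fun_prop)
  have hcn : Continuous fun y : ℝ => G (y + (-Real.pi : ℝ) * Complex.I) := by
    refine continuous_iff_continuousAt.2 fun y => ?_
    exact ContinuousAt.comp (f := fun y : ℝ => (y : ℂ) + (-Real.pi : ℝ) * Complex.I)
      (hd _ (himn y)).continuousAt (by fun_prop)
  have hcj : Continuous (mlJump G) := by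
    unfold mlJump
    exact (by fun_prop : Continuous fun y : ℝ => ((Real.exp (-Real.exp y) : ℝ) : ℂ)).mul
      (hcp.sub hcn)
  have hint : Integrable (mlJump G) := by
    refine Integrable.mono' ((ml_gamma_int c hc).1.const_mul (2 * C))
      hcj.aestronglyMeasurable (ae_of_all _ fun y => ?_)
    have h1 := hb _ (himp y)
    have h2 := hb _ (himn y)
    simp only [Complex.add_re, Complex.ofReal_re, Complex.mul_re, Complex.I_re, Complex.I_im,
      Complex.ofReal_im, mul_zero, mul_one, sub_zero, add_zero] at h1 h2
    unfold mlJump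
    rw [norm_mul, Complex.norm_real, Real.norm_of_nonneg (Real.exp_pos _).le]
    calc _ ≤ Real.exp (-Real.exp y) * (C * Real.exp (c * y) + C * Real.exp (c * y)) := by
          gcongr
          exact (norm_sub_le _ _).trans (add_le_add h1 h2)
      _ = _ := by ring
  refine ⟨hint, ?_⟩
  -- the finite rectangle
  have hrect : ∀ L : ℝ, L ≤ R → Complex.I * mlArc R G - Complex.I * mlArc L G
      = ∫ y in L..R, mlJump G y := by
    intro L hL
    have h := Complex.integral_boundary_rect_eq_zero_of_differentiableOn
      (fun w => Complex.exp (Complex.exp w) * G w) (L + (-Real.pi : ℝ) * Complex.I)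
      (R + Real.pi * Complex.I) ?_
    · simp only [Complex.add_re, Complex.ofReal_re, Complex.mul_re, Complex.I_re, Complex.I_im,
        Complex.ofReal_im, mul_zero, mul_one, sub_zero, add_zero,
        Complex.add_im, Complex.mul_im, zero_add, smul_eq_mul, ml_expexp_pos, ml_expexp_neg] at h
      have e : ∫ y in L..R, mlJump G y =
          (∫ y in L..R, ((Real.exp (-Real.exp y) : ℝ) : ℂ) * G (y + Real.pi * Complex.I)) -
          ∫ y in L..R, ((Real.exp (-Real.exp y) : ℝ) : ℂ) * G (y + (-Real.pi : ℝ) * Complex.I) := by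
        rw [← intervalIntegral.integral_sub]
        · simp only [mlJump, mul_sub]
        · exact Continuous.intervalIntegrable (Continuous.mul (by fun_prop) hcp) _ _
        · exact Continuous.intervalIntegrable (Continuous.mul (by fun_prop) hcn) _ _
      rw [e]
      unfold mlArc
      linear_combination h
    · intro w hw
      have hw2 := hw.2
      simp only [Complex.add_im, Complex.ofReal_im, Complex.mul_im, Complex.ofReal_re,
        Complex.I_im, Complex.I_re, mul_one, mul_zero, add_zero, zero_add, mem_preimage] at hw2
      rw [uIcc_of_le (by linarith)] at hw2
      exact (DifferentiableAt.mul (by fun_prop) (hd w (abs_le.2 hw2))).differentiableWithinAt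
  have harc : Tendsto (fun L => mlArc L G) atBot (𝓝 0) := by
    have hE : Tendsto (fun L => Real.exp (Real.exp L) * (C * Real.exp (c * L)) * |Real.pi - -Real.pi|)
        atBot (𝓝 (Real.exp 0 * (C * 0) * |Real.pi - -Real.pi|)) := by
      have h1 : Tendsto (fun L : ℝ => Real.exp (Real.exp L)) atBot (𝓝 (Real.exp 0)) :=
        (Real.continuous_exp.tendsto 0).comp Real.tendsto_exp_atBot
      have h2 : Tendsto (fun L : ℝ => Real.exp (c * L)) atBot (𝓝 0) :=
        Real.tendsto_exp_atBot.comp (tendsto_id.const_mul_atBot hc)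
      exact (h1.mul (h2.const_mul C)).mul_const _
    rw [mul_zero, mul_zero, zero_mul] at hE
    refine squeeze_zero_norm (fun L => ?_) hE
    refine norm_integral_le_of_norm_le_const fun t ht => ?_
    rw [uIoc_of_le (by linarith)] at ht
    have him : |((L : ℂ) + t * Complex.I).im| ≤ Real.pi := by
      simpa using abs_le.2 ⟨ht.1.le, ht.2⟩
    have h1 := hb _ him
    have hre : ((L : ℂ) + t * Complex.I).re = L := by simp
    rw [hre] at h1
    rw [norm_mul]
    gcongr
    rw [Complex.norm_exp]
    gcongr
    refine (Complex.re_le_norm _).trans ?_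
    rw [Complex.norm_exp, hre]
  have hlim1 : Tendsto (fun L => Complex.I * mlArc R G - Complex.I * mlArc L G) atBot
      (𝓝 (Complex.I * mlArc R G - Complex.I * 0)) := (harc.const_mul _).const_sub _
  have hlim2 : Tendsto (fun L => ∫ y in L..R, mlJump G y) atBot (𝓝 (∫ y in Iic R, mlJump G y)) :=
    intervalIntegral_tendsto_integral_Iic R hint.integrableOn tendsto_id
  have heq := tendsto_nhds_unique (hlim1.congr' (by
    filter_upwards [eventually_le_atBot R] with L hL using hrect L hL)) hlim2
  rw [mul_zero, sub_zero] at heq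
  unfold mlH
  rw [heq, ← integral_Iic_add_Ioi hint.integrableOn hint.integrableOn]
/-- The power function `ζ ^ (1 - z)` in logarithmic coordinates. -/
noncomputable def mlPow (z : ℝ) (w : ℂ) : ℂ := Complex.exp (((1 - z : ℝ) : ℂ) * w)

theorem ml_jump_pow (z y : ℝ) : mlJump (mlPow z) y =
    2 * Complex.I * ((Real.sin (Real.pi * z) : ℝ) : ℂ) *
      ((Real.exp (-Real.exp y) * Real.exp ((1 - z) * y) : ℝ) : ℂ) := by
  have h1 : ∀ p : ℝ, mlPow z (y + p * Complex.I) = ((Real.exp ((1 - z) * y) : ℝ) : ℂ) *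
      (((Real.cos ((1 - z) * p) : ℝ) : ℂ) + ((Real.sin ((1 - z) * p) : ℝ) : ℂ) * Complex.I) := by
    intro p
    unfold mlPow
    rw [mul_add, Complex.exp_add, ← mul_assoc, ← Complex.ofReal_mul, ← Complex.ofReal_mul,
      Complex.exp_mul_I]
    push_cast; rfl
  unfold mlJump
  rw [h1, h1]
  have h2 : (1 - z) * -Real.pi = -((1 - z) * Real.pi) := by ring
  have h3 : Real.sin ((1 - z) * Real.pi) = Real.sin (Real.pi * z) := by
    rw [show (1 - z) * Real.pi = Real.pi - Real.pi * z by ring, Real.sin_pi_sub]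
  rw [h2, Real.cos_neg, Real.sin_neg, h3]
  push_cast; ring

theorem ml_H_pow_lt (R z : ℝ) (hz : z < 1) :
    mlH R (mlPow z) = 2 * Real.pi * Complex.I / ((Real.Gamma z : ℝ) : ℂ) := by
  have hc : 0 < 1 - z := by linarith
  rw [(ml_cauchy R (1 - z) 1 hc (mlPow z) ?_ ?_).2]
  · simp only [ml_jump_pow]
    rw [MeasureTheory.integral_const_mul, integral_complex_ofReal, (ml_gamma_int _ hc).2]
    have h := Real.Gamma_mul_Gamma_one_sub z
    have hG1 : Real.Gamma (1 - z) ≠ 0 := (Real.Gamma_pos_of_pos hc).ne'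
    by_cases hG : Real.Gamma z = 0
    · have : Real.sin (Real.pi * z) = 0 := by
        rw [hG, zero_mul] at h
        rcases div_eq_zero_iff.1 h.symm with h | h
        · exact absurd h Real.pi_ne_zero
        · exact h
      simp [hG, this]
    · have hs : Real.sin (Real.pi * z) ≠ 0 := by
        intro h0
        rw [h0, div_zero] at h
        exact mul_ne_zero hG hG1 h
      have h' : Real.sin (Real.pi * z) * Real.Gamma (1 - z) = Real.pi / Real.Gamma z := by
        rw [eq_div_iff hs] at h
        rw [eq_div_iff hG]
        linarith
      rw [mul_assoc, ← Complex.ofReal_mul, h']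
      push_cast; ring
  · intro w _
    unfold mlPow
    fun_prop
  · intro w _
    unfold mlPow
    rw [Complex.norm_exp, Complex.re_ofReal_mul, one_mul]

theorem ml_H_pow_one (R : ℝ) :
    mlH R (mlPow 1) = 2 * Real.pi * Complex.I / ((Real.Gamma 1 : ℝ) : ℂ) := by
  have hav : Real.circleAverage Complex.exp 0 (Real.exp R) = Complex.exp 0 := by
    refine circleAverage_of_differentiable_on_off_countable (s := ∅) (by simp)
      (by fun_prop) (fun z _ => by fun_prop)
  have h1 : mlArc R (mlPow 1) = 2 * Real.pi := by
    have e : ∀ t : ℝ, Complex.exp (Complex.exp (R + t * Complex.I)) * mlPow 1 (R + t * Complex.I)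
        = Complex.exp (circleMap 0 (Real.exp R) t) := by
      intro t
      simp [mlPow, circleMap, Complex.exp_add]
    unfold mlArc
    simp only [e]
    have hper : Function.Periodic (fun t => Complex.exp (circleMap 0 (Real.exp R) t))
        (2 * Real.pi) := fun t => by
      simp only [periodic_circleMap 0 (Real.exp R) t]
    have := hper.intervalIntegral_add_eq (-Real.pi) 0
    rw [show -Real.pi + 2 * Real.pi = Real.pi by ring, zero_add] at this
    rw [this]
    rw [Real.circleAverage_def, Complex.exp_zero] at hav
    rw [Complex.real_smul] at hav
    have hp : (Real.pi : ℂ) ≠ 0 := by exact_mod_cast Real.pi_ne_zero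
    push_cast at hav
    field_simp at hav
    simpa using hav
  unfold mlH
  simp only [ml_jump_pow, h1]
  simp
  ring

theorem ml_H_pow_rec (R z : ℝ) : mlH R (mlPow z) = z * mlH R (mlPow (z + 1)) := by
  -- arc part
  have harc : mlArc R (mlPow z) - z * mlArc R (mlPow (z + 1)) =
      -2 * ((Real.sin (Real.pi * z) * Real.exp (-Real.exp R) * Real.exp (-z * R) : ℝ) : ℂ) := by
    have hder : ∀ t ∈ uIcc (-Real.pi) Real.pi, HasDerivAt
        (fun t : ℝ => -Complex.I * (Complex.exp (Complex.exp (R + t * Complex.I)) *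
          mlPow (z + 1) (R + t * Complex.I)))
        (Complex.exp (Complex.exp (R + t * Complex.I)) * mlPow z (R + t * Complex.I)
          - z * (Complex.exp (Complex.exp (R + t * Complex.I)) *
            mlPow (z + 1) (R + t * Complex.I))) t := by
      intro t _
      have hw : HasDerivAt (fun t : ℝ => (R : ℂ) + t * Complex.I) Complex.I t := by
        simpa using ((Complex.ofRealCLM.hasDerivAt (x := t)).mul_const Complex.I).const_add (R : ℂ)
      have h1 := hw.cexp.cexp
      have h2 := (hw.const_mul (((1 - (z + 1) : ℝ) : ℂ))).cexp
      have h3 := (h1.mul h2).const_mul (-Complex.I)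
      have hz : mlPow z (R + t * Complex.I) =
          Complex.exp (R + t * Complex.I) * mlPow (z + 1) (R + t * Complex.I) := by
        unfold mlPow
        rw [← Complex.exp_add]
        congr 1
        push_cast; ring
      refine h3.congr_deriv ?_
      rw [hz]
      unfold mlPow
      push_cast
      ring_nf
      simp only [Complex.I_sq]
      ring
    have hi := integral_eq_sub_of_hasDerivAt hder
      (Continuous.intervalIntegrable (by unfold mlPow; fun_prop) _ _)
    rw [intervalIntegral.integral_sub
      (Continuous.intervalIntegrable (by unfold mlPow; fun_prop) _ _)
      (Continuous.intervalIntegrable (by unfold mlPow; fun_prop) _ _),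
      intervalIntegral.integral_const_mul] at hi
    unfold mlArc
    rw [hi, ml_expexp_pos, ml_expexp_neg]
    have hj := ml_jump_pow (z + 1) R
    unfold mlJump at hj
    rw [show Real.pi * (z + 1) = Real.pi * z + Real.pi by ring, Real.sin_add_pi,
      show 1 - (z + 1) = -z by ring] at hj
    push_cast at hj ⊢
    linear_combination (-Complex.I) * hj + (2 * Complex.sin (Real.pi * z) *
       Complex.exp (-Complex.exp R) * Complex.exp (-z * R)) * Complex.I_sq
  have htail : (∫ y in Ioi R, Real.exp (-Real.exp y) * Real.exp ((1 - z) * y)) +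
      z * (∫ y in Ioi R, Real.exp (-Real.exp y) * Real.exp ((1 - (z + 1)) * y)) =
      Real.exp (-Real.exp R) * Real.exp (-z * R) := by
    have hder : ∀ y ∈ Ici R, HasDerivAt
        (fun y : ℝ => -(Real.exp (-Real.exp y) * Real.exp (-z * y)))
        (Real.exp (-Real.exp y) * Real.exp ((1 - z) * y) +
          z * (Real.exp (-Real.exp y) * Real.exp ((1 - (z + 1)) * y))) y := by
      intro y _
      have h1 : HasDerivAt (fun y : ℝ => Real.exp (-Real.exp y))
          (Real.exp (-Real.exp y) * -Real.exp y) y := (Real.hasDerivAt_exp y).neg.exp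
      have h2 := ((hasDerivAt_id y).const_mul (-z)).exp
      refine (h1.mul h2).neg.congr_deriv ?_
      have : Real.exp ((1 - z) * y) = Real.exp y * Real.exp (-z * y) := by
        rw [← Real.exp_add]; ring_nf
      rw [this]
      simp only [id]
      ring_nf
    have hlim : Tendsto (fun y : ℝ => -(Real.exp (-Real.exp y) * Real.exp (-z * y))) atTop
        (𝓝 0) := by
      have h := (tendsto_rpow_mul_exp_neg_mul_atTop_nhds_zero (-z) 1 one_pos).comp
        Real.tendsto_exp_atTop
      rw [← neg_zero]
      refine Tendsto.neg (h.congr fun y => ?_)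
      simp only [Function.comp]
      rw [← Real.exp_mul, neg_one_mul, mul_comm, mul_comm y]
    have h := integral_Ioi_of_hasDerivAt_of_tendsto' hder
      ((ml_tail_int _ R).add ((ml_tail_int _ R).const_mul z)) hlim
    rw [integral_add (ml_tail_int _ R) ((ml_tail_int _ R).const_mul z), MeasureTheory.integral_const_mul] at h
    rw [h]; ring
  unfold mlH
  simp only [ml_jump_pow]
  rw [MeasureTheory.integral_const_mul, MeasureTheory.integral_const_mul, integral_complex_ofReal, integral_complex_ofReal]
  rw [show Real.pi * (z + 1) = Real.pi * z + Real.pi by ring, Real.sin_add_pi]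
  rw [mul_assoc, ← htail] at harc
  push_cast at harc ⊢
  linear_combination Complex.I * harc

theorem ml_H_pow (R : ℝ) (n : ℕ) : ∀ z : ℝ, (n : ℝ) < z → z ≤ n + 1 →
    mlH R (mlPow z) = 2 * Real.pi * Complex.I / ((Real.Gamma z : ℝ) : ℂ) := by
  induction n with
  | zero =>
    intro z h0 h1
    rcases eq_or_lt_of_le h1 with h | h
    · have : z = 1 := by simpa using h
      rw [this]; exact ml_H_pow_one R
    · exact ml_H_pow_lt R z (by simpa using h)
  | succ n ih =>
    intro z h0 h1
    push_cast at h0 h1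
    have hn : (0 : ℝ) ≤ n := n.cast_nonneg
    have hz : z - 1 ≠ 0 := by intro h; linarith
    have h := ih (z - 1) (by linarith) (by linarith)
    rw [ml_H_pow_rec, sub_add_cancel] at h
    have hG : Real.Gamma z = (z - 1) * Real.Gamma (z - 1) := by
      have := Real.Gamma_add_one hz
      rwa [sub_add_cancel] at this
    have hG0 : Real.Gamma (z - 1) ≠ 0 := (Real.Gamma_pos_of_pos (by linarith)).ne'
    rw [hG]
    have hz' : ((z - 1 : ℝ) : ℂ) ≠ 0 := by exact_mod_cast hz
    have hG0' : ((Real.Gamma (z - 1) : ℝ) : ℂ) ≠ 0 := by exact_mod_cast hG0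
    rw [Complex.ofReal_mul]
    field_simp at h ⊢
    linear_combination h

theorem ml_H_pow' (R z : ℝ) (hz : 0 < z) :
    mlH R (mlPow z) = 2 * Real.pi * Complex.I / ((Real.Gamma z : ℝ) : ℂ) := by
  have h1 := Nat.ceil_lt_add_one hz.le
  have h2 := Nat.le_ceil z
  have h3 : 0 < ⌈z⌉₊ := Nat.ceil_pos.2 hz
  obtain ⟨n, hn⟩ := Nat.exists_eq_succ_of_ne_zero h3.ne'
  rw [hn] at h1 h2
  push_cast at h1 h2
  exact ml_H_pow R n z (by linarith) (by linarith)

/-- The Mittag-Leffler kernel in logarithmic coordinates. -/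
noncomputable def mlG (a x : ℝ) (w : ℂ) : ℂ :=
  Complex.exp ((a : ℂ) * w) / (Complex.exp ((a : ℂ) * w) + x)

theorem ml_D_pos (a x u : ℝ) (ha0 : 0 < a) (ha1 : a < 1) (hx : 0 < x) :
    0 < u ^ 2 + 2 * x * Real.cos (Real.pi * a) * u + x ^ 2 := by
  have hs : 0 < Real.sin (Real.pi * a) :=
    Real.sin_pos_of_pos_of_lt_pi (by positivity) (by nlinarith [Real.pi_pos])
  have h2 := Real.sin_sq_add_cos_sq (Real.pi * a)
  have : u ^ 2 + 2 * x * Real.cos (Real.pi * a) * u + x ^ 2 =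
      (u + x * Real.cos (Real.pi * a)) ^ 2 + (x * Real.sin (Real.pi * a)) ^ 2 := by
    linear_combination (-x ^ 2) * h2
  rw [this]
  positivity

theorem ml_den (a x : ℝ) (ha0 : 0 < a) (ha1 : a < 1) (hx : 0 < x) (w : ℂ)
    (hw : |w.im| ≤ Real.pi) :
    x * Real.sin (Real.pi * a) ≤ ‖Complex.exp ((a : ℂ) * w) + x‖ := by
  have hpi := Real.pi_pos
  have hcos : Real.cos (Real.pi * a) ≤ Real.cos (a * w.im) := by
    rw [← Real.cos_abs (a * w.im), abs_mul, abs_of_pos ha0]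
    refine Real.cos_le_cos_of_nonneg_of_le_pi (by positivity) (by nlinarith) ?_
    nlinarith
  refine le_of_sq_le_sq ?_ (norm_nonneg _) |> fun h => h
  rw [← Complex.normSq_eq_norm_sq, Complex.normSq_apply]
  have hre : (Complex.exp ((a : ℂ) * w) + x).re =
      Real.exp (a * w.re) * Real.cos (a * w.im) + x := by
    simp [Complex.exp_re]
  have him : (Complex.exp ((a : ℂ) * w) + x).im =
      Real.exp (a * w.re) * Real.sin (a * w.im) := by
    simp [Complex.exp_im]
  rw [hre, him]
  set r := Real.exp (a * w.re) with hr
  have hr0 : 0 < r := Real.exp_pos _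
  have h1 := Real.sin_sq_add_cos_sq (Real.pi * a)
  have h2 := Real.sin_sq_add_cos_sq (a * w.im)
  have h3 : 0 ≤ 2 * x * r * (Real.cos (a * w.im) - Real.cos (Real.pi * a)) := by
    have := sub_nonneg.2 hcos
    positivity
  have h4 : 0 ≤ (r + x * Real.cos (Real.pi * a)) ^ 2 := sq_nonneg _
  have e : (r * Real.cos (a * w.im) + x) * (r * Real.cos (a * w.im) + x) +
      r * Real.sin (a * w.im) * (r * Real.sin (a * w.im)) =
      r ^ 2 + 2 * x * r * Real.cos (a * w.im) + x ^ 2 := by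
    linear_combination r ^ 2 * h2
  have e2 : (x * Real.sin (Real.pi * a)) ^ 2 = x ^ 2 - x ^ 2 * Real.cos (Real.pi * a) ^ 2 := by
    linear_combination x ^ 2 * h1
  rw [e, e2]
  nlinarith

theorem ml_jump_G (a x : ℝ) (ha0 : 0 < a) (ha1 : a < 1) (hx : 0 < x) (y : ℝ) :
    mlJump (mlG a x) y = 2 * Complex.I * ((Real.exp (-Real.exp y) *
      (x * Real.sin (Real.pi * a) * Real.exp (a * y) / (Real.exp (a * y) ^ 2 +
        2 * x * Real.cos (Real.pi * a) * Real.exp (a * y) + x ^ 2)) : ℝ) : ℂ) := by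
  have hD := ml_D_pos a x (Real.exp (a * y)) ha0 ha1 hx
  have hs : 0 < Real.sin (Real.pi * a) :=
    Real.sin_pos_of_pos_of_lt_pi (by positivity) (by nlinarith [Real.pi_pos])
  have h1 : ∀ p : ℝ, Complex.exp ((a : ℂ) * (y + p * Complex.I)) =
      ((Real.exp (a * y) : ℝ) : ℂ) *
      (((Real.cos (p * a) : ℝ) : ℂ) + ((Real.sin (p * a) : ℝ) : ℂ) * Complex.I) := by
    intro p
    rw [mul_add, Complex.exp_add, ← mul_assoc, ← Complex.ofReal_mul, ← Complex.ofReal_mul,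
      Complex.exp_mul_I, mul_comm a p]
    push_cast; rfl
  have hn1 : Complex.exp ((a : ℂ) * (y + Real.pi * Complex.I)) + x ≠ 0 := by
    have := ml_den a x ha0 ha1 hx (y + Real.pi * Complex.I) (by simp [abs_of_pos Real.pi_pos])
    exact norm_pos_iff.1 (lt_of_lt_of_le (by positivity) this)
  have hn2 : Complex.exp ((a : ℂ) * (y + (-Real.pi : ℝ) * Complex.I)) + x ≠ 0 := by
    have := ml_den a x ha0 ha1 hx (y + (-Real.pi : ℝ) * Complex.I)
      (by simp [abs_of_pos Real.pi_pos])
    exact norm_pos_iff.1 (lt_of_lt_of_le (by positivity) this)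
  unfold mlJump mlG
  rw [Complex.ofReal_mul, mul_left_comm]
  congr 1
  have hD' : ((Real.exp (a * y) ^ 2 +
        2 * x * Real.cos (Real.pi * a) * Real.exp (a * y) + x ^ 2 : ℝ) : ℂ) ≠ 0 := by
    exact_mod_cast hD.ne'
  rw [div_sub_div _ _ hn1 hn2, Complex.ofReal_div, mul_div_assoc', div_eq_div_iff
    (mul_ne_zero hn1 hn2) hD']
  rw [h1, h1, neg_mul, Real.cos_neg, Real.sin_neg]
  have h2 : (((Real.sin (Real.pi * a) : ℝ) : ℂ)) ^ 2 + (((Real.cos (Real.pi * a) : ℝ) : ℂ)) ^ 2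
    = 1 := by exact_mod_cast Real.sin_sq_add_cos_sq (Real.pi * a)
  have key : (((Real.exp (a * y) : ℝ) : ℂ) *
      (((Real.cos (Real.pi * a) : ℝ) : ℂ) + ((Real.sin (Real.pi * a) : ℝ) : ℂ) * Complex.I) + x) *
      (((Real.exp (a * y) : ℝ) : ℂ) *
      (((Real.cos (Real.pi * a) : ℝ) : ℂ) + ((-Real.sin (Real.pi * a) : ℝ) : ℂ) * Complex.I) + x)
      = ((Real.exp (a * y) ^ 2 +
        2 * x * Real.cos (Real.pi * a) * Real.exp (a * y) + x ^ 2 : ℝ) : ℂ) := by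
    push_cast at h2 ⊢
    linear_combination (Complex.exp (a * y)) ^ 2 * h2 -
      (Complex.exp (a * y)) ^ 2 * (Complex.sin (Real.pi * a)) ^ 2 * Complex.I_sq
  rw [key]
  congr 1
  push_cast
  ring

theorem ml_geom (a x R : ℝ) (ha0 : 0 < a) (hx : 0 < x)
    (hq : x * Real.exp (-(a * R)) < 1) (w : ℂ) (hw : R ≤ w.re) :
    HasSum (fun k : ℕ => ((-x : ℝ) : ℂ) ^ k * mlPow (1 + a * k) w) (mlG a x w) ∧
    ∀ k : ℕ, ‖((-x : ℝ) : ℂ) ^ k * mlPow (1 + a * k) w‖ ≤ (x * Real.exp (-(a * R))) ^ k := by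
  have e : ∀ k : ℕ, ((-x : ℝ) : ℂ) ^ k * mlPow (1 + a * k) w
      = (((-x : ℝ) : ℂ) * Complex.exp (-(a * w))) ^ k := by
    intro k
    rw [mul_pow, ← Complex.exp_nat_mul]
    unfold mlPow
    congr 2
    push_cast; ring
  have hn : ‖((-x : ℝ) : ℂ) * Complex.exp (-(a * w))‖ ≤ x * Real.exp (-(a * R)) := by
    rw [norm_mul, Complex.norm_real, norm_neg, Real.norm_of_nonneg hx.le, Complex.norm_exp]
    gcongr
    simp only [Complex.neg_re, Complex.re_ofReal_mul]
    nlinarith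
  simp only [e]
  constructor
  · have h := hasSum_geometric_of_norm_lt_one (hn.trans_lt hq)
    have hg : (1 - ((-x : ℝ) : ℂ) * Complex.exp (-(a * w)))⁻¹ = mlG a x w := by
      unfold mlG
      have hne := Complex.exp_ne_zero ((a : ℂ) * w)
      rw [Complex.exp_neg]
      rw [inv_eq_one_div, ← mul_div_mul_left _ _ hne]
      congr 1
      · ring
      · push_cast
        field_simp
        ring
    rwa [hg] at h
  · intro k
    rw [norm_pow]
    gcongr

theorem ml_hasSum (a x R : ℝ) (ha0 : 0 < a) (hx : 0 < x)
    (hq : x * Real.exp (-(a * R)) < 1) :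
    HasSum (fun k : ℕ => ((-x : ℝ) : ℂ) ^ k * mlH R (mlPow (1 + a * k))) (mlH R (mlG a x)) := by
  set q := x * Real.exp (-(a * R)) with hqdef
  have hq0 : 0 ≤ q := by positivity
  have hgs := summable_geometric_of_lt_one hq0 hq
  have harc : HasSum (fun k : ℕ => ((-x : ℝ) : ℂ) ^ k * mlArc R (mlPow (1 + a * k)))
      (mlArc R (mlG a x)) := by
    have e : ∀ k : ℕ, ((-x : ℝ) : ℂ) ^ k * mlArc R (mlPow (1 + a * k)) =
        ∫ t in (-Real.pi)..Real.pi, Complex.exp (Complex.exp (R + t * Complex.I)) *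
          (((-x : ℝ) : ℂ) ^ k * mlPow (1 + a * k) (R + t * Complex.I)) := by
      intro k
      unfold mlArc
      rw [← intervalIntegral.integral_const_mul]
      congr 1
      ext t
      ring
    simp only [e]
    unfold mlArc
    refine intervalIntegral.hasSum_integral_of_dominated_convergence
      (fun k _ => Real.exp (Real.exp R) * q ^ k) ?_ ?_ ?_ ?_ ?_
    · intro k
      exact Continuous.aestronglyMeasurable (by unfold mlPow; fun_prop)
    · intro k
      refine ae_of_all _ fun t _ => ?_
      rw [norm_mul]
      have hre : ((R : ℂ) + t * Complex.I).re = R := by simp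
      have h1 := (ml_geom a x R ha0 hx hq (R + t * Complex.I) hre.ge).2 k
      refine mul_le_mul ?_ h1 (norm_nonneg _) (Real.exp_pos _).le
      rw [Complex.norm_exp]
      gcongr
      refine (Complex.re_le_norm _).trans ?_
      rw [Complex.norm_exp, hre]
    · exact ae_of_all _ fun t _ => hgs.mul_left _
    · exact intervalIntegrable_const
    · refine ae_of_all _ fun t _ => ?_
      exact ((ml_geom a x R ha0 hx hq (R + t * Complex.I) (by simp)).1).mul_left _
  have htail : HasSum (fun k : ℕ => ((-x : ℝ) : ℂ) ^ k * ∫ y in Ioi R, mlJump (mlPow (1 + a * k)) y)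
      (∫ y in Ioi R, mlJump (mlG a x) y) := by
    simp only [← MeasureTheory.integral_const_mul]
    refine MeasureTheory.hasSum_integral_of_dominated_convergence
      (fun k y => 2 * Real.exp (-Real.exp y) * q ^ k) ?_ ?_ ?_ ?_ ?_
    · intro k
      exact Continuous.aestronglyMeasurable (by unfold mlJump mlPow; fun_prop)
    · intro k
      refine (ae_restrict_iff' measurableSet_Ioi).2 (ae_of_all _ fun y hy => ?_)
      have hy' : R ≤ y := le_of_lt hy
      have h1 := (ml_geom a x R ha0 hx hq (y + Real.pi * Complex.I) (by simpa using hy')).2 k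
      have h2 := (ml_geom a x R ha0 hx hq (y + (-Real.pi : ℝ) * Complex.I)
        (by simpa using hy')).2 k
      unfold mlJump
      rw [mul_left_comm, mul_sub, norm_mul, Complex.norm_real,
        Real.norm_of_nonneg (Real.exp_pos _).le]
      calc _ ≤ Real.exp (-Real.exp y) * (q ^ k + q ^ k) := by
            gcongr
            exact (norm_sub_le _ _).trans (add_le_add h1 h2)
        _ = _ := by ring
    · exact ae_of_all _ fun t => hgs.mul_left _
    · simp only [tsum_mul_left]
      have := ml_tail_int 0 R
      simp only [zero_mul, Real.exp_zero, mul_one] at this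
      exact (this.const_mul 2).mul_const _
    · refine (ae_restrict_iff' measurableSet_Ioi).2 (ae_of_all _ fun y hy => ?_)
      have hy' : R ≤ y := le_of_lt hy
      have h1 := (ml_geom a x R ha0 hx hq (y + Real.pi * Complex.I) (by simpa using hy')).1
      have h2 := (ml_geom a x R ha0 hx hq (y + (-Real.pi : ℝ) * Complex.I)
        (by simpa using hy')).1
      unfold mlJump
      refine ((h1.sub h2).mul_left _).congr_fun ?_
      intro k
      ring
  unfold mlH
  refine ((harc.mul_left Complex.I).add htail).congr_fun ?_
  intro k
  ring

theorem ml_repr (a x : ℝ) (ha0 : 0 < a) (ha1 : a < 1) (hx : 0 < x) :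
    Integrable (fun y : ℝ => Real.exp (-Real.exp y) *
      (x * Real.sin (Real.pi * a) * Real.exp (a * y) / (Real.exp (a * y) ^ 2 +
        2 * x * Real.cos (Real.pi * a) * Real.exp (a * y) + x ^ 2))) ∧
    mittagLefflerReal a 1 (-x) = (∫ y : ℝ, Real.exp (-Real.exp y) *
      (x * Real.sin (Real.pi * a) * Real.exp (a * y) / (Real.exp (a * y) ^ 2 +
        2 * x * Real.cos (Real.pi * a) * Real.exp (a * y) + x ^ 2))) / Real.pi := by
  have hs : 0 < Real.sin (Real.pi * a) :=
    Real.sin_pos_of_pos_of_lt_pi (by positivity) (by nlinarith [Real.pi_pos])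
  obtain ⟨R, hR⟩ : ∃ R : ℝ, x * Real.exp (-(a * R)) < 1 := by
    refine ⟨(Real.log x + 1) / a, ?_⟩
    rw [mul_div_cancel₀ _ ha0.ne']
    nth_rewrite 1 [← Real.exp_log hx]
    rw [← Real.exp_add, Real.exp_lt_one_iff]
    linarith
  have hC := ml_cauchy R a (x * Real.sin (Real.pi * a))⁻¹ ha0 (mlG a x) ?_ ?_
  · obtain ⟨hint, hH⟩ := hC
    have hsum := ml_hasSum a x R ha0 hx hR
    rw [hH] at hsum
    have hjump : mlJump (mlG a x) = fun y => _ := funext (ml_jump_G a x ha0 ha1 hx)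
    rw [hjump] at hint hsum
    rw [MeasureTheory.integral_const_mul, integral_complex_ofReal] at hsum
    have hpi : (Real.pi : ℂ) ≠ 0 := by exact_mod_cast Real.pi_ne_zero
    have h2I : (2 * Complex.I : ℂ) ≠ 0 := by simp
    constructor
    · have h := (hint.const_mul (2 * Complex.I)⁻¹).re
      refine h.congr (ae_of_all _ fun y => ?_)
      simp only [inv_mul_cancel_left₀ h2I]
      exact Complex.ofReal_re _
    · have h := hsum.mul_left (2 * Real.pi * Complex.I)⁻¹
      unfold mittagLefflerReal
      refine HasSum.tsum_eq ?_
      rw [← Complex.hasSum_ofReal]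
      rw [Complex.ofReal_div]
      have e1 : ∀ J : ℂ, (2 * Real.pi * Complex.I)⁻¹ * (2 * Complex.I * J) = J / Real.pi := by
        intro J
        have := Complex.I_ne_zero
        field_simp
      rw [e1] at h
      refine h.congr_fun ?_
      intro k
      rw [ml_H_pow' R (1 + a * k) (by positivity)]
      rw [Complex.ofReal_div, Complex.ofReal_pow]
      have := Complex.I_ne_zero
      field_simp
  · intro w hw
    have h := ml_den a x ha0 ha1 hx w hw
    have hne : Complex.exp ((a : ℂ) * w) + x ≠ 0 :=
      norm_pos_iff.1 (lt_of_lt_of_le (by positivity) h)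
    unfold mlG
    exact DifferentiableAt.div (by fun_prop) (by fun_prop) hne
  · intro w hw
    have h := ml_den a x ha0 ha1 hx w hw
    unfold mlG
    rw [norm_div, Complex.norm_exp, Complex.re_ofReal_mul, div_eq_inv_mul]
    gcongr

theorem ml_exp_log (a x : ℝ) (ha0 : 0 < a) (hx : 0 < x) :
    Real.exp (a * (Real.log x / a)) = x ∧ Real.exp (Real.log x / a) = x ^ (1 / a) := by
  constructor
  · rw [mul_div_cancel₀ _ ha0.ne', Real.exp_log hx]
  · rw [Real.rpow_def_of_pos hx]
    ring_nf

theorem ml_lower (a x : ℝ) (ha0 : 0 < a) (ha1 : a < 1) (hx : 0 < x)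
    (hint : Integrable (fun y : ℝ => Real.exp (-Real.exp y) *
      (x * Real.sin (Real.pi * a) * Real.exp (a * y) / (Real.exp (a * y) ^ 2 +
        2 * x * Real.cos (Real.pi * a) * Real.exp (a * y) + x ^ 2)))) :
    Real.exp (-(x ^ (1 / a))) * (Real.pi / 2) ≤ ∫ y : ℝ, Real.exp (-Real.exp y) *
      (x * Real.sin (Real.pi * a) * Real.exp (a * y) / (Real.exp (a * y) ^ 2 +
        2 * x * Real.cos (Real.pi * a) * Real.exp (a * y) + x ^ 2)) := by
  have hpi := Real.pi_pos
  have hs : 0 < Real.sin (Real.pi * a) :=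
    Real.sin_pos_of_pos_of_lt_pi (by positivity) (by nlinarith)
  obtain ⟨hY1, hY2⟩ := ml_exp_log a x ha0 hx
  set Y := Real.log x / a with hY
  set θ := Real.pi * a with hθ
  have hD : ∀ y : ℝ, 0 < Real.exp (a * y) ^ 2 +
        2 * x * Real.cos θ * Real.exp (a * y) + x ^ 2 :=
    fun y => ml_D_pos a x (Real.exp (a * y)) ha0 ha1 hx
  have hk0 : ∀ y : ℝ, 0 ≤ x * Real.sin θ * Real.exp (a * y) / (Real.exp (a * y) ^ 2 +
        2 * x * Real.cos θ * Real.exp (a * y) + x ^ 2) := fun y => by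
    have := hD y
    positivity
  have hptw : ∀ y ∈ Iic Y, Real.exp (-(x ^ (1 / a))) *
      (x * Real.sin θ * Real.exp (a * y) / (Real.exp (a * y) ^ 2 +
        2 * x * Real.cos θ * Real.exp (a * y) + x ^ 2)) ≤ Real.exp (-Real.exp y) *
      (x * Real.sin θ * Real.exp (a * y) / (Real.exp (a * y) ^ 2 +
        2 * x * Real.cos θ * Real.exp (a * y) + x ^ 2)) := by
    intro y hy
    refine mul_le_mul_of_nonneg_right ?_ (hk0 y)
    rw [← hY2]
    exact Real.exp_le_exp.2 (neg_le_neg (Real.exp_le_exp.2 hy))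
  have hcont : Continuous fun y : ℝ => x * Real.sin θ * Real.exp (a * y) / (Real.exp (a * y) ^ 2 +
        2 * x * Real.cos θ * Real.exp (a * y) + x ^ 2) :=
    Continuous.div (by fun_prop) (by fun_prop) fun y => (hD y).ne'
  have hkint : IntegrableOn (fun y : ℝ => x * Real.sin θ * Real.exp (a * y) /
      (Real.exp (a * y) ^ 2 + 2 * x * Real.cos θ * Real.exp (a * y) + x ^ 2)) (Iic Y) := by
    refine Integrable.mono' ((hint.integrableOn (s := Iic Y)).const_mul
      (Real.exp (x ^ (1 / a)))) hcont.aestronglyMeasurable ?_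
    refine (ae_restrict_iff' measurableSet_Iic).2 (ae_of_all _ fun y hy => ?_)
    rw [Real.norm_of_nonneg (hk0 y)]
    have h := mul_le_mul_of_nonneg_left (hptw y hy) (Real.exp_pos (x ^ (1 / a))).le
    rwa [← mul_assoc, ← Real.exp_add, add_neg_cancel, Real.exp_zero, one_mul] at h
  have hsq := Real.sin_sq_add_cos_sq θ
  have hder : ∀ y ∈ Iic Y, HasDerivAt
      (fun y : ℝ => (1 / a) * Real.arctan ((Real.exp (a * y) + x * Real.cos θ) / (x * Real.sin θ)))
      (x * Real.sin θ * Real.exp (a * y) / (Real.exp (a * y) ^ 2 +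
        2 * x * Real.cos θ * Real.exp (a * y) + x ^ 2)) y := by
    intro y _
    have h1 : HasDerivAt (fun y : ℝ => Real.exp (a * y)) (Real.exp (a * y) * (a * 1)) y :=
      ((hasDerivAt_id y).const_mul a).exp
    have h2 := (((h1.add_const (x * Real.cos θ)).div_const (x * Real.sin θ)).arctan).const_mul
      (1 / a)
    refine h2.congr_deriv ?_
    have e : 1 + ((Real.exp (a * y) + x * Real.cos θ) / (x * Real.sin θ)) ^ 2 =
        (Real.exp (a * y) ^ 2 + 2 * x * Real.cos θ * Real.exp (a * y) + x ^ 2) /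
          (x * Real.sin θ) ^ 2 := by
      rw [eq_div_iff (by positivity)]
      field_simp
      linear_combination x ^ 2 * hsq
    rw [e]
    have := (hD y).ne'
    field_simp
  have hlim : Tendsto
      (fun y : ℝ => (1 / a) * Real.arctan ((Real.exp (a * y) + x * Real.cos θ) / (x * Real.sin θ)))
      atBot (𝓝 ((1 / a) * Real.arctan ((0 + x * Real.cos θ) / (x * Real.sin θ)))) := by
    have h2 : Tendsto (fun L : ℝ => Real.exp (a * L)) atBot (𝓝 0) :=
        Real.tendsto_exp_atBot.comp (tendsto_id.const_mul_atBot ha0)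
    exact ((Real.continuous_arctan.tendsto _).comp
      ((h2.add_const _).div_const _)).const_mul _
  have hI := integral_Iic_of_hasDerivAt_of_tendsto' hder hkint hlim
  have hval : ∫ y in Iic Y, x * Real.sin θ * Real.exp (a * y) / (Real.exp (a * y) ^ 2 +
        2 * x * Real.cos θ * Real.exp (a * y) + x ^ 2) = Real.pi / 2 := by
    rw [hI, hY1]
    have hθ1 : 0 < θ := by positivity
    have hθ2 : θ < Real.pi := by rw [hθ]; nlinarith
    have t1 : (x + x * Real.cos θ) / (x * Real.sin θ) = Real.tan (Real.pi / 2 - θ / 2) := by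
      have h2 : 0 < Real.sin (θ / 2) :=
        Real.sin_pos_of_pos_of_lt_pi (by linarith) (by linarith)
      have h3 : 0 < Real.cos (θ / 2) :=
        Real.cos_pos_of_mem_Ioo ⟨by linarith, by linarith⟩
      rw [Real.tan_eq_sin_div_cos, Real.sin_pi_div_two_sub, Real.cos_pi_div_two_sub,
        div_eq_div_iff (by positivity) h2.ne']
      have e1 : Real.sin θ = 2 * Real.sin (θ / 2) * Real.cos (θ / 2) := by
        rw [← Real.sin_two_mul]; ring_nf
      have e2 : Real.cos θ = 2 * Real.cos (θ / 2) ^ 2 - 1 := by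
        rw [← Real.cos_two_mul]; ring_nf
      rw [e1, e2]; ring
    have t2 : (0 + x * Real.cos θ) / (x * Real.sin θ) = Real.tan (Real.pi / 2 - θ) := by
      rw [Real.tan_eq_sin_div_cos, Real.sin_pi_div_two_sub, Real.cos_pi_div_two_sub, zero_add,
        mul_div_mul_left _ _ hx.ne']
    rw [t1, t2, Real.arctan_tan (by linarith) (by linarith),
      Real.arctan_tan (by linarith) (by linarith)]
    rw [hθ]
    field_simp
    ring
  rw [← hval, ← MeasureTheory.integral_const_mul]
  calc _ ≤ ∫ y in Iic Y, Real.exp (-Real.exp y) *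
      (x * Real.sin θ * Real.exp (a * y) / (Real.exp (a * y) ^ 2 +
        2 * x * Real.cos θ * Real.exp (a * y) + x ^ 2)) :=
        setIntegral_mono_on (hkint.const_mul _) hint.integrableOn measurableSet_Iic hptw
    _ ≤ _ := setIntegral_le_integral hint
        (ae_of_all _ fun y => mul_nonneg (Real.exp_pos _).le (hk0 y))

theorem ml_upper (a x : ℝ) (ha0 : 0 < a) (ha2 : a < 1 / 2) (hx : 0 < x)
    (hint : Integrable (fun y : ℝ => Real.exp (-Real.exp y) *
      (x * Real.sin (Real.pi * a) * Real.exp (a * y) / (Real.exp (a * y) ^ 2 +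
        2 * x * Real.cos (Real.pi * a) * Real.exp (a * y) + x ^ 2)))) :
    (∫ y : ℝ, Real.exp (-Real.exp y) *
      (x * Real.sin (Real.pi * a) * Real.exp (a * y) / (Real.exp (a * y) ^ 2 +
        2 * x * Real.cos (Real.pi * a) * Real.exp (a * y) + x ^ 2))) ≤
    Real.sin (Real.pi * a) / x * Real.Gamma a - Real.exp (-(x ^ (1 / a))) *
      Real.sin (Real.pi * a) * Real.cos (Real.pi * a) / (2 * a * (1 + Real.cos (Real.pi * a))) := by
  have hpi := Real.pi_pos
  have hs : 0 < Real.sin (Real.pi * a) :=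
    Real.sin_pos_of_pos_of_lt_pi (by positivity) (by nlinarith)
  have hc : 0 < Real.cos (Real.pi * a) :=
    Real.cos_pos_of_mem_Ioo ⟨by nlinarith, by nlinarith⟩
  obtain ⟨hY1, hY2⟩ := ml_exp_log a x ha0 hx
  set Y := Real.log x / a with hY
  set s := Real.sin (Real.pi * a) with hsdef
  set c := Real.cos (Real.pi * a) with hcdef
  obtain ⟨hgi, hgv⟩ := ml_gamma_int a ha0
  have hD : ∀ y : ℝ, 0 < Real.exp (a * y) ^ 2 + 2 * x * c * Real.exp (a * y) + x ^ 2 :=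
    fun y => by positivity
  have hdiff := (hgi.const_mul (s / x)).sub hint
  have hk : ∀ y : ℝ, s / x * (Real.exp (-Real.exp y) * Real.exp (a * y)) -
      Real.exp (-Real.exp y) * (x * s * Real.exp (a * y) / (Real.exp (a * y) ^ 2 +
        2 * x * c * Real.exp (a * y) + x ^ 2)) =
      Real.exp (-Real.exp y) * (s / x * Real.exp (a * y) * ((Real.exp (a * y) ^ 2 +
        2 * x * c * Real.exp (a * y)) / (Real.exp (a * y) ^ 2 +
        2 * x * c * Real.exp (a * y) + x ^ 2))) := by
    intro y
    have := (hD y).ne'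
    field_simp
    ring
  have hEint : IntegrableOn (fun y : ℝ => Real.exp ((2 * a) * y)) (Iic Y) :=
    integrableOn_exp_mul_Iic (by positivity) Y
  have hEval : ∫ y in Iic Y, Real.exp ((2 * a) * y) = x ^ 2 / (2 * a) := by
    rw [integral_exp_mul_Iic (by positivity), ← hY1, ← Real.exp_nat_mul]
    push_cast; ring_nf
  have hptw : ∀ y ∈ Iic Y, Real.exp (-(x ^ (1 / a))) * (s * c / (x ^ 2 * (1 + c))) *
      Real.exp ((2 * a) * y) ≤ s / x * (Real.exp (-Real.exp y) * Real.exp (a * y)) -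
      Real.exp (-Real.exp y) * (x * s * Real.exp (a * y) / (Real.exp (a * y) ^ 2 +
        2 * x * c * Real.exp (a * y) + x ^ 2)) := by
    intro y hy
    have hy' : y ≤ Y := hy
    rw [hk, mul_assoc]
    have hu : Real.exp (a * y) ≤ x := by
      rw [← hY1]
      exact Real.exp_le_exp.2 (mul_le_mul_of_nonneg_left hy' ha0.le)
    have hE : Real.exp ((2 * a) * y) = Real.exp (a * y) ^ 2 := by
      rw [← Real.exp_nat_mul]; push_cast; ring_nf
    rw [hE]
    have hDy := hD y
    have hu0 : 0 < Real.exp (a * y) := Real.exp_pos _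
    set u := Real.exp (a * y) with hudef
    refine mul_le_mul ?_ ?_ (by positivity) (Real.exp_pos _).le
    · rw [← hY2]
      exact Real.exp_le_exp.2 (neg_le_neg (Real.exp_le_exp.2 hy'))
    · calc s * c / (x ^ 2 * (1 + c)) * u ^ 2
          = s / x * u * (2 * x * c * u / (2 * x ^ 2 * (1 + c))) := by
            field_simp
        _ ≤ s / x * u * ((u ^ 2 + 2 * x * c * u) / (u ^ 2 + 2 * x * c * u + x ^ 2)) := by
            refine mul_le_mul_of_nonneg_left ?_ (by positivity)
            refine div_le_div₀ (by positivity) (by nlinarith [sq_nonneg u]) hDy ?_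
            have h1 : u ^ 2 ≤ x ^ 2 := by gcongr
            have h2 : x * c * u ≤ x * c * x := by gcongr
            nlinarith
  have hmain : Real.exp (-(x ^ (1 / a))) * (s * c / (x ^ 2 * (1 + c))) * (x ^ 2 / (2 * a)) ≤
      s / x * Real.Gamma a - ∫ y : ℝ, Real.exp (-Real.exp y) *
      (x * s * Real.exp (a * y) / (Real.exp (a * y) ^ 2 +
        2 * x * c * Real.exp (a * y) + x ^ 2)) := by
    rw [← hgv, ← MeasureTheory.integral_const_mul (s / x), ← MeasureTheory.integral_sub
      (hgi.const_mul (s / x)) hint, ← hEval, ← MeasureTheory.integral_const_mul]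
    refine (setIntegral_mono_on (hEint.const_mul _) hdiff.integrableOn
      measurableSet_Iic hptw).trans (setIntegral_le_integral hdiff (ae_of_all _ fun y => ?_))
    simp only [Pi.sub_apply, Pi.zero_apply]
    rw [hk]
    have := hD y
    positivity
  have e : Real.exp (-(x ^ (1 / a))) * (s * c / (x ^ 2 * (1 + c))) * (x ^ 2 / (2 * a)) =
      Real.exp (-(x ^ (1 / a))) * s * c / (2 * a * (1 + c)) := by
    field_simp
  linarith

end MLaux

open MLaux

/-- Bounds for `E_a(−x)`: for `0 < a < 1` and `x > 0`, `E_a(−x) ≥ (1/2) e^{−x^{1/a}}`;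
and if moreover `a < 1/2`, then
`E_a(−x) ≤ sin(πa) Γ(a)/(π x) − (e^{−x^{1/a}}/(4aπ)) sin(2πa)/(1 + cos(πa))`. -/
theorem mittagLeffler_neg_bounds (a x : ℝ) (ha0 : 0 < a) (ha1 : a < 1) (hx : 0 < x) :
    (1 / 2) * Real.exp (-(x ^ (1 / a))) ≤ mittagLefflerReal a 1 (-x) ∧
    (a < 1 / 2 →
      mittagLefflerReal a 1 (-x)
        ≤ Real.sin (Real.pi * a) * Real.Gamma a / (Real.pi * x)
          - (Real.exp (-(x ^ (1 / a))) / (4 * a * Real.pi)) *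
              (Real.sin (2 * Real.pi * a) / (1 + Real.cos (Real.pi * a)))) := by
  have hpi := Real.pi_pos
  obtain ⟨hint, hrep⟩ := ml_repr a x ha0 ha1 hx
  rw [hrep]
  have hs : 0 < Real.sin (Real.pi * a) :=
    Real.sin_pos_of_pos_of_lt_pi (by positivity) (by nlinarith)
  have hl := ml_lower a x ha0 ha1 hx
  refine ⟨?_, fun ha2 => ?_⟩
  · rw [le_div_iff₀ hpi]
    exact (by linarith [hl hint])
  · have hu := ml_upper a x ha0 ha2 hx hint
    have hc : 0 < Real.cos (Real.pi * a) :=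
      Real.cos_pos_of_mem_Ioo ⟨by nlinarith, by nlinarith⟩
    rw [div_le_iff₀ hpi, show 2 * Real.pi * a = 2 * (Real.pi * a) by ring, Real.sin_two_mul]
    refine hu.trans (le_of_eq ?_)
    field_simp
    ring
end
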